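/- Let n ≥ 2 and let Ω ⊂ ℝ^{n+1} be a corkscrew domain whose boundary ∂Ω is n-AD-regular, and let μ = Hⁿ|_{∂Ω}. Suppose that for some p ∈ [2,∞) there exists a constant C_p > 0 such that ‖Su‖_{L^p(μ)} ≤ C_p ‖N_*u‖_{L^p(μ)} for every function u which is continuous on the closure of Ω, vanishes at infinity, and is harmonic in Ω. Then there exists C > 0 such that every such function u satisfies ∫_B |∇u(x)|² dist(x,∂Ω) dx ≤ C ‖u‖²_{L^∞(Ω)} r(B)ⁿ for every ball B centered at a point of ∂Ω. -/

import Mathlib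

open Metric MeasureTheory Set Filter
open scoped ENNReal NNReal Topology

noncomputable section

/-- `E ⊂ ℝ^d` is `n`-AD-regular with constant `c₀`. -/
def ADRegularWith (c₀ : ℝ) (n : ℕ) {d : ℕ} (E : Set (EuclideanSpace ℝ (Fin d))) : Prop :=
  ∀ x ∈ E, ∀ r : ℝ, 0 < r → ENNReal.ofReal r ≤ EMetric.diam E →
    ENNReal.ofReal (c₀⁻¹ * r ^ n) ≤ μH[(n : ℝ)] (ball x r ∩ E) ∧
      μH[(n : ℝ)] (ball x r ∩ E) ≤ ENNReal.ofReal (c₀ * r ^ n)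

/-- `E ⊂ ℝ^d` is `n`-AD-regular. -/
def ADRegular (n : ℕ) {d : ℕ} (E : Set (EuclideanSpace ℝ (Fin d))) : Prop :=
  ∃ c₀ : ℝ, 0 < c₀ ∧ ADRegularWith c₀ n E

/-- `E ⊂ ℝ^d` is uniformly `n`-rectifiable. -/
def UniformlyRectifiable (n : ℕ) {d : ℕ} (E : Set (EuclideanSpace ℝ (Fin d))) : Prop :=
  ADRegular n E ∧
    ∃ (θ : ℝ) (M : ℝ≥0), 0 < θ ∧ 0 < M ∧
      ∀ x ∈ E, ∀ r : ℝ, 0 < r → ENNReal.ofReal r ≤ EMetric.diam E →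
        ∃ g : EuclideanSpace ℝ (Fin n) → EuclideanSpace ℝ (Fin d),
          LipschitzWith M g ∧
            ENNReal.ofReal (θ * r ^ n) ≤ μH[(n : ℝ)] (E ∩ ball x r ∩ (g '' ball 0 r))

/-- `Ω ⊂ ℝ^d` is a corkscrew domain. -/
def Corkscrew {d : ℕ} (Ω : Set (EuclideanSpace ℝ (Fin d))) : Prop :=
  ∃ c : ℝ, 0 < c ∧
    ∀ x ∈ frontier Ω, ∀ r : ℝ, 0 < r → ENNReal.ofReal r ≤ EMetric.diam Ω →
      ∃ (x' : EuclideanSpace ℝ (Fin d)) (r' : ℝ),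
        c * r ≤ r' ∧ ball x' r' ⊆ Ω ∩ ball x r

/-- `u` is harmonic on `Ω`: it is `C²` there and its Laplacian vanishes. -/
def IsHarmonicOn {d : ℕ} (u : EuclideanSpace ℝ (Fin d) → ℝ)
    (Ω : Set (EuclideanSpace ℝ (Fin d))) : Prop :=
  ContDiffOn ℝ 2 u Ω ∧
    ∀ x ∈ Ω, (∑ i : Fin d,
      fderiv ℝ (fun y => fderiv ℝ u y (EuclideanSpace.single i (1 : ℝ))) x
        (EuclideanSpace.single i (1 : ℝ))) = 0

/-- `u` is `ε`-approximable on `Ω` (with the `W^{1,1}_loc` competitor `φ`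
encoded via its distributional gradient `F`). -/
def EpsApprox (n : ℕ) {d : ℕ} (Ω : Set (EuclideanSpace ℝ (Fin d)))
    (u : EuclideanSpace ℝ (Fin d) → ℝ) (ε : ℝ) : Prop :=
  ∃ (φ : EuclideanSpace ℝ (Fin d) → ℝ)
    (F : EuclideanSpace ℝ (Fin d) → EuclideanSpace ℝ (Fin d)) (C : ℝ),
    0 < C ∧ LocallyIntegrableOn φ Ω ∧ LocallyIntegrableOn F Ω ∧
    (∀ ψ : EuclideanSpace ℝ (Fin d) → ℝ, ContDiff ℝ (⊤ : ℕ∞) ψ →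
        HasCompactSupport ψ → tsupport ψ ⊆ Ω →
        ∫ x in Ω, φ x • gradient ψ x = -∫ x in Ω, ψ x • F x) ∧
    (∀ x ∈ Ω, |u x - φ x| < ε) ∧
    (∀ x ∈ frontier Ω, ∀ r : ℝ, 0 < r → ∫ y in ball x r ∩ Ω, ‖F y‖ ≤ C * r ^ n)

/-- The nontangential cone `Γ(x)`. -/
def cone {d : ℕ} (Ω : Set (EuclideanSpace ℝ (Fin d))) (x : EuclideanSpace ℝ (Fin d)) :
    Set (EuclideanSpace ℝ (Fin d)) :=
  {y | y ∈ Ω ∧ dist x y < 2 * infDist y (frontier Ω)}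

/-- The nontangential maximal function `N_* u`. -/
def ntMaximal {d : ℕ} (Ω : Set (EuclideanSpace ℝ (Fin d)))
    (u : EuclideanSpace ℝ (Fin d) → ℝ) (x : EuclideanSpace ℝ (Fin d)) : ℝ≥0∞ :=
  ⨆ y ∈ cone Ω x, (‖u y‖₊ : ℝ≥0∞)

/-- The square function `Su`. -/
def sqFun (n : ℕ) {d : ℕ} (Ω : Set (EuclideanSpace ℝ (Fin d)))
    (u : EuclideanSpace ℝ (Fin d) → ℝ) (x : EuclideanSpace ℝ (Fin d)) : ℝ≥0∞ :=
  (∫⁻ y in cone Ω x,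
      (‖gradient u y‖₊ : ℝ≥0∞) ^ 2 *
        ENNReal.ofReal (infDist y (frontier Ω) ^ ((1 : ℝ) - n))) ^ (1 / 2 : ℝ)

/-- `u ∈ C₀(closure Ω)`: continuous on the closure of `Ω` and vanishing at infinity. -/
def MemC0Closure {d : ℕ} (Ω : Set (EuclideanSpace ℝ (Fin d)))
    (u : EuclideanSpace ℝ (Fin d) → ℝ) : Prop :=
  ContinuousOn u (closure Ω) ∧
    Filter.Tendsto u (Filter.cocompact (EuclideanSpace ℝ (Fin d)) ⊓
      Filter.principal (closure Ω)) (nhds 0)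

/-- The suppressed Riesz kernel `K_Φ`. -/
def suppKernel (n : ℕ) {d : ℕ} (Φ : EuclideanSpace ℝ (Fin d) → ℝ)
    (x y : EuclideanSpace ℝ (Fin d)) : EuclideanSpace ℝ (Fin d) :=
  ((dist x y ^ 2 + Φ x * Φ y) ^ (((n : ℝ) + 1) / 2))⁻¹ • (x - y)

/-- The radius function `ρ_ν` associated with a measure `ν` and constant `C₀`. -/
def suppRadius (n : ℕ) {d : ℕ} (C₀ : ℝ) (ν : Measure (EuclideanSpace ℝ (Fin d)))
    (x : EuclideanSpace ℝ (Fin d)) : ℝ :=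
  sSup {r : ℝ | 0 < r ∧ ENNReal.ofReal (C₀ * r ^ n) < ν (ball x r)}

/-- The support of a measure on `ℝ^d`. -/
def measSupport {d : ℕ} (μ : Measure (EuclideanSpace ℝ (Fin d))) :
    Set (EuclideanSpace ℝ (Fin d)) :=
  {x | ∀ r : ℝ, 0 < r → 0 < μ (ball x r)}

/-- A measure `μ` on `ℝ^d` is `n`-AD-regular with constant `c₀`. -/
def ADRegularMeasureWith (c₀ : ℝ) (n : ℕ) {d : ℕ}
    (μ : Measure (EuclideanSpace ℝ (Fin d))) : Prop :=
  ∀ x ∈ measSupport μ, ∀ r : ℝ, 0 < r → ENNReal.ofReal r ≤ EMetric.diam (measSupport μ) →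
    ENNReal.ofReal (c₀⁻¹ * r ^ n) ≤ μ (ball x r) ∧ μ (ball x r) ≤ ENNReal.ofReal (c₀ * r ^ n)

/-- The normalized Newtonian-type potential of `μ` restricted to `B(y₀,r)`. -/
def newtonPot (n : ℕ) {d : ℕ} (μ : Measure (EuclideanSpace ℝ (Fin d)))
    (y₀ : EuclideanSpace ℝ (Fin d)) (r : ℝ) (x : EuclideanSpace ℝ (Fin d)) : ℝ :=
  ∫ y in ball y₀ r, (r * dist x y ^ (n - 1))⁻¹ ∂μ

/-- The auxiliary logarithmic potential in the plane. -/
def logPot (μ : Measure (EuclideanSpace ℝ (Fin 2))) (y₁ y₂ : EuclideanSpace ℝ (Fin 2))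
    (r : ℝ) (x : EuclideanSpace ℝ (Fin 2)) : ℝ :=
  (∫ y in ball y₁ r, (1 / r) * Real.log (1 / dist x y) ∂μ) -
    ((μ (ball y₁ r)).toReal / (μ (ball y₂ r)).toReal) *
      ∫ y in ball y₂ r, (1 / r) * Real.log (1 / dist x y) ∂μ

section Growth

variable {X : Type*} [PseudoMetricSpace X] [MeasurableSpace X] [OpensMeasurableSpace X]

/-- A measure with growth `ν (B(x, ρ)) ≤ c ρ ^ s` integrates `dist x · ^ (-a)` over balls,
`a < s`. -/
lemma exists_lintegral_ball_rpow_le (s : ℕ) (a : ℝ) (ha : 0 < a) (has : a < s) :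
    ∃ C : ℝ, 0 < C ∧ ∀ (ν : Measure X) (c : ℝ), 0 ≤ c →
      (∀ x ρ, 0 < ρ → ν (ball x ρ) ≤ ENNReal.ofReal (c * ρ ^ s)) → ∀ x R, 0 < R →
        ∫⁻ y in ball x R, ENNReal.ofReal (dist x y ^ (-a)) ∂ν ≤
          ENNReal.ofReal (c * (C * R ^ ((s : ℝ) - a))) := by
  set q : ℝ := (1 / 2 : ℝ) ^ ((s : ℝ) - a) with hq
  have hq0 : 0 < q := by positivity
  have hq1 : q < 1 := Real.rpow_lt_one (by norm_num) (by norm_num) (by linarith)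
  refine ⟨2 ^ a * (1 - q)⁻¹, by have := sub_pos.2 hq1; positivity, fun ν c hc hν x R hR => ?_⟩
  have key : ∀ y ∈ ball x R, ENNReal.ofReal (dist x y ^ (-a)) ≤
      ∑' k : ℕ, (ball x ((1 / 2 : ℝ) ^ k * R)).indicator
        (fun _ => ENNReal.ofReal (((1 / 2 : ℝ) ^ (k + 1) * R) ^ (-a))) y := by
    intro y hy
    rcases (dist_nonneg (x := x) (y := y)).eq_or_lt with h0 | h0
    · rw [← h0, Real.zero_rpow (by linarith)]; simp
    have hlt : dist x y / R < 1 := by rw [div_lt_one hR, dist_comm]; exact hy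
    obtain ⟨k, hk1, hk2⟩ := exists_nat_pow_near_of_lt_one (div_pos h0 hR) hlt.le
      (by norm_num : (0 : ℝ) < 1 / 2) (by norm_num)
    rw [lt_div_iff₀ hR] at hk1
    rw [div_le_iff₀ hR] at hk2
    obtain ⟨k, hk1, hk2⟩ : ∃ k : ℕ, (1 / 2 : ℝ) ^ (k + 1) * R ≤ dist x y ∧
        dist x y < (1 / 2 : ℝ) ^ k * R := by
      rcases hk2.lt_or_eq with h | h
      · exact ⟨k, hk1.le, h⟩
      · rcases k with _ | k
        · simp only [pow_zero, one_mul] at h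
          rw [div_lt_one hR] at hlt; linarith
        · refine ⟨k, h.ge, h.trans_lt ?_⟩
          gcongr ?_ * R
          exact pow_lt_pow_right_of_lt_one₀ (by norm_num) (by norm_num) (by omega)
    refine le_trans ?_ (ENNReal.le_tsum k)
    rw [indicator_of_mem (by rwa [mem_ball, dist_comm])]
    exact ENNReal.ofReal_le_ofReal
      (Real.rpow_le_rpow_of_nonpos (by positivity) hk1 (by linarith))
  calc ∫⁻ y in ball x R, ENNReal.ofReal (dist x y ^ (-a)) ∂ν
      ≤ ∫⁻ y in ball x R, ∑' k : ℕ, (ball x ((1 / 2 : ℝ) ^ k * R)).indicator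
        (fun _ => ENNReal.ofReal (((1 / 2 : ℝ) ^ (k + 1) * R) ^ (-a))) y ∂ν :=
        setLIntegral_mono' measurableSet_ball key
    _ ≤ ∫⁻ y, ∑' k : ℕ, (ball x ((1 / 2 : ℝ) ^ k * R)).indicator
        (fun _ => ENNReal.ofReal (((1 / 2 : ℝ) ^ (k + 1) * R) ^ (-a))) y ∂ν :=
        setLIntegral_le_lintegral _ _
    _ = ∑' k : ℕ, ENNReal.ofReal (((1 / 2 : ℝ) ^ (k + 1) * R) ^ (-a)) *
          ν (ball x ((1 / 2 : ℝ) ^ k * R)) := by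
        rw [lintegral_tsum fun k => (measurable_const.indicator measurableSet_ball).aemeasurable]
        congr 1; ext k
        rw [lintegral_indicator_const measurableSet_ball]
    _ ≤ ∑' k : ℕ, ENNReal.ofReal (c * (2 ^ a * R ^ ((s : ℝ) - a)) * q ^ k) := by
        refine ENNReal.tsum_le_tsum fun k => ?_
        refine (mul_le_mul_right (hν x _ (by positivity)) _).trans ?_
        rw [← ENNReal.ofReal_mul (by positivity)]
        refine ENNReal.ofReal_le_ofReal (le_of_eq ?_)
        rw [Real.mul_rpow (by positivity) hR.le, pow_succ, Real.mul_rpow (by positivity)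
          (by positivity), hq, ← Real.rpow_natCast, ← Real.rpow_mul (by norm_num), mul_pow,
          ← Real.rpow_natCast _ k, ← Real.rpow_natCast _ s, ← Real.rpow_natCast R s,
          ← Real.rpow_mul (by norm_num), ← Real.rpow_mul (by norm_num), Real.rpow_sub hR,
          Real.rpow_neg hR.le, show ((s : ℝ) - a) * k = k * -a + k * s by ring,
          Real.rpow_add (by norm_num), Real.rpow_neg (by norm_num),
            Real.div_rpow (by norm_num) (by norm_num),
          Real.one_rpow]
        field_simp
        rw [mul_right_comm, ← Real.mul_rpow (by norm_num) (by norm_num)]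
        norm_num
    _ = ENNReal.ofReal (c * (2 ^ a * (1 - q)⁻¹ * R ^ ((s : ℝ) - a))) := by
        rw [← ENNReal.ofReal_tsum_of_nonneg (fun k => by positivity)
          ((summable_geometric_of_lt_one hq0.le hq1).mul_left _), tsum_mul_left,
          tsum_geometric_of_lt_one hq0.le hq1]
        congr 1; ring

/-- A measure with growth `ν (B(x, ρ)) ≤ c ρ ^ s` integrates `(r / (r + dist · x)) ^ (2 s)`. -/
lemma exists_lintegral_tail_le (s : ℕ) (hs : 0 < s) :
    ∃ C : ℝ, 0 < C ∧ ∀ (ν : Measure X) (c : ℝ), 0 ≤ c →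
      (∀ x ρ, 0 < ρ → ν (ball x ρ) ≤ ENNReal.ofReal (c * ρ ^ s)) → ∀ x r, 0 < r →
        ∫⁻ y, ENNReal.ofReal ((r / (r + dist y x)) ^ (2 * s)) ∂ν ≤
          ENNReal.ofReal (c * (C * r ^ s)) := by
  set q : ℝ := (1 / 2 : ℝ) ^ s with hq
  have hq0 : 0 < q := by positivity
  have hq1 : q < 1 := pow_lt_one₀ (by norm_num) (by norm_num) hs.ne'
  refine ⟨2 ^ s * (1 - q)⁻¹, by have := sub_pos.2 hq1; positivity, fun ν c hc hν x r hr => ?_⟩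
  have key : ∀ y, ENNReal.ofReal ((r / (r + dist y x)) ^ (2 * s)) ≤
      ∑' k : ℕ, (ball x ((2 : ℝ) ^ (k + 1) * r)).indicator
        (fun _ => ENNReal.ofReal ((q ^ k) ^ 2)) y := by
    intro y
    have hd := dist_nonneg (x := y) (y := x)
    obtain ⟨k, hk1, hk2⟩ := exists_nat_pow_near (x := (r + dist y x) / r) (y := (2 : ℝ))
      (by rw [le_div_iff₀ hr]; linarith) (by norm_num)
    rw [le_div_iff₀ hr] at hk1
    rw [div_lt_iff₀ hr] at hk2
    refine le_trans ?_ (ENNReal.le_tsum k)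
    rw [indicator_of_mem (by rw [mem_ball]; linarith)]
    refine ENNReal.ofReal_le_ofReal ?_
    rw [hq, mul_comm 2 s, pow_mul, ← pow_mul _ s k, mul_comm s k, pow_mul _ k s]
    gcongr
    rw [div_le_iff₀ (by positivity), one_div, inv_pow, inv_mul_eq_div, le_div_iff₀ (by positivity)]
    linarith
  calc ∫⁻ y, ENNReal.ofReal ((r / (r + dist y x)) ^ (2 * s)) ∂ν
      ≤ ∫⁻ y, ∑' k : ℕ, (ball x ((2 : ℝ) ^ (k + 1) * r)).indicator
        (fun _ => ENNReal.ofReal ((q ^ k) ^ 2)) y ∂ν := lintegral_mono key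
    _ = ∑' k : ℕ, ENNReal.ofReal ((q ^ k) ^ 2) * ν (ball x ((2 : ℝ) ^ (k + 1) * r)) := by
        rw [lintegral_tsum fun k => (measurable_const.indicator measurableSet_ball).aemeasurable]
        congr 1; ext k
        rw [lintegral_indicator_const measurableSet_ball]
    _ ≤ ∑' k : ℕ, ENNReal.ofReal (c * (2 ^ s * r ^ s) * q ^ k) := by
        refine ENNReal.tsum_le_tsum fun k => ?_
        refine (mul_le_mul_right (hν x _ (by positivity)) _).trans ?_
        rw [← ENNReal.ofReal_mul (by positivity)]
        refine ENNReal.ofReal_le_ofReal (le_of_eq ?_)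
        have : (2 : ℝ) ^ k * (1 / 2) ^ k = 1 := by rw [← mul_pow]; norm_num
        have h2 : ((2 : ℝ) ^ k) ^ s * q ^ k = 1 := by
          rw [hq, ← pow_mul _ s k, mul_comm s k, pow_mul, ← mul_pow, this, one_pow]
        rw [mul_pow, pow_succ 2 k, mul_pow]
        linear_combination (c * 2 ^ s * r ^ s * q ^ k) * h2
    _ = ENNReal.ofReal (c * (2 ^ s * (1 - q)⁻¹ * r ^ s)) := by
        rw [← ENNReal.ofReal_tsum_of_nonneg (fun k => by positivity)
          ((summable_geometric_of_lt_one hq0.le hq1).mul_left _), tsum_mul_left,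
          tsum_geometric_of_lt_one hq0.le hq1]
        congr 1; ring

end Growth

section Calculus

variable {d : ℕ}

local notation "𝔼" => EuclideanSpace ℝ (Fin d)

/-- The `i`-th partial derivative. -/
def partialDeriv (i : Fin d) (f : 𝔼 → ℝ) (x : 𝔼) : ℝ :=
  fderiv ℝ f x (EuclideanSpace.single i 1)

/-- The Laplacian, as the sum of the pure second partial derivatives. -/
def lap (f : 𝔼 → ℝ) (x : 𝔼) : ℝ := ∑ i, partialDeriv i (partialDeriv i f) x

lemma ContDiffAt.partialDeriv {m k : WithTop ℕ∞} {f : 𝔼 → ℝ} {x : 𝔼} (hf : ContDiffAt ℝ k f x)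
    (hm : m + 1 ≤ k) (i : Fin d) : ContDiffAt ℝ m (partialDeriv i f) x :=
  (hf.fderiv_right hm).clm_apply contDiffAt_const

lemma ContDiff.partialDeriv {m k : WithTop ℕ∞} {f : 𝔼 → ℝ} (hf : ContDiff ℝ k f)
    (hm : m + 1 ≤ k) (i : Fin d) : ContDiff ℝ m (partialDeriv i f) :=
  contDiff_iff_contDiffAt.2 fun _ => hf.contDiffAt.partialDeriv hm i

lemma ContDiffOn.partialDeriv {m k : WithTop ℕ∞} {f : 𝔼 → ℝ} {U : Set 𝔼} (hU : IsOpen U)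
    (hf : ContDiffOn ℝ k f U) (hm : m + 1 ≤ k) (i : Fin d) :
    ContDiffOn ℝ m (partialDeriv i f) U := fun _ hx =>
  ((hf.contDiffAt (hU.mem_nhds hx)).partialDeriv hm i).contDiffWithinAt

lemma ContDiffOn.lap {f : 𝔼 → ℝ} {U : Set 𝔼} (hU : IsOpen U) (hf : ContDiffOn ℝ 2 f U) :
    ContinuousOn (lap f) U :=
  continuousOn_finsetSum _ fun i _ =>
    ((hf.partialDeriv hU (m := 1) (by norm_num) i).partialDeriv hU (m := 0)
      (by norm_num) i).continuousOn

lemma ContDiff.lap {f : 𝔼 → ℝ} (hf : ContDiff ℝ (⊤ : ℕ∞) f) : ContDiff ℝ (⊤ : ℕ∞) (lap f) :=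
  ContDiff.sum fun i _ =>
    (hf.partialDeriv (m := (⊤ : ℕ∞)) le_rfl i).partialDeriv (m := (⊤ : ℕ∞)) le_rfl i

lemma tsupport_partialDeriv_subset (i : Fin d) (f : 𝔼 → ℝ) :
    tsupport (partialDeriv i f) ⊆ tsupport f :=
  tsupport_fderiv_apply_subset ℝ _

lemma HasCompactSupport.partialDeriv {f : 𝔼 → ℝ} (hf : HasCompactSupport f) (i : Fin d) :
    HasCompactSupport (partialDeriv i f) :=
  hf.of_isClosed_subset (isClosed_tsupport _) (tsupport_partialDeriv_subset i f)

lemma Filter.EventuallyEq.partialDeriv {f g : 𝔼 → ℝ} {x : 𝔼} (h : f =ᶠ[𝓝 x] g) (i : Fin d) :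
    partialDeriv i f =ᶠ[𝓝 x] partialDeriv i g := by
  filter_upwards [h.fderiv (𝕜 := ℝ)] with y hy
  simp only [_root_.partialDeriv, hy]

lemma Filter.EventuallyEq.lap_eq {f g : 𝔼 → ℝ} {x : 𝔼} (h : f =ᶠ[𝓝 x] g) :
    lap f x = lap g x :=
  Finset.sum_congr rfl fun i _ => ((h.partialDeriv i).partialDeriv i).eq_of_nhds

lemma lap_eq_zero_of_notMem_tsupport {f : 𝔼 → ℝ} {x : 𝔼} (h : x ∉ tsupport f) : lap f x = 0 :=
  Finset.sum_eq_zero fun i _ => image_eq_zero_of_notMem_tsupport fun hx =>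
    h (tsupport_partialDeriv_subset i f (tsupport_partialDeriv_subset i _ hx))

lemma HasCompactSupport.lap {f : 𝔼 → ℝ} (hf : HasCompactSupport f) :
    HasCompactSupport (lap f) :=
  HasCompactSupport.intro hf fun _ hx => lap_eq_zero_of_notMem_tsupport hx

lemma tsupport_lap_subset (f : 𝔼 → ℝ) : tsupport (lap f) ⊆ tsupport f :=
  closure_minimal (fun x hx => by
    by_contra h; exact hx (lap_eq_zero_of_notMem_tsupport h)) (isClosed_tsupport _)

lemma partialDeriv_comp_add_right (i : Fin d) (f : 𝔼 → ℝ) (a : 𝔼) :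
    partialDeriv i (fun y => f (y + a)) = fun y => partialDeriv i f (y + a) := by
  ext y
  simp only [partialDeriv, fderiv_comp_add_right]

lemma lap_comp_add_right (f : 𝔼 → ℝ) (a : 𝔼) (x : 𝔼) :
    lap (fun y => f (y + a)) x = lap f (x + a) := by
  simp only [lap, partialDeriv_comp_add_right]

lemma partialDeriv_comp_smul (i : Fin d) (f : 𝔼 → ℝ) (c : ℝ) :
    partialDeriv i (fun y => f (c • y)) = fun y => c * partialDeriv i f (c • y) := by
  ext y
  simp only [partialDeriv, fderiv_comp_smul]; simp

lemma partialDeriv_const_mul (i : Fin d) (f : 𝔼 → ℝ) (c : ℝ) :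
    partialDeriv i (fun y => c * f y) = fun y => c * partialDeriv i f y := by
  ext y
  have : (fun y => c * f y) = c • f := rfl
  simp only [partialDeriv, this, fderiv_const_smul_field]; simp

lemma lap_const_mul (f : 𝔼 → ℝ) (c : ℝ) (x : 𝔼) :
    lap (fun y => c * f y) x = c * lap f x := by
  simp only [lap, partialDeriv_const_mul, Finset.mul_sum]

lemma lap_comp_smul (f : 𝔼 → ℝ) (c : ℝ) (x : 𝔼) :
    lap (fun y => f (c • y)) x = c ^ 2 * lap f (c • x) := by
  simp only [lap, partialDeriv_comp_smul, partialDeriv_const_mul, Finset.mul_sum]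
  exact Finset.sum_congr rfl fun i _ => by ring

lemma partialDeriv_add {f g : 𝔼 → ℝ} {x : 𝔼} (hf : DifferentiableAt ℝ f x)
    (hg : DifferentiableAt ℝ g x) (i : Fin d) :
    partialDeriv i (fun y => f y + g y) x = partialDeriv i f x + partialDeriv i g x := by
  simp only [partialDeriv, fderiv_fun_add hf hg]; simp

lemma partialDeriv_mul {f g : 𝔼 → ℝ} {x : 𝔼} (hf : DifferentiableAt ℝ f x)
    (hg : DifferentiableAt ℝ g x) (i : Fin d) :
    partialDeriv i (fun y => f y * g y) x =
      f x * partialDeriv i g x + g x * partialDeriv i f x := by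
  simp only [partialDeriv, fderiv_fun_mul hf hg]; simp

lemma lap_add {f g : 𝔼 → ℝ} (hf : ContDiff ℝ 2 f) (hg : ContDiff ℝ 2 g) (x : 𝔼) :
    lap (fun y => f y + g y) x = lap f x + lap g x := by
  simp only [lap, ← Finset.sum_add_distrib]
  refine Finset.sum_congr rfl fun i _ => ?_
  have h : partialDeriv i (fun y => f y + g y) =
      fun y => partialDeriv i f y + partialDeriv i g y := funext fun y =>
    partialDeriv_add (hf.differentiable (by norm_num) y) (hg.differentiable (by norm_num) y) i
  rw [h, partialDeriv_add
    ((hf.partialDeriv (m := 1) (by norm_num) i).differentiable (by norm_num) x)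
    ((hg.partialDeriv (m := 1) (by norm_num) i).differentiable (by norm_num) x)]

lemma lap_mul {f g : 𝔼 → ℝ} (hf : ContDiff ℝ 2 f) (hg : ContDiff ℝ 2 g) (x : 𝔼) :
    lap (fun y => f y * g y) x =
      f x * lap g x + 2 * ∑ i, partialDeriv i f x * partialDeriv i g x + g x * lap f x := by
  simp only [lap, Finset.mul_sum, ← Finset.sum_add_distrib]
  refine Finset.sum_congr rfl fun i _ => ?_
  have h1 := fun y => hf.differentiable (by norm_num) y
  have h2 := fun y => hg.differentiable (by norm_num) y
  have h3 := fun y =>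
    (hf.partialDeriv (m := 1) (by norm_num) i).differentiable (by norm_num) y
  have h4 := fun y =>
    (hg.partialDeriv (m := 1) (by norm_num) i).differentiable (by norm_num) y
  have h : partialDeriv i (fun y => f y * g y) =
      fun y => f y * partialDeriv i g y + g y * partialDeriv i f y := funext fun y =>
    partialDeriv_mul (h1 y) (h2 y) i
  rw [h, partialDeriv_add ((h1 x).fun_mul (h4 x)) ((h2 x).fun_mul (h3 x)),
    partialDeriv_mul (h1 x) (h4 x),
    partialDeriv_mul (h2 x) (h3 x)]
  ring

lemma partialDeriv_lap {f : 𝔼 → ℝ} (hf : ContDiff ℝ (⊤ : ℕ∞) f) (i : Fin d) (x : 𝔼) :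
    partialDeriv i (lap f) x = lap (partialDeriv i f) x := by
  have hpd : ∀ j {g : 𝔼 → ℝ}, ContDiff ℝ (⊤ : ℕ∞) g → ContDiff ℝ (⊤ : ℕ∞) (partialDeriv j g) :=
    fun j g hg => hg.partialDeriv le_rfl j
  have comm : ∀ j {g : 𝔼 → ℝ}, ContDiff ℝ (⊤ : ℕ∞) g →
      partialDeriv i (partialDeriv j g) = partialDeriv j (partialDeriv i g) := by
    intro j g hg
    ext y
    have hd : DifferentiableAt ℝ (fderiv ℝ g) y :=
      (hg.fderiv_right (m := (⊤ : ℕ∞)) le_rfl).differentiable (by simp) y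
    have hs := (hg.contDiffAt (x := y)).isSymmSndFDerivAt (by
      simp only [minSmoothness_of_isRCLikeNormedField]
      exact WithTop.coe_le_coe.2 (le_top : (2 : ℕ∞) ≤ ⊤))
    have h (v w : 𝔼) : fderiv ℝ (fun y => fderiv ℝ g y v) y w = fderiv ℝ (fderiv ℝ g) y w v := by
      rw [fderiv_clm_apply hd (differentiableAt_const v)]
      simp
    exact (h _ _).trans ((hs _ _).trans (h _ _).symm)
  calc partialDeriv i (lap f) x = ∑ j, partialDeriv i (partialDeriv j (partialDeriv j f)) x := by
        simp only [partialDeriv]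
        rw [show lap f = fun y => ∑ j, partialDeriv j (partialDeriv j f) y from rfl, fderiv_fun_sum
          fun j _ => (hpd j (hpd j hf)).differentiable (by simp) x]
        simp
    _ = lap (partialDeriv i f) x := by
        refine Finset.sum_congr rfl fun j _ => ?_
        rw [comm j (hpd j hf), comm j hf]

lemma integrable_mul_of_tsupport_subset {f g : 𝔼 → ℝ} {U : Set 𝔼} (hU : IsOpen U)
    (hf : ContinuousOn f U) (hg : Continuous g) (hgc : HasCompactSupport g)
    (hgU : tsupport g ⊆ U) : Integrable (fun x => f x * g x) := by
  refine Continuous.integrable_of_hasCompactSupport ?_ hgc.mul_left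
  exact (hf.mul hg.continuousOn).continuous_of_tsupport_subset hU
    ((tsupport_mul_subset_right).trans hgU)

lemma integral_mul_partialDeriv {f g : 𝔼 → ℝ} {U : Set 𝔼} (hU : IsOpen U)
    (hf : ContDiffOn ℝ 1 f U) (hg : ContDiff ℝ 1 g) (hgc : HasCompactSupport g)
    (hgU : tsupport g ⊆ U) (i : Fin d) :
    ∫ x, f x * partialDeriv i g x = -∫ x, partialDeriv i f x * g x := by
  refine integral_mul_fderiv_eq_neg_fderiv_mul_of_integrable ?_ ?_ ?_ ?_ ?_
  · exact integrable_mul_of_tsupport_subset hU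
      (hf.partialDeriv hU (m := 0) (by norm_num) i).continuousOn hg.continuous hgc hgU
  · exact integrable_mul_of_tsupport_subset hU hf.continuousOn
      (hg.partialDeriv (m := 0) (by norm_num) i).continuous (hgc.partialDeriv i)
      ((tsupport_partialDeriv_subset i g).trans hgU)
  · exact integrable_mul_of_tsupport_subset hU hf.continuousOn hg.continuous hgc hgU
  · exact fun x hx => (hf.contDiffAt (hU.mem_nhds (hgU hx))).differentiableAt (by norm_num)
  · exact fun x _ => hg.differentiable (by norm_num) x

/-- Green's second identity against a compactly supported function. -/
lemma integral_mul_lap {f g : 𝔼 → ℝ} {U : Set 𝔼} (hU : IsOpen U)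
    (hf : ContDiffOn ℝ 2 f U) (hg : ContDiff ℝ 2 g) (hgc : HasCompactSupport g)
    (hgU : tsupport g ⊆ U) : ∫ x, f x * lap g x = ∫ x, lap f x * g x := by
  have hf1 := fun i => hf.partialDeriv hU (m := 1) (by norm_num) i
  have hg1 := fun i => hg.partialDeriv (m := 1) (by norm_num) i
  have hgi := fun i => (tsupport_partialDeriv_subset i g).trans hgU
  simp only [lap, Finset.mul_sum, Finset.sum_mul]
  rw [integral_finsetSum, integral_finsetSum]
  · refine Finset.sum_congr rfl fun i _ => ?_
    rw [integral_mul_partialDeriv hU (hf.of_le (by norm_num)) (hg1 i) (hgc.partialDeriv i) (hgi i),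
      integral_mul_partialDeriv hU (hf1 i) (hg.of_le (by norm_num)) hgc hgU, neg_neg]
  · exact fun i _ => integrable_mul_of_tsupport_subset hU
      ((hf1 i).partialDeriv hU (m := 0) (by norm_num) i).continuousOn hg.continuous hgc hgU
  · exact fun i _ => integrable_mul_of_tsupport_subset hU hf.continuousOn
      ((hg1 i).partialDeriv (m := 0) (by norm_num) i).continuous
        ((hgc.partialDeriv i).partialDeriv i)
      ((tsupport_partialDeriv_subset i _).trans (hgi i))

end Calculus

section Kernel

variable {n : ℕ}

local notation "𝔼" => EuclideanSpace ℝ (Fin (n + 1))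

/-- A smooth monotone step from `0` (on `s ≤ 1/2`) to `1` (on `s ≥ 1`). -/
def smoothStep (s : ℝ) : ℝ := Real.smoothTransition (2 * s - 1)

lemma contDiff_smoothStep : ContDiff ℝ (⊤ : ℕ∞) smoothStep :=
  Real.smoothTransition.contDiff.comp (by fun_prop)

lemma smoothStep_of_le {s : ℝ} (hs : s ≤ 1 / 2) : smoothStep s = 0 :=
  Real.smoothTransition.zero_of_nonpos (by linarith)

lemma smoothStep_of_ge {s : ℝ} (hs : 1 ≤ s) : smoothStep s = 1 :=
  Real.smoothTransition.one_of_one_le (by linarith)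

lemma monotone_smoothStep : Monotone smoothStep := fun _ _ h =>
  Real.smoothTransition.monotone (by linarith)

/-- The derivative of `regRadial`. -/
def regRadialDeriv (n : ℕ) (s : ℝ) : ℝ :=
  (1 - n) / 2 * (smoothStep s * s ^ (-((n : ℝ) + 1) / 2))

/-- A smooth function on `ℝ` that agrees with `s ^ ((1 - n) / 2)` for `1 ≤ s`. -/
def regRadial (n : ℕ) (s : ℝ) : ℝ := 1 + ∫ t in (1 : ℝ)..s, regRadialDeriv n t

lemma contDiff_regRadialDeriv : ContDiff ℝ (⊤ : ℕ∞) (regRadialDeriv n) := by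
  refine contDiff_iff_contDiffAt.2 fun s => ?_
  rcases lt_or_ge 0 s with hs | hs
  · exact contDiffAt_const.mul (contDiff_smoothStep.contDiffAt.mul
      (Real.contDiffAt_rpow_const_of_ne hs.ne'))
  · refine (contDiffAt_const (c := (0 : ℝ))).congr_of_eventuallyEq ?_
    filter_upwards [Iio_mem_nhds (show s < 1 / 2 by linarith)] with t ht
    simp [regRadialDeriv, smoothStep_of_le (le_of_lt ht)]

lemma hasDerivAt_regRadial (s : ℝ) : HasDerivAt (regRadial n) (regRadialDeriv n s) s :=
  ((contDiff_regRadialDeriv.continuous.integral_hasStrictDerivAt 1 s).hasDerivAt).const_add 1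

lemma contDiff_regRadial : ContDiff ℝ (⊤ : ℕ∞) (regRadial n) := by
  refine contDiff_infty_iff_deriv.2 ⟨fun s => (hasDerivAt_regRadial s).differentiableAt, ?_⟩
  rw [show deriv (regRadial n) = regRadialDeriv n from
    funext fun s => (hasDerivAt_regRadial s).deriv]
  exact contDiff_regRadialDeriv

lemma regRadial_of_ge (hn : 2 ≤ n) {s : ℝ} (hs : 1 ≤ s) :
    regRadial n s = s ^ ((1 - (n : ℝ)) / 2) := by
  have hn' : (2 : ℝ) ≤ n := by exact_mod_cast hn
  have h : ∫ t in (1 : ℝ)..s, regRadialDeriv n t =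
      ∫ t in (1 : ℝ)..s, (1 - (n : ℝ)) / 2 * t ^ (-((n : ℝ) + 1) / 2) := by
    refine intervalIntegral.integral_congr fun t ht => ?_
    rw [uIcc_of_le hs] at ht
    simp only [regRadialDeriv, smoothStep_of_ge ht.1, one_mul]
  rw [regRadial, h, intervalIntegral.integral_const_mul, integral_rpow, Real.one_rpow,
    show -((n : ℝ) + 1) / 2 + 1 = (1 - n) / 2 by ring]
  · have : (1 - (n : ℝ)) / 2 ≠ 0 := by linarith
    rw [mul_div_cancel₀ _ this]
    ring
  · refine Or.inr ⟨by linarith, ?_⟩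
    rw [uIcc_of_le hs]
    exact fun h => by linarith [h.1]

/-- A smooth radial function on `ℝ^{n+1}` that agrees with `‖z‖ ^ (1 - n)` off the unit ball. -/
def regNewtonUnit (z : 𝔼) : ℝ := regRadial n (‖z‖ ^ 2)

/-- The gradient `∇ ‖z‖ ^ (1 - n)`, in coordinates. -/
def newtonGrad (i : Fin (n + 1)) (z : 𝔼) : ℝ := (1 - n) * (z i * ‖z‖ ^ (-((n : ℝ) + 1)))

/-- The kernel `‖z‖ ^ (1 - n)` smoothed at scale `ε`. -/
def regNewton (ε : ℝ) (z : 𝔼) : ℝ := ε ^ (1 - (n : ℝ)) * regNewtonUnit (ε⁻¹ • z)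

lemma contDiff_regNewtonUnit : ContDiff ℝ (⊤ : ℕ∞) (regNewtonUnit : 𝔼 → ℝ) :=
  contDiff_regRadial.comp (contDiff_norm_sq ℝ)

lemma contDiff_regNewton (ε : ℝ) : ContDiff ℝ (⊤ : ℕ∞) (regNewton ε : 𝔼 → ℝ) :=
  contDiff_const.mul (contDiff_regNewtonUnit.comp (contDiff_const_smul _))

lemma partialDeriv_comp_norm_sq {g : ℝ → ℝ} {g' : ℝ} {z : 𝔼} (hg : HasDerivAt g g' (‖z‖ ^ 2))
    (i : Fin (n + 1)) : partialDeriv i (fun y : 𝔼 => g (‖y‖ ^ 2)) z = g' * (2 * z i) := by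
  have h := hg.comp_hasFDerivAt z (hasStrictFDerivAt_norm_sq z).hasFDerivAt
  have h' : fderiv ℝ (fun y : 𝔼 => g (‖y‖ ^ 2)) z = _ := h.fderiv
  rw [partialDeriv, h']
  simp [EuclideanSpace.inner_single_right]

lemma partialDeriv_coord (i : Fin (n + 1)) (z : 𝔼) :
    partialDeriv i (fun y : 𝔼 => y i) z = 1 := by
  have : (fun y : 𝔼 => y i) = (EuclideanSpace.proj i : 𝔼 →L[ℝ] ℝ) := rfl
  rw [partialDeriv, this, ContinuousLinearMap.fderiv]
  simp

lemma partialDeriv_regNewtonUnit_eq (i : Fin (n + 1)) (z : 𝔼) :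
    partialDeriv i regNewtonUnit z = regRadialDeriv n (‖z‖ ^ 2) * (2 * z i) :=
  partialDeriv_comp_norm_sq (hasDerivAt_regRadial _) i

lemma partialDeriv_regNewtonUnit (i : Fin (n + 1)) (z : 𝔼) :
    partialDeriv i regNewtonUnit z = smoothStep (‖z‖ ^ 2) * newtonGrad i z := by
  rw [partialDeriv_regNewtonUnit_eq, regRadialDeriv, newtonGrad, ← Real.rpow_natCast,
    ← Real.rpow_mul (norm_nonneg _), show ((2 : ℕ) : ℝ) * (-((n : ℝ) + 1) / 2) = -((n : ℝ) + 1) by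
      push_cast; ring]
  ring

lemma lap_regNewtonUnit_eq (z : 𝔼) : lap regNewtonUnit z =
    2 * (n + 1) * regRadialDeriv n (‖z‖ ^ 2) +
      4 * ‖z‖ ^ 2 * deriv (regRadialDeriv n) (‖z‖ ^ 2) := by
  have hd : ∀ s, HasDerivAt (regRadialDeriv n) (deriv (regRadialDeriv n) s) s := fun s =>
    (contDiff_regRadialDeriv.differentiable (by simp) s).hasDerivAt
  have h : ∀ i : Fin (n + 1), partialDeriv i (partialDeriv i regNewtonUnit) z =
      2 * regRadialDeriv n (‖z‖ ^ 2) + 4 * z i ^ 2 * deriv (regRadialDeriv n) (‖z‖ ^ 2) := by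
    intro i
    have hdiff : DifferentiableAt ℝ (fun y : 𝔼 => regRadialDeriv n (‖y‖ ^ 2)) z :=
      (contDiff_regRadialDeriv.differentiable (by simp) _).comp z
        ((contDiff_norm_sq ℝ (n := 1)).differentiable (by simp) z)
    rw [show partialDeriv i (regNewtonUnit : 𝔼 → ℝ) =
      fun z => regRadialDeriv n (‖z‖ ^ 2) * (2 * z i) from funext (partialDeriv_regNewtonUnit_eq i),
      partialDeriv_mul hdiff (by fun_prop),
      partialDeriv_comp_norm_sq (hd _), partialDeriv_const_mul]
    simp only [partialDeriv_coord]
    ring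
  rw [lap, Finset.sum_congr rfl fun i _ => h i, Finset.sum_add_distrib, Finset.sum_const,
    ← Finset.sum_mul, ← Finset.mul_sum, EuclideanSpace.real_norm_sq_eq]
  simp
  ring

lemma lap_regNewtonUnit (z : 𝔼) : lap regNewtonUnit z =
    2 * (1 - n) * (deriv smoothStep (‖z‖ ^ 2) * (‖z‖ ^ 2) ^ ((1 - (n : ℝ)) / 2)) := by
  rw [lap_regNewtonUnit_eq]
  rcases (sq_nonneg ‖z‖).eq_or_lt with hs | hs
  · have h0 : deriv smoothStep 0 = 0 := by
      have : smoothStep =ᶠ[𝓝 0] fun _ => 0 := by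
        filter_upwards [Iio_mem_nhds (show (0 : ℝ) < 1 / 2 by norm_num)] with t ht
        exact smoothStep_of_le (le_of_lt ht)
      rw [this.deriv_eq]; simp
    rw [← hs, h0, regRadialDeriv, smoothStep_of_le (by norm_num)]
    ring
  · set s := ‖z‖ ^ 2
    have h1 : HasDerivAt smoothStep (deriv smoothStep s) s :=
      (contDiff_smoothStep.differentiable (by simp) s).hasDerivAt
    have h2 := (h1.mul (Real.hasDerivAt_rpow_const (p := -((n : ℝ) + 1) / 2)
      (Or.inl hs.ne'))).const_mul ((1 - (n : ℝ)) / 2)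
    have h3 : deriv (regRadialDeriv n) s = _ := h2.deriv
    have e1 : s ^ ((1 - (n : ℝ)) / 2) = s * s ^ (-((n : ℝ) + 1) / 2) := by
      rw [show (1 - (n : ℝ)) / 2 = 1 + -((n : ℝ) + 1) / 2 by ring, Real.rpow_add hs, Real.rpow_one]
    have e2 : s ^ (-((n : ℝ) + 1) / 2) = s * s ^ (-((n : ℝ) + 1) / 2 - 1) := by
      rw [Real.rpow_sub_one hs.ne']; field_simp
    rw [h3, regRadialDeriv, e1]
    linear_combination (2 * (n + 1) * ((1 - n) / 2) * smoothStep s) * e2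

lemma lap_regNewtonUnit_nonpos (hn : 2 ≤ n) (z : 𝔼) : lap regNewtonUnit z ≤ 0 := by
  have hn' : (2 : ℝ) ≤ n := by exact_mod_cast hn
  rw [lap_regNewtonUnit]
  exact mul_nonpos_of_nonpos_of_nonneg (by linarith)
    (mul_nonneg monotone_smoothStep.deriv_nonneg (by positivity))

lemma lap_regNewtonUnit_of_one_le {z : 𝔼} (hz : 1 < ‖z‖) : lap regNewtonUnit z = 0 := by
  have : smoothStep =ᶠ[𝓝 (‖z‖ ^ 2)] fun _ => 1 := by
    filter_upwards [Ioi_mem_nhds (one_lt_pow₀ hz two_ne_zero)] with t ht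
    exact smoothStep_of_ge (le_of_lt ht)
  rw [lap_regNewtonUnit, this.deriv_eq]
  simp

lemma lap_regNewtonUnit_neg (z : 𝔼) : lap regNewtonUnit (-z) = lap regNewtonUnit z := by
  simp only [lap_regNewtonUnit_eq, norm_neg]

lemma tsupport_lap_regNewtonUnit :
    tsupport (lap (regNewtonUnit : 𝔼 → ℝ)) ⊆ closedBall 0 1 :=
  closure_minimal (fun z hz => by
    by_contra h
    exact hz (lap_regNewtonUnit_of_one_le (by simpa using h))) isClosed_closedBall

lemma hasCompactSupport_lap_regNewtonUnit :
    HasCompactSupport (lap (regNewtonUnit : 𝔼 → ℝ)) :=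
  (isCompact_closedBall 0 1).of_isClosed_subset (isClosed_tsupport _) tsupport_lap_regNewtonUnit

/-- The normalising constant of the Newtonian kernel `‖z‖ ^ (1 - n)`. -/
def newtonConst (n : ℕ) : ℝ :=
  ∫ z : EuclideanSpace ℝ (Fin (n + 1)), lap regNewtonUnit z

lemma newtonConst_neg (hn : 2 ≤ n) : newtonConst n < 0 := by
  have hn' : (2 : ℝ) ≤ n := by exact_mod_cast hn
  obtain ⟨s, hs, hs'⟩ := exists_deriv_eq_slope smoothStep (by norm_num : (1 / 2 : ℝ) < 1)
    contDiff_smoothStep.continuous.continuousOn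
    (contDiff_smoothStep.differentiable (by simp)).differentiableOn
  rw [smoothStep_of_ge le_rfl, smoothStep_of_le le_rfl] at hs'
  have hs0 : 0 < s := by linarith [hs.1]
  have h : 0 < ∫ z : 𝔼, -lap regNewtonUnit z := by
    refine Continuous.integral_pos_of_hasCompactSupport_nonneg_nonzero
      (x := EuclideanSpace.single 0 (√s)) contDiff_regNewtonUnit.lap.continuous.neg
      hasCompactSupport_lap_regNewtonUnit.neg
      (fun z => neg_nonneg.2 (lap_regNewtonUnit_nonpos hn z)) ?_
    rw [neg_ne_zero, lap_regNewtonUnit, PiLp.norm_single, Real.norm_eq_abs, sq_abs,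
      Real.sq_sqrt hs0.le, hs']
    have := (Real.rpow_pos_of_pos hs0 ((1 - (n : ℝ)) / 2)).ne'
    have : (1 : ℝ) - n ≠ 0 := by linarith
    positivity
  rw [integral_neg] at h
  exact neg_pos.1 h

lemma regNewton_of_le (hn : 2 ≤ n) {ε : ℝ} (hε : 0 < ε) {z : 𝔼} (hz : ε ≤ ‖z‖) :
    regNewton ε z = ‖z‖ ^ (1 - (n : ℝ)) := by
  have h1 : 1 ≤ ε⁻¹ * ‖z‖ := by rwa [inv_mul_eq_div, one_le_div hε]
  rw [regNewton, regNewtonUnit, norm_smul, Real.norm_of_nonneg (by positivity), regRadial_of_ge hn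
    (one_le_pow₀ h1), ← Real.rpow_natCast, ← Real.rpow_mul (by positivity),
    show ((2 : ℕ) : ℝ) * ((1 - (n : ℝ)) / 2) = 1 - n by push_cast; ring,
    ← Real.mul_rpow hε.le (by positivity), mul_inv_cancel_left₀ hε.ne']

lemma exists_regNewton_le (hn : 2 ≤ n) : ∃ C : ℝ, ∀ ε, 0 < ε → ∀ z : 𝔼, z ≠ 0 →
    |regNewton ε z| ≤ C * ‖z‖ ^ (1 - (n : ℝ)) := by
  have hn' : (2 : ℝ) ≤ n := by exact_mod_cast hn
  obtain ⟨C, hC⟩ := (isCompact_closedBall (0 : 𝔼) 1).exists_bound_of_continuousOn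
    contDiff_regNewtonUnit.continuous.continuousOn
  refine ⟨max C 1, fun ε hε z hz => ?_⟩
  have hz' := norm_pos_iff.2 hz
  rcases le_total ε ‖z‖ with h | h
  · rw [regNewton_of_le hn hε h, abs_of_nonneg (by positivity)]
    exact le_mul_of_one_le_left (by positivity) (le_max_right _ _)
  · rw [regNewton, abs_mul, abs_of_pos (by positivity), mul_comm]
    refine mul_le_mul ((hC _ ?_).trans (le_max_left _ _))
      (Real.rpow_le_rpow_of_nonpos hz' h (by linarith)) (by positivity) (by positivity)
    rw [mem_closedBall_zero_iff, norm_smul, Real.norm_of_nonneg (by positivity), inv_mul_eq_div]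
    exact div_le_one_of_le₀ h hε.le

lemma partialDeriv_regNewton {ε : ℝ} (hε : 0 < ε) (i : Fin (n + 1)) (z : 𝔼) :
    partialDeriv i (regNewton ε) z = smoothStep (‖ε⁻¹ • z‖ ^ 2) * newtonGrad i z := by
  have : (regNewton ε : 𝔼 → ℝ) =
      fun z => ε ^ (1 - (n : ℝ)) * (fun y => regNewtonUnit (ε⁻¹ • y)) z :=
    rfl
  rw [this, partialDeriv_const_mul, partialDeriv_comp_smul]
  simp only [partialDeriv_regNewtonUnit, newtonGrad]
  have h : ‖ε⁻¹ • z‖ ^ (-((n : ℝ) + 1)) = ε ^ ((n : ℝ) + 1) * ‖z‖ ^ (-((n : ℝ) + 1)) := by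
    rw [norm_smul, Real.norm_of_nonneg (by positivity), Real.mul_rpow (by positivity)
      (norm_nonneg _), Real.inv_rpow hε.le, Real.rpow_neg hε.le, inv_inv]
  have h2 : ε ^ (1 - (n : ℝ)) * ε⁻¹ * (ε⁻¹ * ε ^ ((n : ℝ) + 1)) = 1 := by
    rw [Real.rpow_sub hε, Real.rpow_add hε, Real.rpow_one]
    field_simp
  rw [h, PiLp.smul_apply, smul_eq_mul]
  linear_combination (smoothStep (‖ε⁻¹ • z‖ ^ 2) * ((1 - n) * (z i * ‖z‖ ^ (-((n : ℝ) + 1))))) * h2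

lemma lap_regNewton {ε : ℝ} (hε : 0 < ε) (z : 𝔼) :
    lap (regNewton ε) z = (ε ^ (n + 1))⁻¹ * lap regNewtonUnit (ε⁻¹ • z) := by
  have : (regNewton ε : 𝔼 → ℝ) =
      fun z => ε ^ (1 - (n : ℝ)) * (fun y => regNewtonUnit (ε⁻¹ • y)) z :=
    rfl
  rw [this, lap_const_mul, lap_comp_smul, ← mul_assoc]
  congr 1
  rw [Real.rpow_sub hε, Real.rpow_one, Real.rpow_natCast]
  field_simp
  ring

lemma abs_newtonGrad_le (hn : 2 ≤ n) (i : Fin (n + 1)) (z : 𝔼) :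
    |newtonGrad i z| ≤ n * ‖z‖ ^ (-(n : ℝ)) := by
  have hn' : (2 : ℝ) ≤ n := by exact_mod_cast hn
  rcases eq_or_ne z 0 with rfl | hz
  · simp [newtonGrad]; positivity
  have hz' := norm_pos_iff.2 hz
  rw [newtonGrad, abs_mul, abs_mul, abs_of_nonneg (Real.rpow_nonneg (norm_nonneg z) _),
    abs_of_nonpos (by linarith : 1 - (n : ℝ) ≤ 0)]
  refine mul_le_mul (by linarith) ?_ (by positivity) (by positivity)
  calc |z i| * ‖z‖ ^ (-((n : ℝ) + 1)) ≤ ‖z‖ * ‖z‖ ^ (-((n : ℝ) + 1)) := by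
        gcongr
        exact PiLp.norm_apply_le z i
    _ = ‖z‖ ^ (-(n : ℝ)) := by
        rw [← Real.rpow_one_add' hz'.le (by linarith)]; ring_nf

end Kernel

section Potential

/-- The measure `ν` of a ball of radius `ρ` is at most `c ρ ^ s`. -/
def HasGrowth {X : Type*} [PseudoMetricSpace X] [MeasurableSpace X] (ν : Measure X) (c : ℝ)
    (s : ℕ) : Prop :=
  ∀ x ρ, 0 < ρ → ν (ball x ρ) ≤ ENNReal.ofReal (c * ρ ^ s)

lemma HasGrowth.mono {X : Type*} [PseudoMetricSpace X] [MeasurableSpace X] {ν ν' : Measure X}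
    {c : ℝ} {s : ℕ} (h : HasGrowth ν c s) (hν : ν' ≤ ν) : HasGrowth ν' c s :=
  fun x ρ hρ => (hν _).trans (h x ρ hρ)

lemma exists_hasGrowth_volume (n : ℕ) :
    ∃ c : ℝ, 0 < c ∧
      HasGrowth (volume : Measure (EuclideanSpace ℝ (Fin (n + 1)))) c (n + 1) := by
  refine ⟨(volume (ball (0 : EuclideanSpace ℝ (Fin (n + 1))) 1)).toReal,
    ENNReal.toReal_pos (measure_ball_pos _ _ one_pos).ne' measure_ball_lt_top.ne,
    fun x ρ hρ => ?_⟩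
  rw [Measure.addHaar_ball volume x hρ.le, finrank_euclideanSpace_fin, mul_comm,
    ENNReal.ofReal_mul ENNReal.toReal_nonneg, ENNReal.ofReal_toReal measure_ball_lt_top.ne]

variable {X : Type*} [PseudoMetricSpace X] [MeasurableSpace X] [OpensMeasurableSpace X]

lemma exists_lintegral_rpow_le (s : ℕ) (a : ℝ) (ha : 0 < a) (has : a < s) :
    ∃ C : ℝ, 0 < C ∧ ∀ (ν : Measure X) (c R : ℝ), 0 ≤ c → 0 < R → HasGrowth ν c s →
      ν univ ≤ ENNReal.ofReal (c * R ^ s) → ∀ x,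
        ∫⁻ y, ENNReal.ofReal (dist x y ^ (-a)) ∂ν ≤
          ENNReal.ofReal (c * (C * R ^ ((s : ℝ) - a))) := by
  obtain ⟨C, hC, h⟩ := exists_lintegral_ball_rpow_le (X := X) s a ha has
  refine ⟨C + 1, by positivity, fun ν c R hc hR hg hν x => ?_⟩
  rw [← lintegral_add_compl _ (measurableSet_ball (x := x) (ε := R)), add_mul, mul_add c,
    ENNReal.ofReal_add (by positivity) (by positivity)]
  refine add_le_add (h ν c hc hg x R hR) ?_
  calc ∫⁻ y in (ball x R)ᶜ, ENNReal.ofReal (dist x y ^ (-a)) ∂ν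
      ≤ ∫⁻ _ in (ball x R)ᶜ, ENNReal.ofReal (R ^ (-a)) ∂ν := by
        refine setLIntegral_mono' measurableSet_ball.compl fun y hy => ENNReal.ofReal_le_ofReal ?_
        refine Real.rpow_le_rpow_of_nonpos hR ?_ (by linarith)
        simpa [dist_comm] using hy
    _ = ENNReal.ofReal (R ^ (-a)) * ν (ball x R)ᶜ := by
        rw [lintegral_const, Measure.restrict_apply_univ]
    _ ≤ ENNReal.ofReal (R ^ (-a)) * ENNReal.ofReal (c * R ^ s) := by
        gcongr
        exact (measure_mono (subset_univ _)).trans hν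
    _ = _ := by
        rw [← ENNReal.ofReal_mul (by positivity), sub_eq_add_neg, Real.rpow_add hR,
          Real.rpow_natCast]
        ring_nf

lemma exists_abs_integral_le (s : ℕ) (a : ℝ) (ha : 0 < a) (has : a < s) :
    ∃ C : ℝ, 0 < C ∧ ∀ (ν : Measure X) (c R : ℝ), 0 ≤ c → 0 < R → HasGrowth ν c s →
      ν univ ≤ ENNReal.ofReal (c * R ^ s) → ∀ x (k : X → ℝ) (B : ℝ), 0 ≤ B →
        AEStronglyMeasurable k ν → (∀ᵐ y ∂ν, |k y| ≤ B * dist x y ^ (-a)) →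
          Integrable k ν ∧ ∫ y, |k y| ∂ν ≤ B * (c * (C * R ^ ((s : ℝ) - a))) := by
  obtain ⟨C, hC, h⟩ := exists_lintegral_rpow_le (X := X) s a ha has
  refine ⟨C, hC, fun ν c R hc hR hg hν x k B hB hk hkB => ?_⟩
  have h1 : ∫⁻ y, ‖k y‖ₑ ∂ν ≤ ENNReal.ofReal (B * (c * (C * R ^ ((s : ℝ) - a)))) := by
    calc ∫⁻ y, ‖k y‖ₑ ∂ν ≤ ∫⁻ y, ENNReal.ofReal B * ENNReal.ofReal (dist x y ^ (-a)) ∂ν := by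
          refine lintegral_mono_ae (hkB.mono fun y hy => ?_)
          rw [← ENNReal.ofReal_mul hB, Real.enorm_eq_ofReal_abs]
          exact ENNReal.ofReal_le_ofReal hy
      _ ≤ _ := by
          rw [lintegral_const_mul' _ _ ENNReal.ofReal_ne_top, ENNReal.ofReal_mul hB]
          gcongr
          exact h ν c R hc hR hg hν x
  refine ⟨⟨hk, h1.trans_lt ENNReal.ofReal_lt_top⟩, ?_⟩
  rw [integral_eq_lintegral_of_nonneg_ae (ae_of_all _ fun _ => abs_nonneg _) hk.norm]
  refine ENNReal.toReal_le_of_le_ofReal (by positivity) ?_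
  simpa only [Real.enorm_eq_ofReal_abs] using h1

end Potential

section Potential

variable {d : ℕ}

local notation "𝔼" => EuclideanSpace ℝ (Fin d)

/-- A cutoff of a kernel of order `-a` near its singularity. -/
def ramp (t : ℝ) : ℝ := max 0 (min 1 (2 * t - 1))

lemma continuous_ramp : Continuous ramp := by unfold ramp; fun_prop

lemma ramp_of_le {t : ℝ} (ht : t ≤ 1 / 2) : ramp t = 0 :=
  max_eq_left ((min_le_right _ _).trans (by linarith))

lemma ramp_of_ge {t : ℝ} (ht : 1 ≤ t) : ramp t = 1 := by
  rw [ramp, min_eq_left (by linarith), max_eq_right zero_le_one]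

lemma ramp_nonneg (t : ℝ) : 0 ≤ ramp t := le_max_left _ _

lemma ramp_le_one (t : ℝ) : ramp t ≤ 1 := max_le zero_le_one (min_le_left _ _)

/-- Potentials of finite measures with growth against kernels with a weak singularity are
continuous. -/
lemma continuous_potential {s : ℕ} {a : ℝ} (ha : 0 < a) (has : a < s) {ν : Measure 𝔼}
    [IsFiniteMeasure ν] {c : ℝ} (hc : 0 ≤ c) (hg : HasGrowth ν c s) {K : 𝔼 → ℝ}
    (hK : ContinuousOn K {0}ᶜ) {B : ℝ} (hKB : ∀ z, |K z| ≤ B * ‖z‖ ^ (-a))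
    (hKm : Measurable K) {f : 𝔼 → ℝ} (hf : Measurable f) {F : ℝ} (hfF : ∀ y, |f y| ≤ F) :
    Continuous fun x => ∫ y, K (x - y) * f y ∂ν := by
  have hF : 0 ≤ F := (abs_nonneg _).trans (hfF 0)
  have hKB' : ∀ z, |K z| ≤ |B| * ‖z‖ ^ (-a) := fun z =>
    (hKB z).trans (by gcongr; exact le_abs_self B)
  obtain ⟨C, hC, hCb⟩ := exists_lintegral_ball_rpow_le (X := 𝔼) s a ha has
  obtain ⟨C', hC', hCi⟩ := exists_abs_integral_le (X := 𝔼) s a ha has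
  have hcut : ∀ ε > 0, ∀ z, |K z * ramp (‖z‖ / ε)| ≤ |B| * (ε / 2) ^ (-a) := by
    intro ε hε z
    rw [abs_mul, abs_of_nonneg (ramp_nonneg _)]
    rcases le_or_gt ‖z‖ (ε / 2) with h | h
    · rw [ramp_of_le (by rw [div_le_iff₀ hε]; linarith), mul_zero]; positivity
    · calc |K z| * ramp (‖z‖ / ε) ≤ (|B| * ‖z‖ ^ (-a)) * 1 :=
            mul_le_mul (hKB' z) (ramp_le_one _) (ramp_nonneg _) (by positivity)
        _ ≤ _ := by
            rw [mul_one]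
            gcongr ?_ * ?_
            exact Real.rpow_le_rpow_of_nonpos (by positivity) h.le (by linarith)
  have hcutc : ∀ ε > 0, Continuous fun z => K z * ramp (‖z‖ / ε) := by
    intro ε hε
    refine continuous_iff_continuousAt.2 fun z => ?_
    rcases eq_or_ne z 0 with rfl | hz
    · refine (continuousAt_const (y := (0 : ℝ))).congr ?_
      filter_upwards [ball_mem_nhds (0 : 𝔼) (half_pos hε)] with z hz
      rw [mem_ball_zero_iff] at hz
      rw [ramp_of_le (by rw [div_le_iff₀ hε]; linarith), mul_zero]
    · exact (hK.continuousAt (isOpen_compl_singleton.mem_nhds hz)).mul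
        (continuous_ramp.comp (continuous_norm.div_const _)).continuousAt
  have hInt : ∀ x, Integrable (fun y => K (x - y) * f y) ν := by
    intro x
    obtain ⟨R, hR1, hR⟩ : ∃ R : ℝ, 0 < R ∧ ν univ ≤ ENNReal.ofReal (max c 1 * R ^ s) := by
      refine ⟨(ν univ).toReal + 1, by positivity, ?_⟩
      rw [← ENNReal.ofReal_toReal (measure_ne_top ν univ)]
      refine ENNReal.ofReal_le_ofReal ?_
      rw [ENNReal.toReal_ofReal ENNReal.toReal_nonneg]
      have hs : s ≠ 0 := by rintro rfl; simp at has; linarith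
      have h0 : 0 ≤ (ν univ).toReal := ENNReal.toReal_nonneg
      calc (ν univ).toReal ≤ (ν univ).toReal + 1 := by linarith
        _ ≤ ((ν univ).toReal + 1) ^ s := le_self_pow₀ (by linarith) hs
        _ ≤ _ := le_mul_of_one_le_left (by positivity) (le_max_right _ _)
    refine (hCi ν (max c 1) R (by positivity) hR1 (fun x ρ hρ => (hg x ρ hρ).trans
      (ENNReal.ofReal_le_ofReal (by gcongr; exact le_max_left _ _))) hR x _ (|B| * F)
      (by positivity)
      ((hKm.comp (by fun_prop)).mul hf).aestronglyMeasurable (ae_of_all _ fun y => ?_)).1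
    change |K (x - y) * f y| ≤ _
    rw [abs_mul, dist_eq_norm, mul_right_comm]
    exact mul_le_mul (hKB' _) (hfF y) (abs_nonneg _) (by positivity)
  have hintc : ∀ ε > 0, ∀ x, Integrable (fun y => K (x - y) * ramp (‖x - y‖ / ε) * f y) ν := by
    intro ε hε x
    refine Integrable.of_bound (((hcutc ε hε).measurable.comp (by fun_prop)).mul
      hf).aestronglyMeasurable (|B| * (ε / 2) ^ (-a) * F) (ae_of_all _ fun y => ?_)
    rw [norm_mul]
    exact mul_le_mul (hcut ε hε _) (hfF y) (abs_nonneg _) (by positivity)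
  refine continuous_of_uniform_approx_of_continuous fun u hu => ?_
  obtain ⟨η, hη, hηu⟩ := Metric.mem_uniformity_dist.1 hu
  have hlim : Tendsto (fun ε : ℝ => |B| * F * (c * (C * ε ^ ((s : ℝ) - a)))) (𝓝[>] 0) (𝓝 0) := by
    have : Tendsto (fun ε : ℝ => ε ^ ((s : ℝ) - a)) (𝓝[>] 0) (𝓝 (0 ^ ((s : ℝ) - a))) :=
      ((Real.continuous_rpow_const (by linarith)).tendsto 0).mono_left nhdsWithin_le_nhds
    rw [Real.zero_rpow (by linarith)] at this
    simpa using ((this.const_mul C).const_mul c).const_mul (|B| * F)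
  obtain ⟨ε, hεη, hε⟩ := ((hlim.eventually (gt_mem_nhds hη)).and self_mem_nhdsWithin).exists
  refine ⟨fun x => ∫ y, K (x - y) * ramp (‖x - y‖ / ε) * f y ∂ν,
    continuous_of_dominated (bound := fun _ => |B| * (ε / 2) ^ (-a) * F)
      (fun x => (hintc ε hε x).aestronglyMeasurable) (fun x => ae_of_all _ fun y => ?_)
      (integrable_const _) (ae_of_all _ fun y =>
        ((hcutc ε hε).comp (continuous_id.sub continuous_const)).mul continuous_const),
    fun x => hηu ?_⟩
  · rw [norm_mul]
    exact mul_le_mul (hcut ε hε _) (hfF y) (abs_nonneg _) (by positivity)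
  rw [Real.dist_eq, ← integral_sub (hInt x) (hintc ε hε x)]
  refine lt_of_le_of_lt ?_ hεη
  rw [← Real.norm_eq_abs]
  refine (norm_integral_le_lintegral_norm _).trans (ENNReal.toReal_le_of_le_ofReal
    (by positivity) ?_)
  calc ∫⁻ y, ENNReal.ofReal ‖K (x - y) * f y - K (x - y) * ramp (‖x - y‖ / ε) * f y‖ ∂ν
      ≤ ∫⁻ y, (ball x ε).indicator (fun y => ENNReal.ofReal (|B| * F) *
          ENNReal.ofReal (dist x y ^ (-a))) y ∂ν := by
        refine lintegral_mono fun y => ?_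
        by_cases hy : y ∈ ball x ε
        · rw [indicator_of_mem hy, ← ENNReal.ofReal_mul (by positivity)]
          refine ENNReal.ofReal_le_ofReal ?_
          rw [show K (x - y) * f y - K (x - y) * ramp (‖x - y‖ / ε) * f y =
            K (x - y) * f y * (1 - ramp (‖x - y‖ / ε)) by ring, Real.norm_eq_abs, abs_mul, abs_mul,
            abs_of_nonneg (sub_nonneg.2 (ramp_le_one _)), dist_eq_norm, mul_right_comm |B|]
          refine (mul_le_of_le_one_right (by positivity) ?_).trans
            (mul_le_mul (hKB' _) (hfF y) (abs_nonneg _) (by positivity))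
          linarith [ramp_nonneg (‖x - y‖ / ε)]
        · rw [ramp_of_ge]
          · simp
          · rw [one_le_div hε, ← dist_eq_norm, dist_comm]; simpa using hy
    _ ≤ _ := by
        rw [lintegral_indicator measurableSet_ball, lintegral_const_mul' _ _ ENNReal.ofReal_ne_top,
          ENNReal.ofReal_mul (p := |B| * F) (by positivity)]
        exact mul_le_mul_right (hCb ν c hc hg x ε hε) _

/-- Fubini for a potential tested against an integrable function. -/
lemma integral_potential_mul {s : ℕ} {a : ℝ} (ha : 0 < a) (has : a < s) {ν : Measure 𝔼}
    [IsFiniteMeasure ν] {c R : ℝ} (hc : 0 ≤ c) (hR : 0 < R) (hg : HasGrowth ν c s)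
    (hν : ν univ ≤ ENNReal.ofReal (c * R ^ s)) {K : 𝔼 → ℝ}
    {B : ℝ} (hKB : ∀ z, |K z| ≤ B * ‖z‖ ^ (-a))
    (hKm : Measurable K) {f : 𝔼 → ℝ} (hf : Measurable f) {F : ℝ} (hfF : ∀ y, |f y| ≤ F)
    {g : 𝔼 → ℝ} (hg1 : Integrable g) (hgm : Measurable g) :
    ∫ x, (∫ y, K (x - y) * f y ∂ν) * g x = ∫ y, f y * (∫ x, K (x - y) * g x) ∂ν := by
  have hF : 0 ≤ F := (abs_nonneg _).trans (hfF 0)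
  have hKB' : ∀ z, |K z| ≤ |B| * ‖z‖ ^ (-a) := fun z =>
    (hKB z).trans (by gcongr; exact le_abs_self B)
  obtain ⟨C, hC, h⟩ := exists_lintegral_rpow_le (X := 𝔼) s a ha has
  have hm : Measurable (fun p : 𝔼 × 𝔼 => K (p.1 - p.2) * f p.2 * g p.1) :=
    ((hKm.comp (by fun_prop)).mul (hf.comp measurable_snd)).mul (hgm.comp measurable_fst)
  have hInt : Integrable (fun p : 𝔼 × 𝔼 => K (p.1 - p.2) * f p.2 * g p.1) (volume.prod ν) := by
    refine ⟨hm.aestronglyMeasurable, ?_⟩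
    rw [HasFiniteIntegral, lintegral_prod _ hm.enorm.aemeasurable]
    calc ∫⁻ x, ∫⁻ y, ‖K (x - y) * f y * g x‖ₑ ∂ν
        ≤ ∫⁻ x, (ENNReal.ofReal (|B| * F) * ENNReal.ofReal (c * (C * R ^ ((s : ℝ) - a)))) *
            ‖g x‖ₑ := by
          refine lintegral_mono fun x => ?_
          simp only [enorm_mul _ (g x)]
          rw [lintegral_mul_const' _ _ enorm_ne_top]
          gcongr
          calc ∫⁻ y, ‖K (x - y) * f y‖ₑ ∂ν
              ≤ ∫⁻ y, ENNReal.ofReal (|B| * F) * ENNReal.ofReal (dist x y ^ (-a)) ∂ν := by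
                refine lintegral_mono fun y => ?_
                rw [← ENNReal.ofReal_mul (by positivity), Real.enorm_eq_ofReal_abs]
                refine ENNReal.ofReal_le_ofReal ?_
                rw [abs_mul, dist_eq_norm, mul_right_comm]
                exact mul_le_mul (hKB' _) (hfF y) (abs_nonneg _) (by positivity)
            _ ≤ _ := by
                rw [lintegral_const_mul' _ _ ENNReal.ofReal_ne_top]
                gcongr
                exact h ν c R hc hR hg hν x
      _ < ⊤ := by
          rw [lintegral_const_mul' _ _ (by finiteness)]
          exact ENNReal.mul_lt_top (by finiteness) hg1.2
  simp only [← integral_mul_const, ← integral_const_mul]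
  rw [integral_integral_swap (f := fun x y => K (x - y) * f y * g x) hInt]
  exact integral_congr_ae (ae_of_all _ fun y => integral_congr_ae (ae_of_all _ fun x => by
    ring))

end Potential

section Newton

variable {n : ℕ}

local notation "𝔼" => EuclideanSpace ℝ (Fin (n + 1))

lemma two_le_infty : (2 : WithTop ℕ∞) ≤ ((⊤ : ℕ∞) : WithTop ℕ∞) := by
  exact WithTop.coe_le_coe.2 (le_top : (2 : ℕ∞) ≤ ⊤)

lemma lap_comp_sub_right (f : 𝔼 → ℝ) (a x : 𝔼) : lap (fun y => f (y - a)) x = lap f (x - a) := by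
  simpa only [sub_eq_add_neg] using lap_comp_add_right f (-a) x

lemma continuous_lap_regNewton (ε : ℝ) : Continuous (lap (regNewton ε : 𝔼 → ℝ)) :=
  (contDiff_regNewton ε).lap.continuous

lemma lap_regNewton_eq_zero {ε : ℝ} (hε : 0 < ε) {z : 𝔼} (hz : ε < ‖z‖) :
    lap (regNewton ε) z = 0 := by
  rw [lap_regNewton hε, lap_regNewtonUnit_of_one_le, mul_zero]
  rwa [norm_smul, Real.norm_of_nonneg (by positivity), inv_mul_eq_div, one_lt_div hε]

lemma hasCompactSupport_lap_regNewton {ε : ℝ} (hε : 0 < ε) :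
    HasCompactSupport (lap (regNewton ε : 𝔼 → ℝ)) :=
  HasCompactSupport.intro (isCompact_closedBall 0 ε) fun z hz =>
    lap_regNewton_eq_zero hε (by simpa using hz)

lemma lap_regNewton_neg {ε : ℝ} (hε : 0 < ε) (z : 𝔼) :
    lap (regNewton ε) (-z) = lap (regNewton ε) z := by
  rw [lap_regNewton hε, lap_regNewton hε, smul_neg, lap_regNewtonUnit_neg]

lemma integral_mul_lap_regNewton {δ : ℝ} (hδ : 0 < δ) (v : 𝔼 → ℝ) (y : 𝔼) :
    ∫ x, v x * lap (regNewton δ) (x - y) = ∫ z, v (y + δ • z) * lap regNewtonUnit z := by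
  have h1 : ∫ x, v x * lap (regNewton δ) (x - y) =
      ∫ x, (δ ^ (n + 1))⁻¹ * (v (y + x) * lap regNewtonUnit (δ⁻¹ • x)) := by
    rw [← integral_add_right_eq_self _ y]
    refine integral_congr_ae (ae_of_all _ fun x => ?_)
    simp only [lap_regNewton hδ, add_sub_cancel_right, add_comm y x]
    ring
  have h2 := Measure.integral_comp_smul (volume : Measure 𝔼)
    (fun x => v (y + x) * lap regNewtonUnit (δ⁻¹ • x)) δ
  rw [finrank_euclideanSpace_fin, abs_of_pos (by positivity), smul_eq_mul] at h2
  rw [h1, integral_const_mul, ← h2]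
  simp only [inv_smul_smul₀ hδ.ne']

/-- The functions `lap (regNewton δ)` are an approximate identity, up to the factor
`newtonConst n`. -/
lemma tendsto_integral_mul_lap_regNewton {v : 𝔼 → ℝ} {y : 𝔼} {ε : ℝ} (hε : 0 < ε)
    (hv : ContinuousOn v (closedBall y ε)) :
    Tendsto (fun δ => ∫ x, v x * lap (regNewton δ) (x - y)) (𝓝[>] 0)
      (𝓝 (newtonConst n * v y)) := by
  obtain ⟨M, hM⟩ := (isCompact_closedBall y ε).exists_bound_of_continuousOn hv
  have hc := (contDiff_regNewtonUnit (n := n)).lap.continuous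
  have hy : y ∈ closedBall y ε := mem_closedBall_self hε.le
  have hmem : ∀ {δ : ℝ} {z : 𝔼}, 0 < δ → δ < ε / 2 → ‖z‖ < 2 → y + δ • z ∈ closedBall y ε := by
    intro δ z h1 h2 hz
    rw [mem_closedBall, dist_eq_norm, add_sub_cancel_left, norm_smul, Real.norm_of_nonneg h1.le]
    nlinarith [norm_nonneg z]
  have hsmall : ∀ᶠ δ : ℝ in 𝓝[>] 0, 0 < δ ∧ δ < ε / 2 :=
    Ioo_mem_nhdsGT (half_pos hε)
  have key : Tendsto (fun δ : ℝ => ∫ z, v (y + δ • z) * lap regNewtonUnit z) (𝓝[>] 0)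
      (𝓝 (∫ z : 𝔼, v y * lap regNewtonUnit z)) := by
    refine tendsto_integral_filter_of_dominated_convergence
      (fun z => M * |lap regNewtonUnit z|) ?_ ?_ ?_ ?_
    · filter_upwards [hsmall] with δ hδ
      refine (integrable_mul_of_tsupport_subset (U := ball 0 2) isOpen_ball
        (hv.comp (by fun_prop) fun z hz => hmem hδ.1 hδ.2 (by simpa using hz)) hc
        hasCompactSupport_lap_regNewtonUnit (tsupport_lap_regNewtonUnit.trans
          (closedBall_subset_ball one_lt_two))).aestronglyMeasurable
    · filter_upwards [hsmall] with δ hδ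
      refine ae_of_all _ fun z => ?_
      rw [norm_mul, Real.norm_eq_abs (lap _ _)]
      rcases le_or_gt ‖z‖ 1 with hz | hz
      · gcongr
        exact hM _ (hmem hδ.1 hδ.2 (by linarith))
      · rw [lap_regNewtonUnit_of_one_le hz]; simp
    · exact ((hc.integrable_of_hasCompactSupport
        hasCompactSupport_lap_regNewtonUnit).abs).const_mul M
    · refine ae_of_all _ fun z => Tendsto.mul_const _ ?_
      have h0 : ContinuousAt v y := hv.continuousAt (closedBall_mem_nhds y hε)
      refine h0.tendsto.comp ?_
      have : Tendsto (fun δ : ℝ => y + δ • z) (𝓝 0) (𝓝 (y + (0 : ℝ) • z)) :=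
        Continuous.tendsto (by fun_prop) 0
      rw [zero_smul, add_zero] at this
      exact this.mono_left nhdsWithin_le_nhds
  rw [integral_const_mul, mul_comm] at key
  refine key.congr' ?_
  filter_upwards [self_mem_nhdsWithin] with δ hδ
  exact (integral_mul_lap_regNewton hδ v y).symm

/-- Smoothed kernels of a locally integrable order converge in the sense of distributions. -/
lemma tendsto_integral_kernel {a C : ℝ} (ha : 0 < a) (han : a < n + 1) {k : ℝ → 𝔼 → ℝ} {K : 𝔼 → ℝ}
    (hk : ∀ ε > 0, Continuous (k ε)) (hkC : ∀ ε > 0, ∀ z, z ≠ 0 → |k ε z| ≤ C * ‖z‖ ^ (-a))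
    (hkK : ∀ ε > 0, ∀ z, ε ≤ ‖z‖ → k ε z = K z) {g : 𝔼 → ℝ} (hg : Continuous g)
    (hgc : HasCompactSupport g) (y : 𝔼) :
    Tendsto (fun ε => ∫ x, k ε (x - y) * g x) (𝓝[>] 0) (𝓝 (∫ x, K (x - y) * g x)) := by
  obtain ⟨c, hc, hvol⟩ := exists_hasGrowth_volume n
  obtain ⟨G, hG⟩ := hgc.exists_bound_of_continuous hg
  have hG0 : 0 ≤ G := (norm_nonneg _).trans (hG 0)
  obtain ⟨R, hR0, hR⟩ : ∃ R > 0, tsupport g ⊆ ball y R := by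
    obtain ⟨R, hR⟩ := hgc.isCompact.isBounded.subset_ball y
    exact ⟨max R 1, by positivity, hR.trans (ball_subset_ball (le_max_left _ _))⟩
  have hgz : ∀ x ∉ ball y R, g x = 0 := fun x hx =>
    image_eq_zero_of_notMem_tsupport fun h => hx (hR h)
  obtain ⟨C', -, hC'⟩ := exists_abs_integral_le (X := 𝔼) (n + 1) a ha (by push_cast; exact han)
  have hb : Integrable (fun x => dist y x ^ (-a)) (volume.restrict (ball y R)) :=
    (hC' (volume.restrict (ball y R)) c R hc.le hR0 (hvol.mono Measure.restrict_le_self)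
      (by rw [Measure.restrict_apply_univ]; exact hvol y R hR0) y _ 1 zero_le_one
      (Measurable.pow_const (by fun_prop) _).aestronglyMeasurable (ae_of_all _ fun x => by
        rw [abs_of_nonneg (by positivity), one_mul])).1
  have hne : ∀ᵐ x : 𝔼, x ≠ y := by simp [ae_iff]
  refine tendsto_integral_filter_of_dominated_convergence
    (fun x => (|C| * G) * (ball y R).indicator (fun x => dist y x ^ (-a)) x) ?_ ?_ ?_ ?_
  · filter_upwards [self_mem_nhdsWithin] with ε hε
    exact (((hk ε hε).comp (by fun_prop)).mul hg).aestronglyMeasurable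
  · filter_upwards [self_mem_nhdsWithin] with ε hε
    filter_upwards [hne] with x hx
    by_cases hxR : x ∈ ball y R
    · rw [indicator_of_mem hxR, norm_mul, mul_right_comm, dist_comm, dist_eq_norm]
      refine mul_le_mul ((hkC ε hε _ (sub_ne_zero.2 hx)).trans ?_) (hG x) (norm_nonneg _)
        (by positivity)
      gcongr
      exact le_abs_self C
    · rw [hgz x hxR, indicator_of_notMem hxR]; simp
  · exact ((integrable_indicator_iff measurableSet_ball).2 hb).const_mul _
  · filter_upwards [hne] with x hx
    refine tendsto_const_nhds.congr' ?_
    filter_upwards [Ioo_mem_nhdsGT (norm_pos_iff.2 (sub_ne_zero.2 hx))] with ε hε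
    rw [hkK ε hε.1 _ hε.2.le]

/-- `‖x‖ ^ (1 - n)` is a multiple of a fundamental solution of the Laplacian. -/
lemma integral_newton_mul_lap (hn : 2 ≤ n) {ψ : 𝔼 → ℝ} (hψ : ContDiff ℝ (⊤ : ℕ∞) ψ)
    (hψc : HasCompactSupport ψ) (y : 𝔼) :
    ∫ x, ‖x - y‖ ^ (1 - (n : ℝ)) * lap ψ x = newtonConst n * ψ y := by
  have hn' : (2 : ℝ) ≤ n := by exact_mod_cast hn
  obtain ⟨C, hC⟩ := exists_regNewton_le hn
  have h1 := tendsto_integral_kernel (a := n - 1) (C := C) (by linarith) (by linarith)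
    (k := regNewton) (K := fun z : 𝔼 => ‖z‖ ^ (1 - (n : ℝ)))
    (fun ε _ => (contDiff_regNewton ε).continuous)
    (fun ε hε z hz => by rw [neg_sub]; exact hC ε hε z hz)
    (fun ε hε z hz => regNewton_of_le hn hε hz) hψ.lap.continuous hψc.lap y
  refine tendsto_nhds_unique h1 ((tendsto_integral_mul_lap_regNewton (v := ψ) (y := y) one_pos
    hψ.continuous.continuousOn).congr fun ε => ?_)
  have h2 : ContDiff ℝ 2 fun x : 𝔼 => regNewton ε (x - y) :=
    ((contDiff_regNewton ε).comp (contDiff_id.sub contDiff_const)).of_le two_le_infty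
  rw [integral_mul_lap isOpen_univ h2.contDiffOn (hψ.of_le two_le_infty) hψc
    (subset_univ _)]
  simp only [lap_comp_sub_right, mul_comm]

lemma integral_newtonGrad_mul_lap (hn : 2 ≤ n) {ψ : 𝔼 → ℝ} (hψ : ContDiff ℝ (⊤ : ℕ∞) ψ)
    (hψc : HasCompactSupport ψ) (i : Fin (n + 1)) (y : 𝔼) :
    ∫ x, newtonGrad i (x - y) * lap ψ x = -(newtonConst n * partialDeriv i ψ y) := by
  have hn' : (2 : ℝ) ≤ n := by exact_mod_cast hn
  have hψi : ContDiff ℝ (⊤ : ℕ∞) (partialDeriv i ψ) := hψ.partialDeriv le_rfl i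
  have h1 := tendsto_integral_kernel (a := n) (C := n) (by linarith) (by linarith)
    (k := fun ε => partialDeriv i (regNewton ε)) (K := newtonGrad i)
    (fun ε _ => ((contDiff_regNewton ε).partialDeriv (m := (⊤ : ℕ∞)) le_rfl i).continuous)
    (fun ε hε z _ => by
      rw [partialDeriv_regNewton hε, abs_mul]
      refine (mul_le_of_le_one_left (abs_nonneg _) ?_).trans (abs_newtonGrad_le hn i z)
      rw [smoothStep, abs_of_nonneg (Real.smoothTransition.nonneg _)]
      exact Real.smoothTransition.le_one _)
    (fun ε hε z hz => by
      rw [partialDeriv_regNewton hε, smoothStep_of_ge, one_mul]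
      rw [norm_smul, Real.norm_of_nonneg (by positivity), inv_mul_eq_div]
      exact one_le_pow₀ ((one_le_div hε).2 hz)) hψ.lap.continuous hψc.lap y
  refine tendsto_nhds_unique h1 (((tendsto_integral_mul_lap_regNewton (v := partialDeriv i ψ)
    (y := y) one_pos hψi.continuous.continuousOn).neg).congr fun ε => ?_)
  have h2 : ContDiff ℝ 2 fun x : 𝔼 => regNewton ε (x - y) :=
    ((contDiff_regNewton ε).comp (contDiff_id.sub contDiff_const)).of_le two_le_infty
  have h3 := integral_mul_partialDeriv isOpen_univ (h2.of_le one_le_two).contDiffOn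
    (hψ.lap.of_le (one_le_two.trans two_le_infty)) hψc.lap (subset_univ _) i
  simp only [partialDeriv_lap hψ] at h3
  rw [integral_mul_lap isOpen_univ h2.contDiffOn (hψi.of_le two_le_infty)
    (hψc.partialDeriv i) (subset_univ _)] at h3
  simp only [lap_comp_sub_right] at h3
  have h4 : ∀ x, partialDeriv i (fun x : 𝔼 => regNewton ε (x - y)) x =
      partialDeriv i (regNewton ε) (x - y) := fun x => by
    simpa only [sub_eq_add_neg] using congrFun (partialDeriv_comp_add_right i (regNewton ε) (-y)) x
  simp only [h4] at h3
  rw [← neg_eq_iff_eq_neg.2 h3]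
  simp only [mul_comm]

end Newton

section Weyl

variable {n : ℕ}

local notation "𝔼" => EuclideanSpace ℝ (Fin (n + 1))

/-- `v` is harmonic on `U` in the sense of distributions. -/
def WeaklyHarmonicOn {d : ℕ} (v : EuclideanSpace ℝ (Fin d) → ℝ)
    (U : Set (EuclideanSpace ℝ (Fin d))) : Prop :=
  ∀ ψ : EuclideanSpace ℝ (Fin d) → ℝ, ContDiff ℝ (⊤ : ℕ∞) ψ → HasCompactSupport ψ →
    tsupport ψ ⊆ U → ∫ x, v x * lap ψ x = 0

lemma tsupport_subset_closedBall {g : 𝔼 → ℝ} {x : 𝔼} {ε : ℝ} (h : ∀ y, ε < ‖y - x‖ → g y = 0) :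
    tsupport g ⊆ closedBall x ε :=
  closure_minimal (fun y hy => by
    by_contra h'
    exact hy (h y (by simpa [dist_eq_norm] using h'))) isClosed_closedBall

lemma integrable_mul_lap_regNewton {v : 𝔼 → ℝ} {U : Set 𝔼} (hU : IsOpen U)
    (hv : ContinuousOn v U) {x : 𝔼} {ε : ℝ} (hε : 0 < ε) (hx : closedBall x ε ⊆ U) :
    Integrable fun y => v y * lap (regNewton ε) (y - x) := by
  have h : tsupport (fun y => lap (regNewton ε) (y - x)) ⊆ closedBall x ε :=
    tsupport_subset_closedBall fun y hy => lap_regNewton_eq_zero hε hy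
  exact integrable_mul_of_tsupport_subset hU hv ((continuous_lap_regNewton ε).comp (by fun_prop))
    ((isCompact_closedBall x ε).of_isClosed_subset (isClosed_tsupport _) h) (h.trans hx)

/-- The mean value property. -/
lemma WeaklyHarmonicOn.integral_mul_lap_regNewton (hn : 2 ≤ n) {v : 𝔼 → ℝ} {U : Set 𝔼}
    (h : WeaklyHarmonicOn v U) (hU : IsOpen U) (hv : ContinuousOn v U) {x : 𝔼} {ε : ℝ} (hε : 0 < ε)
    (hx : closedBall x ε ⊆ U) :
    ∫ y, v y * lap (regNewton ε) (y - x) = newtonConst n * v x := by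
  refine tendsto_nhds_unique ?_ (tendsto_integral_mul_lap_regNewton hε (hv.mono hx))
  refine tendsto_const_nhds.congr' ?_
  filter_upwards [Ioo_mem_nhdsGT hε] with δ hδ
  have hs : ∀ ε, ContDiff ℝ (⊤ : ℕ∞) fun y : 𝔼 => regNewton ε (y - x) := fun ε =>
    (contDiff_regNewton ε).comp (contDiff_id.sub contDiff_const)
  have hs2 := hs ε
  set ψ : 𝔼 → ℝ := fun y => regNewton ε (y - x) + (-1) * regNewton δ (y - x)
  have hψ : tsupport ψ ⊆ closedBall x ε := tsupport_subset_closedBall fun y hy => by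
    simp only [ψ]
    rw [regNewton_of_le hn hε hy.le, regNewton_of_le hn hδ.1 (hδ.2.le.trans hy.le)]
    ring
  have h0 := h ψ ((hs ε).add (contDiff_const.mul (hs δ)))
    ((isCompact_closedBall x ε).of_isClosed_subset (isClosed_tsupport _) hψ) (hψ.trans hx)
  have h1 : ∀ y, lap ψ y = lap (regNewton ε) (y - x) - lap (regNewton δ) (y - x) := fun y => by
    rw [lap_add ((hs ε).of_le two_le_infty) ((contDiff_const.mul (hs δ)).of_le two_le_infty),
      lap_const_mul, lap_comp_sub_right, lap_comp_sub_right]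
    ring
  simp only [h1, mul_sub] at h0
  rw [integral_sub (integrable_mul_lap_regNewton hU hv hε hx) (integrable_mul_lap_regNewton hU hv
    hδ.1 ((closedBall_subset_closedBall hδ.2.le).trans hx))] at h0
  linarith

lemma WeaklyHarmonicOn.contDiffOn (hn : 2 ≤ n) {v : 𝔼 → ℝ} {U : Set 𝔼}
    (h : WeaklyHarmonicOn v U) (hU : IsOpen U) (hv : ContinuousOn v U) :
    ContDiffOn ℝ (⊤ : ℕ∞) v U := by
  intro x₀ hx₀
  obtain ⟨R, hR, hRU⟩ := nhds_basis_closedBall.mem_iff.1 (hU.mem_nhds hx₀)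
  have hR2 := half_pos hR
  set f := (closedBall x₀ R).indicator v
  have hf : Integrable f := ((hv.mono hRU).integrableOn_compact
    (isCompact_closedBall _ _)).integrable_indicator measurableSet_closedBall
  have hsm : ContDiff ℝ (⊤ : ℕ∞) (convolution f (lap (regNewton (R / 2)))
      (ContinuousLinearMap.mul ℝ ℝ) volume) :=
    (hasCompactSupport_lap_regNewton hR2).contDiff_convolution_right _ hf.locallyIntegrable
      (contDiff_regNewton _).lap
  refine ((contDiff_const (c := (newtonConst n)⁻¹)).mul hsm).contDiffAt.congr_of_eventuallyEq
    ?_ |>.contDiffWithinAt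
  filter_upwards [ball_mem_nhds x₀ hR2] with x hx
  have hsub : closedBall x (R / 2) ⊆ closedBall x₀ R :=
    closedBall_subset_closedBall' (by linarith [mem_ball.1 hx])
  rw [eq_inv_mul_iff_mul_eq₀ (newtonConst_neg hn).ne,
    ← h.integral_mul_lap_regNewton hn hU hv hR2 (hsub.trans hRU), convolution_def]
  refine integral_congr_ae (ae_of_all _ fun y => ?_)
  simp only [ContinuousLinearMap.mul_apply']
  rw [← lap_regNewton_neg hR2 (y - x), neg_sub]
  by_cases hy : y ∈ closedBall x₀ R
  · simp only [f, indicator_of_mem hy]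
  · rw [lap_regNewton_eq_zero hR2 (z := x - y), mul_zero, mul_zero]
    by_contra hcon
    exact hy (hsub (by simpa [dist_eq_norm, norm_sub_rev] using hcon))

/-- **Weyl's lemma**. -/
lemma WeaklyHarmonicOn.lap_eq_zero (hn : 2 ≤ n) {v : 𝔼 → ℝ} {U : Set 𝔼}
    (h : WeaklyHarmonicOn v U) (hU : IsOpen U) (hv : ContinuousOn v U) {x : 𝔼} (hx : x ∈ U) :
    lap v x = 0 := by
  have hs : ContDiffOn ℝ 2 v U := (h.contDiffOn hn hU hv).of_le two_le_infty
  have hc : ContinuousOn (lap v) U := hs.lap hU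
  have h0 := hU.ae_eq_zero_of_integral_contDiff_smul_eq_zero (μ := volume)
    (hc.locallyIntegrableOn hU.measurableSet) fun g hg hgc hgU => by
      have := h g hg hgc hgU
      rw [integral_mul_lap hU hs (hg.of_le two_le_infty) hgc hgU] at this
      simpa only [smul_eq_mul, mul_comm] using this
  exact Measure.eqOn_open_of_ae_eq ((ae_restrict_iff' hU.measurableSet).2 h0) hU hc
    continuousOn_const hx

lemma exists_norm_fderiv_le (hn : 2 ≤ n) : ∃ C : ℝ, 0 < C ∧ ∀ (v : 𝔼 → ℝ) (x : 𝔼) (R M : ℝ),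
    0 < R → WeaklyHarmonicOn v (ball x R) → ContinuousOn v (ball x R) →
      (∀ y ∈ ball x R, |v y| ≤ M) → ‖fderiv ℝ v x‖ ≤ C * M / R := by
  obtain ⟨c, hc, hvol⟩ := exists_hasGrowth_volume n
  obtain ⟨L, hL⟩ := ((contDiff_regNewtonUnit (n := n)).lap.of_le
    (one_le_two.trans two_le_infty)).lipschitzWith_of_hasCompactSupport
    hasCompactSupport_lap_regNewtonUnit (by simp)
  have hκ := newtonConst_neg hn
  have hκ' : 0 < |newtonConst n| := abs_pos.2 hκ.ne
  refine ⟨|newtonConst n|⁻¹ * (3 ^ (n + 2) * (L + 1) * c), by positivity,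
    fun v x R M hR hv hvc hM => ?_⟩
  have hM0 : 0 ≤ M := (abs_nonneg _).trans (hM x (mem_ball_self hR))
  set ε := R / 3 with hεd
  have hε : 0 < ε := by positivity
  have hLip : ∀ z w : 𝔼, |lap (regNewton ε) z - lap (regNewton ε) w| ≤
      (ε ^ (n + 2))⁻¹ * (L + 1) * ‖z - w‖ := by
    intro z w
    have := hL.dist_le_mul (ε⁻¹ • z) (ε⁻¹ • w)
    rw [Real.dist_eq, dist_eq_norm, ← smul_sub, norm_smul,
      Real.norm_of_nonneg (by positivity)] at this
    rw [lap_regNewton hε, lap_regNewton hε, ← mul_sub, abs_mul, abs_of_pos (by positivity)]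
    calc _ ≤ (ε ^ (n + 1))⁻¹ * ((L + 1) * (ε⁻¹ * ‖z - w‖)) := by
          gcongr
          refine this.trans ?_
          gcongr
          linarith
      _ = _ := by rw [pow_succ ε (n + 1), mul_inv]; ring
  have hsub : ∀ y ∈ ball x ε, closedBall y ε ⊆ ball x R := fun y hy z hz => by
    have := dist_triangle z y x
    rw [mem_closedBall] at hz
    rw [mem_ball] at hy ⊢
    linarith
  refine norm_fderiv_le_of_lip' ℝ (by positivity) ?_
  filter_upwards [ball_mem_nhds x hε] with y hy
  have hxε := mem_ball_self (x := x) hε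
  have e : newtonConst n * (v y - v x) =
      ∫ z, (ball x R).indicator (fun z => v z * (lap (regNewton ε) (z - y) -
        lap (regNewton ε) (z - x))) z := by
    rw [mul_sub, ← hv.integral_mul_lap_regNewton hn isOpen_ball hvc hε (hsub y hy),
      ← hv.integral_mul_lap_regNewton hn isOpen_ball hvc hε (hsub x hxε),
      ← integral_sub (integrable_mul_lap_regNewton isOpen_ball hvc hε (hsub y hy))
        (integrable_mul_lap_regNewton isOpen_ball hvc hε (hsub x hxε))]
    refine integral_congr_ae (ae_of_all _ fun z => ?_)
    by_cases hz : z ∈ ball x R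
    · simp only [indicator_of_mem hz, mul_sub]
    · have hz' : ∀ w ∈ ball x ε, lap (regNewton ε) (z - w) = 0 := fun w hw =>
        lap_regNewton_eq_zero hε (by
          by_contra h'
          exact hz (hsub w hw (by simpa [dist_eq_norm] using h')))
      simp only [indicator_of_notMem hz, hz' y hy, hz' x hxε]
      ring
  have e2 : |newtonConst n| * ‖v y - v x‖ ≤
      M * ((ε ^ (n + 2))⁻¹ * (L + 1) * ‖y - x‖) * (c * R ^ (n + 1)) := by
    rw [Real.norm_eq_abs, ← abs_mul, e, integral_indicator measurableSet_ball, ← Real.norm_eq_abs]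
    refine (norm_setIntegral_le_of_norm_le_const measure_ball_lt_top fun z hz => ?_).trans
      (mul_le_mul_of_nonneg_left (ENNReal.toReal_le_of_le_ofReal (by positivity) (hvol x R hR))
        (by positivity))
    rw [norm_mul]
    refine mul_le_mul (hM z hz) ((hLip _ _).trans_eq ?_) (norm_nonneg _) hM0
    rw [show z - y - (z - x) = x - y by abel, norm_sub_rev]
  have hR3 : R = 3 * ε := by rw [hεd]; ring
  rw [← mul_le_mul_iff_right₀ hκ']
  refine e2.trans_eq ?_
  rw [hR3]
  field_simp
  ring_nf

end Weyl

section Localization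

variable {n : ℕ}

local notation "𝔼" => EuclideanSpace ℝ (Fin (n + 1))

lemma abs_rpow_sub_rpow_le (hn : 2 ≤ n) {t a b : ℝ} (ht : 0 < t) (ha : t ≤ a) (hb : t ≤ b) :
    |a ^ (1 - (n : ℝ)) - b ^ (1 - (n : ℝ))| ≤ n * t ^ (-(n : ℝ)) * |a - b| := by
  have hn' : (2 : ℝ) ≤ n := by exact_mod_cast hn
  refine Convex.norm_image_sub_le_of_norm_hasDerivWithin_le (s := Ici t)
    (f := fun s : ℝ => s ^ (1 - (n : ℝ))) (f' := fun s => (1 - (n : ℝ)) * s ^ (1 - (n : ℝ) - 1))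
    (fun s hs => (Real.hasDerivAt_rpow_const (Or.inl (ht.trans_le hs).ne')).hasDerivWithinAt)
    (fun s hs => ?_) (convex_Ici t) hb ha
  have hs0 : 0 < s := ht.trans_le hs
  rw [norm_mul, Real.norm_eq_abs, abs_of_nonpos (by linarith), Real.norm_of_nonneg (by positivity),
    show 1 - (n : ℝ) - 1 = -n by ring]
  exact mul_le_mul (by linarith) (Real.rpow_le_rpow_of_nonpos ht hs (by linarith)) (by positivity)
    (by positivity)

lemma partialDeriv_eq_zero_of_notMem_tsupport {d : ℕ} {f : EuclideanSpace ℝ (Fin d) → ℝ}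
    {x : EuclideanSpace ℝ (Fin d)} (h : x ∉ tsupport f) (i : Fin d) : partialDeriv i f x = 0 :=
  image_eq_zero_of_notMem_tsupport fun hx => h (tsupport_partialDeriv_subset i f hx)

variable (n) in
/-- Smooth cutoff functions adapted to balls. -/
lemma exists_cutoff : ∃ A : ℝ, 0 < A ∧ ∀ (x₀ : EuclideanSpace ℝ (Fin (n + 1))) (r : ℝ),
    0 < r → ∃ φ : EuclideanSpace ℝ (Fin (n + 1)) → ℝ, ContDiff ℝ (⊤ : ℕ∞) φ ∧ (∀ x, 0 ≤ φ x) ∧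
      (∀ x, φ x ≤ 1) ∧ (∀ x ∈ ball x₀ (2 * r), φ x = 1) ∧ tsupport φ ⊆ ball x₀ (4 * r) ∧
      (∀ i x, |partialDeriv i φ x| ≤ A / r) ∧ ∀ x, |lap φ x| ≤ A / r ^ 2 := by
  let η : ContDiffBump (0 : 𝔼) := ⟨2, 3, by norm_num, by norm_num⟩
  have hη : ContDiff ℝ (⊤ : ℕ∞) η := η.contDiff
  have h1 : ∀ i, ∃ A : ℝ, ∀ x, ‖partialDeriv i η x‖ ≤ A := fun i =>
    (η.hasCompactSupport.partialDeriv i).exists_bound_of_continuous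
      (hη.partialDeriv (m := (⊤ : ℕ∞)) le_rfl i).continuous
  choose A1 hA1 using h1
  obtain ⟨A2, hA2⟩ := η.hasCompactSupport.lap.exists_bound_of_continuous hη.lap.continuous
  have hA1' : ∀ i, 0 ≤ A1 i := fun i => (norm_nonneg _).trans (hA1 i 0)
  have hA2' : 0 ≤ A2 := (norm_nonneg _).trans (hA2 0)
  have hsum : 0 ≤ ∑ i, A1 i := Finset.sum_nonneg fun i _ => hA1' i
  refine ⟨∑ i, A1 i + A2 + 1, by positivity, fun x₀ r hr => ?_⟩
  have hφ : ContDiff ℝ (⊤ : ℕ∞) fun x : 𝔼 => η (r⁻¹ • (x - x₀)) :=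
    hη.comp (by fun_prop : ContDiff ℝ (⊤ : ℕ∞) fun x : 𝔼 => r⁻¹ • (x - x₀))
  have hnorm : ∀ x, ‖r⁻¹ • (x - x₀)‖ = dist x x₀ / r := fun x => by
    rw [norm_smul, Real.norm_of_nonneg (by positivity), dist_eq_norm, inv_mul_eq_div]
  have hpd : ∀ i, partialDeriv i (fun x : 𝔼 => η (r⁻¹ • (x - x₀))) =
      fun x => r⁻¹ * partialDeriv i η (r⁻¹ • (x - x₀)) := fun i => by
    have := partialDeriv_comp_add_right i (fun x => η (r⁻¹ • x)) (-x₀)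
    simp only [partialDeriv_comp_smul, ← sub_eq_add_neg] at this
    exact this
  have hlap : ∀ x, lap (fun x : 𝔼 => η (r⁻¹ • (x - x₀))) x =
      r⁻¹ ^ 2 * lap η (r⁻¹ • (x - x₀)) := fun x => by
    rw [lap_comp_sub_right (fun x => η (r⁻¹ • x)), lap_comp_smul]
  refine ⟨_, hφ, fun x => η.nonneg, fun x => η.le_one, fun x hx => η.one_of_mem_closedBall ?_,
    (tsupport_subset_closedBall (ε := 3 * r) fun x hx => η.zero_of_le_dist ?_).trans
      (closedBall_subset_ball (by linarith)), fun i x => ?_, fun x => ?_⟩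
  · rw [mem_closedBall_zero_iff, hnorm, div_le_iff₀ hr]
    exact (mem_ball.1 hx).le
  · rw [dist_zero_right, hnorm, le_div_iff₀ hr, dist_eq_norm]
    exact hx.le
  · rw [hpd, abs_mul, abs_of_pos (by positivity), div_eq_inv_mul]
    gcongr
    have := Finset.single_le_sum (fun i _ => hA1' i) (Finset.mem_univ i)
    linarith [Real.norm_eq_abs _ ▸ hA1 i (r⁻¹ • (x - x₀))]
  · rw [hlap, abs_mul, abs_of_pos (by positivity), div_eq_inv_mul, inv_pow]
    gcongr
    linarith [Real.norm_eq_abs _ ▸ hA2 (r⁻¹ • (x - x₀))]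

lemma measurable_newton : Measurable fun z : 𝔼 => ‖z‖ ^ (1 - (n : ℝ)) :=
  measurable_norm.pow_const _

lemma measurable_newtonGrad (i : Fin (n + 1)) : Measurable (newtonGrad i : 𝔼 → ℝ) := by
  unfold newtonGrad
  have : Measurable fun z : 𝔼 => z i := (by fun_prop : Continuous fun z : 𝔼 => z i).measurable
  exact (this.mul (measurable_norm.pow_const _)).const_mul _

lemma continuousOn_newton : ContinuousOn (fun z : 𝔼 => ‖z‖ ^ (1 - (n : ℝ))) {0}ᶜ := fun _ hz =>
  (continuous_norm.continuousAt.rpow_const (Or.inl (norm_ne_zero_iff.2 hz))).continuousWithinAt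

lemma continuousOn_newtonGrad (i : Fin (n + 1)) : ContinuousOn (newtonGrad i : 𝔼 → ℝ) {0}ᶜ :=
  fun z hz => by
    have : ContinuousAt (fun z : 𝔼 => z i) z :=
      (by fun_prop : Continuous fun z : 𝔼 => z i).continuousAt
    exact ((this.mul (continuous_norm.continuousAt.rpow_const
      (Or.inl (norm_ne_zero_iff.2 hz)))).const_mul _).continuousWithinAt

/-- The Newtonian potential of the density `f` with respect to `ν`. -/
def newtonPotential (ν : Measure 𝔼) (f : 𝔼 → ℝ) (x : 𝔼) : ℝ :=
  ∫ y, ‖x - y‖ ^ (1 - (n : ℝ)) * f y ∂ν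

/-- The `i`-th derivative of the Newtonian potential of the density `f` with respect to `ν`. -/
def newtonGradPotential (ν : Measure 𝔼) (i : Fin (n + 1)) (f : 𝔼 → ℝ) (x : 𝔼) : ℝ :=
  ∫ y, newtonGrad i (x - y) * f y ∂ν

section

variable {ν : Measure (EuclideanSpace ℝ (Fin (n + 1)))} [IsFiniteMeasure ν] {c R F : ℝ} {s : ℕ}
  {f : EuclideanSpace ℝ (Fin (n + 1)) → ℝ}

lemma continuous_newtonPotential (hn : 2 ≤ n) (hs : n ≤ s) (hc : 0 ≤ c) (hg : HasGrowth ν c s)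
    (hf : Measurable f) (hfF : ∀ y, |f y| ≤ F) : Continuous (newtonPotential ν f) := by
  have hn' : (2 : ℝ) ≤ n := by exact_mod_cast hn
  have hs' : (n : ℝ) ≤ s := by exact_mod_cast hs
  refine continuous_potential (a := n - 1) (B := 1) (by linarith) (by linarith) hc hg
    continuousOn_newton (fun z => ?_) measurable_newton hf hfF
  rw [abs_of_nonneg (by positivity), one_mul, neg_sub]

lemma continuous_newtonGradPotential (hn : 2 ≤ n) (hs : n < s) (hc : 0 ≤ c) (hg : HasGrowth ν c s)
    (hf : Measurable f) (hfF : ∀ y, |f y| ≤ F) (i : Fin (n + 1)) :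
    Continuous (newtonGradPotential ν i f) :=
  continuous_potential (a := n) (B := n) (by positivity) (by exact_mod_cast hs) hc hg
    (continuousOn_newtonGrad i) (abs_newtonGrad_le hn i) (measurable_newtonGrad i) hf hfF

lemma integral_newtonPotential_mul_lap (hn : 2 ≤ n) (hs : n ≤ s) (hc : 0 ≤ c) (hR : 0 < R)
    (hg : HasGrowth ν c s) (hν : ν univ ≤ ENNReal.ofReal (c * R ^ s)) (hf : Measurable f)
    (hfF : ∀ y, |f y| ≤ F) {ψ : 𝔼 → ℝ} (hψ : ContDiff ℝ (⊤ : ℕ∞) ψ) (hψc : HasCompactSupport ψ) :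
    ∫ x, newtonPotential ν f x * lap ψ x = newtonConst n * ∫ y, f y * ψ y ∂ν := by
  have hn' : (2 : ℝ) ≤ n := by exact_mod_cast hn
  have hs' : (n : ℝ) ≤ s := by exact_mod_cast hs
  unfold newtonPotential
  rw [integral_potential_mul (a := n - 1) (B := 1) (by linarith) (by linarith) hc hR hg hν
    (K := fun z => ‖z‖ ^ (1 - (n : ℝ))) (fun z => by
      rw [abs_of_nonneg (by positivity), one_mul, neg_sub]) measurable_newton hf hfF
    (hψ.lap.continuous.integrable_of_hasCompactSupport hψc.lap) hψ.lap.continuous.measurable]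
  simp only [integral_newton_mul_lap hn hψ hψc]
  rw [← integral_const_mul]
  exact integral_congr_ae (ae_of_all _ fun y => by ring)

lemma integral_newtonGradPotential_mul_lap (hn : 2 ≤ n) (hs : n < s) (hc : 0 ≤ c) (hR : 0 < R)
    (hg : HasGrowth ν c s) (hν : ν univ ≤ ENNReal.ofReal (c * R ^ s)) (hf : Measurable f)
    (hfF : ∀ y, |f y| ≤ F) {ψ : 𝔼 → ℝ} (hψ : ContDiff ℝ (⊤ : ℕ∞) ψ) (hψc : HasCompactSupport ψ)
    (i : Fin (n + 1)) :
    ∫ x, newtonGradPotential ν i f x * lap ψ x =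
      -(newtonConst n * ∫ y, f y * partialDeriv i ψ y ∂ν) := by
  unfold newtonGradPotential
  rw [integral_potential_mul (a := n) (B := n) (by positivity) (by exact_mod_cast hs) hc hR hg hν
    (abs_newtonGrad_le hn i) (measurable_newtonGrad i) hf hfF
    (hψ.lap.continuous.integrable_of_hasCompactSupport hψc.lap) hψ.lap.continuous.measurable]
  simp only [integral_newtonGrad_mul_lap hn hψ hψc]
  rw [← integral_const_mul, ← integral_neg]
  exact integral_congr_ae (ae_of_all _ fun y => by ring)

end

end Localization

section PotentialBounds

variable {n : ℕ}

local notation "𝔼" => EuclideanSpace ℝ (Fin (n + 1))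

lemma exists_abs_newtonPotential_le (hn : 2 ≤ n) {s : ℕ} (hs : n ≤ s) : ∃ C : ℝ, 0 < C ∧
    ∀ (ν : Measure (EuclideanSpace ℝ (Fin (n + 1)))) (c R F : ℝ)
      (f : EuclideanSpace ℝ (Fin (n + 1)) → ℝ), 0 ≤ c → 0 < R → 0 ≤ F → HasGrowth ν c s →
      ν univ ≤ ENNReal.ofReal (c * R ^ s) → Measurable f → (∀ y, |f y| ≤ F) →
      ∀ x, |newtonPotential ν f x| ≤ F * (c * (C * R ^ ((s : ℝ) - (n - 1)))) := by
  have hn' : (2 : ℝ) ≤ n := by exact_mod_cast hn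
  have hs' : (n : ℝ) ≤ s := by exact_mod_cast hs
  obtain ⟨C, hC, h⟩ := exists_abs_integral_le (X := 𝔼) s (n - 1) (by linarith) (by linarith)
  refine ⟨C, hC, fun ν c R F f hc hR hF hg hν hf hfF x => ?_⟩
  refine (abs_integral_le_integral_abs).trans (h ν c R hc hR hg hν x _ F hF
    ((measurable_newton.comp (measurable_const.sub measurable_id)).mul hf).aestronglyMeasurable
    (ae_of_all _ fun y => ?_)).2
  change |‖x - y‖ ^ (1 - (n : ℝ)) * f y| ≤ _
  rw [abs_mul, abs_of_nonneg (by positivity), neg_sub, dist_eq_norm, mul_comm]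
  gcongr
  exact hfF y

lemma exists_abs_newtonGradPotential_le (hn : 2 ≤ n) {s : ℕ} (hs : n < s) : ∃ C : ℝ, 0 < C ∧
    ∀ (ν : Measure (EuclideanSpace ℝ (Fin (n + 1)))) (c R F : ℝ)
      (f : EuclideanSpace ℝ (Fin (n + 1)) → ℝ), 0 ≤ c → 0 < R → 0 ≤ F → HasGrowth ν c s →
      ν univ ≤ ENNReal.ofReal (c * R ^ s) → Measurable f → (∀ y, |f y| ≤ F) →
      ∀ i x, |newtonGradPotential ν i f x| ≤ F * (c * (C * R ^ ((s : ℝ) - n))) := by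
  have hn' : (2 : ℝ) ≤ n := by exact_mod_cast hn
  have hs' : (n : ℝ) < s := by exact_mod_cast hs
  obtain ⟨C, hC, h⟩ := exists_abs_integral_le (X := 𝔼) s n (by linarith) (by linarith)
  refine ⟨n * C, by positivity, fun ν c R F f hc hR hF hg hν hf hfF i x => ?_⟩
  refine ((abs_integral_le_integral_abs).trans (h ν c R hc hR hg hν x _ (n * F) (by positivity)
    (((measurable_newtonGrad i).comp
      (measurable_const.sub measurable_id)).mul hf).aestronglyMeasurable
    (ae_of_all _ fun y => ?_)).2).trans_eq (by ring)
  change |newtonGrad i (x - y) * f y| ≤ _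
  rw [abs_mul, dist_eq_norm, mul_right_comm]
  exact mul_le_mul (abs_newtonGrad_le hn i _) (hfF y) (abs_nonneg _) (by positivity)

section

variable {ν : Measure (EuclideanSpace ℝ (Fin (n + 1)))} {ρ F m : ℝ}
  {f : EuclideanSpace ℝ (Fin (n + 1)) → ℝ} {x x₀ : EuclideanSpace ℝ (Fin (n + 1))}

lemma abs_integral_le_of_ae_le {X : Type*} [MeasurableSpace X] {ν : Measure X} {g : X → ℝ}
    {B m : ℝ} (hB : 0 ≤ B) (hm : 0 ≤ m) (hν : ν univ ≤ ENNReal.ofReal m)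
    (hg : ∀ᵐ y ∂ν, |g y| ≤ B) : |∫ y, g y ∂ν| ≤ B * m := by
  have : IsFiniteMeasure ν := ⟨hν.trans_lt ENNReal.ofReal_lt_top⟩
  refine (norm_integral_le_of_norm_le_const (f := g) (C := B) hg).trans ?_
  gcongr
  exact ENNReal.toReal_le_of_le_ofReal hm hν

lemma abs_newtonGradPotential_le_of_far (hn : 2 ≤ n) (hρ : 0 < ρ) (hF : 0 ≤ F) (hm : 0 ≤ m)
    (hν : ν univ ≤ ENNReal.ofReal m) (hνρ : ν (ball x₀ ρ)ᶜ = 0) (hfF : ∀ y, |f y| ≤ F)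
    (hx : 2 * ρ ≤ dist x x₀) (i : Fin (n + 1)) :
    |newtonGradPotential ν i f x| ≤ n * (dist x x₀ / 2) ^ (-(n : ℝ)) * F * m := by
  refine abs_integral_le_of_ae_le (by positivity) hm hν ?_
  filter_upwards [(compl_mem_ae_iff.2 hνρ : _ ∈ ae ν)] with y hy
  rw [compl_compl, mem_ball] at hy
  rw [abs_mul]
  refine mul_le_mul ((abs_newtonGrad_le hn i _).trans ?_) (hfF y) (abs_nonneg _) (by positivity)
  refine mul_le_mul_of_nonneg_left ?_ (by positivity)
  refine Real.rpow_le_rpow_of_nonpos (by linarith) ?_ (by simp)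
  rw [← dist_eq_norm]
  linarith [dist_triangle x y x₀]

lemma abs_newtonPotential_sub_le_of_far (hn : 2 ≤ n) (hρ : 0 < ρ) (hF : 0 ≤ F) (hm : 0 ≤ m)
    (hν : ν univ ≤ ENNReal.ofReal m) (hνρ : ν (ball x₀ ρ)ᶜ = 0) (hf : Measurable f)
    (hfF : ∀ y, |f y| ≤ F) (hx : 2 * ρ ≤ dist x x₀) :
    |newtonPotential ν f x - ‖x - x₀‖ ^ (1 - (n : ℝ)) * ∫ y, f y ∂ν| ≤
      n * (dist x x₀ / 2) ^ (-(n : ℝ)) * ρ * F * m := by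
  have hn' : (2 : ℝ) ≤ n := by exact_mod_cast hn
  have : IsFiniteMeasure ν := ⟨hν.trans_lt ENNReal.ofReal_lt_top⟩
  have hfar : ∀ᵐ y ∂ν, dist y x₀ < ρ ∧ dist x x₀ / 2 ≤ ‖x - y‖ := by
    filter_upwards [(compl_mem_ae_iff.2 hνρ : _ ∈ ae ν)] with y hy
    rw [compl_compl, mem_ball] at hy
    refine ⟨hy, ?_⟩
    rw [← dist_eq_norm]
    linarith [dist_triangle x y x₀]
  have hpos : 0 < dist x x₀ / 2 := by linarith
  have hi1 : Integrable (fun y => ‖x - y‖ ^ (1 - (n : ℝ)) * f y) ν := by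
    refine Integrable.of_bound
      ((measurable_newton.comp (measurable_const.sub measurable_id)).mul hf).aestronglyMeasurable
      ((dist x x₀ / 2) ^ (1 - (n : ℝ)) * F) (hfar.mono fun y hy => ?_)
    change |‖x - y‖ ^ (1 - (n : ℝ)) * f y| ≤ _
    rw [abs_mul, abs_of_nonneg (by positivity)]
    exact mul_le_mul (Real.rpow_le_rpow_of_nonpos hpos hy.2 (by linarith)) (hfF y) (abs_nonneg _)
      (by positivity)
  have hi2 : Integrable f ν := Integrable.of_bound hf.aestronglyMeasurable F (ae_of_all _ hfF)
  rw [newtonPotential, ← integral_const_mul, ← integral_sub hi1 (hi2.const_mul _)]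
  refine abs_integral_le_of_ae_le (by positivity) hm hν (hfar.mono fun y hy => ?_)
  rw [← sub_mul, abs_mul]
  refine mul_le_mul ((abs_rpow_sub_rpow_le hn hpos hy.2 ?_).trans ?_) (hfF y) (abs_nonneg _)
    (by positivity)
  · rw [← dist_eq_norm]
    linarith
  · gcongr
    refine (abs_norm_sub_norm_le _ _).trans ?_
    rw [sub_sub_sub_cancel_left, ← dist_eq_norm, dist_comm]
    exact hy.1.le

end

end PotentialBounds

section Localization

variable {n : ℕ}

local notation "𝔼" => EuclideanSpace ℝ (Fin (n + 1))

lemma integral_restrict_indicator_mul {X : Type*} [MeasurableSpace X] {ν : Measure X}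
    {B Ω : Set X} (u : X → ℝ) {a b : X → ℝ} (ha : ∀ y, y ∉ B → a y = 0)
    (hb : ∀ y, y ∉ Ω → b y = 0) :
    ∫ y in B, (Ω.indicator u y * a y) * b y ∂ν = ∫ y, u y * (a y * b y) ∂ν := by
  rw [setIntegral_eq_integral_of_forall_compl_eq_zero fun y hy => by rw [ha y hy]; ring]
  refine integral_congr_ae (ae_of_all _ fun y => ?_)
  by_cases hy : y ∈ Ω
  · simp only [indicator_of_mem hy]
    ring
  · simp only [hb y hy, mul_zero]

/-- The corrector which makes `φ u` harmonic up to sources away from `Ω`. -/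
def corrector (x₀ : EuclideanSpace ℝ (Fin (n + 1))) (r : ℝ)
    (σ : Measure (EuclideanSpace ℝ (Fin (n + 1)))) (Ω : Set (EuclideanSpace ℝ (Fin (n + 1))))
    (u φ : EuclideanSpace ℝ (Fin (n + 1)) → ℝ) (x : EuclideanSpace ℝ (Fin (n + 1))) : ℝ :=
  newtonPotential (volume.restrict (ball x₀ (4 * r))) (fun y => Ω.indicator u y * lap φ y) x
    - 2 * ∑ i, newtonGradPotential (volume.restrict (ball x₀ (4 * r))) i
        (fun y => Ω.indicator u y * partialDeriv i φ y) x
    - (∫ y in ball x₀ (4 * r), Ω.indicator u y * lap φ y) * newtonPotential σ (fun _ => 1) x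

section

variable {x₀ : EuclideanSpace ℝ (Fin (n + 1))} {r c M A : ℝ}
  {σ : Measure (EuclideanSpace ℝ (Fin (n + 1)))} {Ω : Set (EuclideanSpace ℝ (Fin (n + 1)))}
  {u φ : EuclideanSpace ℝ (Fin (n + 1)) → ℝ}

lemma abs_indicator_mul_le {a : 𝔼 → ℝ} {B : ℝ} (hM : 0 ≤ M) (huM : ∀ x ∈ Ω, |u x| ≤ M)
    (ha : ∀ x, |a x| ≤ B) (y : 𝔼) : |Ω.indicator u y * a y| ≤ M * B := by
  rw [abs_mul]
  refine mul_le_mul ?_ (ha y) (abs_nonneg _) hM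
  by_cases hy : y ∈ Ω
  · simpa [hy] using huM y hy
  · simpa [hy] using hM

lemma measurable_indicator_of_continuousOn {u : 𝔼 → ℝ} {Ω : Set 𝔼} (hΩ : IsOpen Ω)
    (hu : ContinuousOn u Ω) : Measurable (Ω.indicator u) := by
  classical
  rw [← piecewise_eq_indicator]
  exact hu.measurable_piecewise continuousOn_const hΩ.measurableSet

lemma integral_corrector_mul_lap (hn : 2 ≤ n) (hr : 0 < r) (hc : 0 ≤ c) (hM : 0 ≤ M)
    (hΩ : IsOpen Ω) (hu : ContinuousOn u Ω) (huM : ∀ x ∈ Ω, |u x| ≤ M)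
    (hφ : ContDiff ℝ (⊤ : ℕ∞) φ) (hφA : ∀ i x, |partialDeriv i φ x| ≤ A / r)
    (hφA' : ∀ x, |lap φ x| ≤ A / r ^ 2) (hσ : HasGrowth σ (c / r ^ n) n)
    (hσ1 : σ univ ≤ ENNReal.ofReal (c / r ^ n * r ^ n)) {ψ : 𝔼 → ℝ}
    (hψ : ContDiff ℝ (⊤ : ℕ∞) ψ) (hψc : HasCompactSupport ψ) :
    Continuous (corrector x₀ r σ Ω u φ) ∧
    ∫ x, corrector x₀ r σ Ω u φ x * lap ψ x =
      newtonConst n * (∫ y in ball x₀ (4 * r), (Ω.indicator u y * lap φ y) * ψ y) +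
      2 * newtonConst n * (∑ i, ∫ y in ball x₀ (4 * r),
        (Ω.indicator u y * partialDeriv i φ y) * partialDeriv i ψ y) -
      (∫ y in ball x₀ (4 * r), Ω.indicator u y * lap φ y) * (newtonConst n * ∫ y, ψ y ∂σ) := by
  obtain ⟨cv, hcv, hvol⟩ := exists_hasGrowth_volume n
  have hν : HasGrowth (volume.restrict (ball x₀ (4 * r))) cv (n + 1) :=
    hvol.mono Measure.restrict_le_self
  have hνu : volume.restrict (ball x₀ (4 * r)) univ ≤ ENNReal.ofReal (cv * (4 * r) ^ (n + 1)) := by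
    rw [Measure.restrict_apply_univ]
    exact hvol x₀ _ (by positivity)
  have : IsFiniteMeasure (volume.restrict (ball x₀ (4 * r))) :=
    ⟨hνu.trans_lt ENNReal.ofReal_lt_top⟩
  have : IsFiniteMeasure σ := ⟨hσ1.trans_lt ENNReal.ofReal_lt_top⟩
  have hum := measurable_indicator_of_continuousOn hΩ hu
  have hf0 : Measurable fun y => Ω.indicator u y * lap φ y := hum.mul hφ.lap.continuous.measurable
  have hfi : ∀ i, Measurable fun y => Ω.indicator u y * partialDeriv i φ y := fun i =>
    hum.mul (hφ.partialDeriv (m := (⊤ : ℕ∞)) le_rfl i).continuous.measurable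
  have hb0 := abs_indicator_mul_le hM huM hφA'
  have hbi := fun i => abs_indicator_mul_le hM huM (hφA i)
  have hcr : 0 ≤ c / r ^ n := by positivity
  have hc0 := continuous_newtonPotential hn n.le_succ hcv.le hν hf0 hb0
  have hci := fun i => continuous_newtonGradPotential hn n.lt_succ_self hcv.le hν (hfi i) (hbi i) i
  have hcσ := continuous_newtonPotential hn le_rfl hcr hσ (measurable_const (a := (1 : ℝ)))
    (F := 1) (fun _ => by simp)
  have hInt : ∀ {P : 𝔼 → ℝ}, Continuous P → Integrable fun x => P x * lap ψ x := fun hP =>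
    (hP.mul hψ.lap.continuous).integrable_of_hasCompactSupport hψc.lap.mul_left
  have hsum := continuous_finsetSum Finset.univ fun i _ => hci i
  refine ⟨(hc0.sub (continuous_const.mul hsum)).sub (continuous_const.mul hcσ), ?_⟩
  have h0 := integral_newtonPotential_mul_lap hn n.le_succ hcv.le (by positivity) hν hνu hf0 hb0
    hψ hψc
  have hi := fun i => integral_newtonGradPotential_mul_lap hn n.lt_succ_self hcv.le (by positivity)
    hν hνu (hfi i) (hbi i) hψ hψc i
  have hs := integral_newtonPotential_mul_lap hn le_rfl hcr hr hσ hσ1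
    (measurable_const (a := (1 : ℝ))) (F := 1) (fun _ => by simp) hψ hψc
  simp only [one_mul] at hs
  have hsum' : ∫ x, (∑ i, newtonGradPotential (volume.restrict (ball x₀ (4 * r))) i
      (fun y => Ω.indicator u y * partialDeriv i φ y) x) * lap ψ x =
      -(newtonConst n * ∑ i, ∫ y in ball x₀ (4 * r),
        (Ω.indicator u y * partialDeriv i φ y) * partialDeriv i ψ y) := by
    simp only [Finset.sum_mul]
    rw [integral_finsetSum _ fun i _ => hInt (hci i)]
    simp only [hi, Finset.sum_neg_distrib, Finset.mul_sum]
  simp only [corrector, sub_mul _ _ (lap ψ _), mul_assoc _ _ (lap ψ _)]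
  rw [integral_sub, integral_sub (hInt hc0), integral_const_mul, integral_const_mul, h0, hsum', hs]
  · ring
  · exact (hInt hsum).const_mul _
  · exact (hInt hc0).sub ((hInt hsum).const_mul _)
  · exact (hInt hcσ).const_mul _

lemma weaklyHarmonicOn_corrector (hn : 2 ≤ n) (hr : 0 < r) (hc : 0 ≤ c) (hM : 0 ≤ M)
    (hΩ : IsOpen Ω) (hu : ContinuousOn u Ω) (huM : ∀ x ∈ Ω, |u x| ≤ M)
    (huh : WeaklyHarmonicOn u Ω)
    (hφ : ContDiff ℝ (⊤ : ℕ∞) φ) (hφA : ∀ i x, |partialDeriv i φ x| ≤ A / r)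
    (hφA' : ∀ x, |lap φ x| ≤ A / r ^ 2) (hφs : tsupport φ ⊆ ball x₀ (4 * r))
    (hσ : HasGrowth σ (c / r ^ n) n)
    (hσ1 : σ univ ≤ ENNReal.ofReal (c / r ^ n * r ^ n)) (hσΩ : σ Ω = 0) :
    WeaklyHarmonicOn (fun x => newtonConst n * (φ x * u x) + corrector x₀ r σ Ω u φ x) Ω := by
  intro ψ hψ hψc hψΩ
  obtain ⟨hcw, hw⟩ := integral_corrector_mul_lap (x₀ := x₀) hn hr hc hM hΩ hu huM hφ hφA hφA' hσ hσ1
    hψ hψc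
  have hψ0 : ∀ y, y ∉ Ω → ψ y = 0 := fun y hy =>
    image_eq_zero_of_notMem_tsupport fun h => hy (hψΩ h)
  have hψi : ∀ i y, y ∉ Ω → partialDeriv i ψ y = 0 := fun i y hy =>
    partialDeriv_eq_zero_of_notMem_tsupport (fun h => hy (hψΩ h)) i
  have hφi : ∀ i y, y ∉ ball x₀ (4 * r) → partialDeriv i φ y = 0 := fun i y hy =>
    partialDeriv_eq_zero_of_notMem_tsupport (fun h => hy (hφs h)) i
  have hφl : ∀ y, y ∉ ball x₀ (4 * r) → lap φ y = 0 := fun y hy =>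
    lap_eq_zero_of_notMem_tsupport fun h => hy (hφs h)
  have hσψ : ∫ y, ψ y ∂σ = 0 := by
    refine integral_eq_zero_of_ae ?_
    filter_upwards [measure_eq_zero_iff_ae_notMem.1 hσΩ] with y hy
    exact hψ0 y hy
  rw [hσψ, integral_restrict_indicator_mul u hφl hψ0] at hw
  simp only [fun i => integral_restrict_indicator_mul (ν := volume) u (hφi i) (hψi i)] at hw
  have hInt : ∀ {g : 𝔼 → ℝ}, Continuous g → HasCompactSupport g → tsupport g ⊆ Ω →
      Integrable fun x => u x * g x := fun hg hgc hgΩ =>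
    integrable_mul_of_tsupport_subset hΩ hu hg hgc hgΩ
  have hd : ∀ (i) {g : 𝔼 → ℝ}, ContDiff ℝ (⊤ : ℕ∞) g → Continuous (partialDeriv i g) :=
    fun i g hg => (hg.partialDeriv (m := (⊤ : ℕ∞)) le_rfl i).continuous
  have h1 : Integrable fun x => u x * (φ x * lap ψ x) :=
    hInt (hφ.continuous.mul hψ.lap.continuous) hψc.lap.mul_left
      (tsupport_mul_subset_right.trans ((tsupport_lap_subset ψ).trans hψΩ))
  have h2 : ∀ i, Integrable fun x => u x * (partialDeriv i φ x * partialDeriv i ψ x) := fun i =>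
    hInt ((hd i hφ).mul (hd i hψ)) (hψc.partialDeriv i).mul_left
      (tsupport_mul_subset_right.trans ((tsupport_partialDeriv_subset i ψ).trans hψΩ))
  have h3 : Integrable fun x => u x * (lap φ x * ψ x) :=
    hInt (hφ.lap.continuous.mul hψ.continuous) hψc.mul_left (tsupport_mul_subset_right.trans hψΩ)
  have hkey := huh (fun x => φ x * ψ x) (hφ.mul hψ) hψc.mul_left
    (tsupport_mul_subset_right.trans hψΩ)
  have hexp : ∀ x, u x * lap (fun x => φ x * ψ x) x = u x * (φ x * lap ψ x) +
      2 * ∑ i, u x * (partialDeriv i φ x * partialDeriv i ψ x) + u x * (lap φ x * ψ x) :=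
    fun x => by
      rw [lap_mul (hφ.of_le two_le_infty) (hψ.of_le two_le_infty), ← Finset.mul_sum]
      ring
  simp only [hexp] at hkey
  have hs2 := integrable_finsetSum Finset.univ fun i _ => h2 i
  have h12 : Integrable fun x => u x * (φ x * lap ψ x) +
      2 * ∑ i, u x * (partialDeriv i φ x * partialDeriv i ψ x) := h1.add (hs2.const_mul 2)
  rw [integral_add h12 h3, integral_add h1 (hs2.const_mul 2),
    integral_const_mul, integral_finsetSum _ fun i _ => h2 i] at hkey
  have hsplit : ∀ x, (newtonConst n * (φ x * u x) + corrector x₀ r σ Ω u φ x) * lap ψ x =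
      newtonConst n * (u x * (φ x * lap ψ x)) + corrector x₀ r σ Ω u φ x * lap ψ x :=
    fun x => by ring
  simp only [hsplit]
  have h4 : Integrable fun x => corrector x₀ r σ Ω u φ x * lap ψ x :=
    (hcw.mul hψ.lap.continuous).integrable_of_hasCompactSupport hψc.lap.mul_left
  rw [integral_add (h1.const_mul _) h4, integral_const_mul, hw]
  linear_combination newtonConst n * hkey

lemma weaklyHarmonicOn_corrector_ball (hn : 2 ≤ n) (hr : 0 < r) (hc : 0 ≤ c) (hM : 0 ≤ M)
    (hΩ : IsOpen Ω) (hu : ContinuousOn u Ω) (huM : ∀ x ∈ Ω, |u x| ≤ M)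
    (hφ : ContDiff ℝ (⊤ : ℕ∞) φ) (hφA : ∀ i x, |partialDeriv i φ x| ≤ A / r)
    (hφA' : ∀ x, |lap φ x| ≤ A / r ^ 2) (hφ1 : ∀ x ∈ ball x₀ (2 * r), φ x = 1)
    (hσ : HasGrowth σ (c / r ^ n) n)
    (hσ1 : σ univ ≤ ENNReal.ofReal (c / r ^ n * r ^ n)) (hσx₀ : σ (ball x₀ (2 * r)) = 0) :
    WeaklyHarmonicOn (corrector x₀ r σ Ω u φ) (ball x₀ (2 * r)) := by
  intro ψ hψ hψc hψΩ
  rw [(integral_corrector_mul_lap (x₀ := x₀) hn hr hc hM hΩ hu huM hφ hφA hφA' hσ hσ1 hψ hψc).2]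
  have hψ0 : ∀ y, y ∉ ball x₀ (2 * r) → ψ y = 0 := fun y hy =>
    image_eq_zero_of_notMem_tsupport fun h => hy (hψΩ h)
  have hev : ∀ y ∈ ball x₀ (2 * r), φ =ᶠ[𝓝 y] fun _ => (1 : ℝ) := fun y hy =>
    Filter.eventuallyEq_of_mem (isOpen_ball.mem_nhds hy) hφ1
  have hpd1 : ∀ i, partialDeriv i (fun _ : 𝔼 => (1 : ℝ)) = 0 := fun i => by
    ext y
    simp [partialDeriv]
  have hσψ : ∫ y, ψ y ∂σ = 0 := by
    refine integral_eq_zero_of_ae ?_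
    filter_upwards [measure_eq_zero_iff_ae_notMem.1 hσx₀] with y hy
    exact hψ0 y hy
  have h0 : ∀ y, (Ω.indicator u y * lap φ y) * ψ y = 0 := fun y => by
    by_cases hy : y ∈ ball x₀ (2 * r)
    · rw [(hev y hy).lap_eq]
      simp [lap, hpd1, partialDeriv]
    · rw [hψ0 y hy, mul_zero]
  have h1 : ∀ i y, (Ω.indicator u y * partialDeriv i φ y) * partialDeriv i ψ y = 0 := fun i y => by
    by_cases hy : y ∈ ball x₀ (2 * r)
    · rw [((hev y hy).partialDeriv i).eq_of_nhds, hpd1]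
      simp
    · rw [partialDeriv_eq_zero_of_notMem_tsupport (fun h => hy (hψΩ h)), mul_zero]
  simp only [h0, h1, hσψ, integral_zero, mul_zero, Finset.sum_const_zero, add_zero, sub_zero]

end

end Localization

section Corrector

variable {n : ℕ}

local notation "𝔼" => EuclideanSpace ℝ (Fin (n + 1))

lemma exists_abs_corrector_le (hn : 2 ≤ n) {K c A : ℝ} (hK : 4 ≤ K) (hc : 0 < c) (hA : 0 < A) :
    ∃ C : ℝ, 0 < C ∧ ∀ (Ω : Set (EuclideanSpace ℝ (Fin (n + 1))))
      (u φ : EuclideanSpace ℝ (Fin (n + 1)) → ℝ) (x₀ : EuclideanSpace ℝ (Fin (n + 1))) (M r : ℝ)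
      (σ : Measure (EuclideanSpace ℝ (Fin (n + 1)))), IsOpen Ω → 0 ≤ M → 0 < r →
      ContinuousOn u Ω → (∀ x ∈ Ω, |u x| ≤ M) → ContDiff ℝ (⊤ : ℕ∞) φ →
      (∀ i x, |partialDeriv i φ x| ≤ A / r) → (∀ x, |lap φ x| ≤ A / r ^ 2) →
      HasGrowth σ (c / r ^ n) n → σ univ ≤ ENNReal.ofReal (c / r ^ n * r ^ n) →
      σ univ = 1 → σ (ball x₀ (K * r))ᶜ = 0 →
      ∀ x, |corrector x₀ r σ Ω u φ x| ≤ C * M * (r / (r + dist x x₀)) ^ n := by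
  have hn' : (2 : ℝ) ≤ n := by exact_mod_cast hn
  obtain ⟨cv, hcv, hvol⟩ := exists_hasGrowth_volume n
  obtain ⟨C0, hC0, h0⟩ := exists_abs_newtonPotential_le hn n.le_succ
  obtain ⟨C1, hC1, h1⟩ := exists_abs_newtonGradPotential_le hn n.lt_succ_self
  obtain ⟨C2, hC2, h2⟩ := exists_abs_newtonPotential_le hn le_rfl
  set N1 : ℝ := A * (cv * (C0 * 16)) + 2 * ((n + 1) * (A * (cv * (C1 * 4)))) +
    A * cv * 4 ^ (n + 1) * (c * C2) with hN1
  set N2 : ℝ := (2 * K + 2 * (n + 1)) * n * A * cv * 4 ^ (n + 1) with hN2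
  have hN1' : 0 < N1 := by positivity
  have hN2' : 0 < N2 := by positivity
  refine ⟨N1 * (1 + 2 * K) ^ n + N2 * 4 ^ n, by positivity,
    fun Ω u φ x₀ M r σ hΩ hM hr hu huM hφ hφA hφA' hσ hσ1 hσ2 hσK x => ?_⟩
  have hν : HasGrowth (volume.restrict (ball x₀ (4 * r))) cv (n + 1) :=
    hvol.mono Measure.restrict_le_self
  have hνu : volume.restrict (ball x₀ (4 * r)) univ ≤ ENNReal.ofReal (cv * (4 * r) ^ (n + 1)) := by
    rw [Measure.restrict_apply_univ]
    exact hvol x₀ _ (by positivity)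
  have hum := measurable_indicator_of_continuousOn hΩ hu
  have hf0 : Measurable fun y => Ω.indicator u y * lap φ y := hum.mul hφ.lap.continuous.measurable
  have hfi : ∀ i, Measurable fun y => Ω.indicator u y * partialDeriv i φ y := fun i =>
    hum.mul (hφ.partialDeriv (m := (⊤ : ℕ∞)) le_rfl i).continuous.measurable
  have hb0 := abs_indicator_mul_le hM huM hφA'
  have hbi := fun i => abs_indicator_mul_le hM huM (hφA i)
  have hq : |∫ y in ball x₀ (4 * r), Ω.indicator u y * lap φ y| ≤
      M * (A / r ^ 2) * (cv * (4 * r) ^ (n + 1)) :=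
    abs_integral_le_of_ae_le (by positivity) (by positivity) hνu (ae_of_all _ hb0)
  have hd : 0 ≤ dist x x₀ := dist_nonneg
  have htri : ∀ a b e : ℝ, |a - 2 * b - e| ≤ |a - e| + 2 * |b| := fun a b e => by
    rw [show a - 2 * b - e = (a - e) - 2 * b by ring]
    refine (abs_sub _ _).trans_eq ?_
    rw [abs_mul, abs_of_pos (two_pos : (0 : ℝ) < 2)]
  rw [corrector]
  refine (htri _ _ _).trans ?_
  rcases le_or_gt (dist x x₀) (2 * (K * r)) with hx | hx
  · have e0 := h0 _ cv (4 * r) _ _ hcv.le (by positivity) (by positivity) hν hνu hf0 hb0 x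
    have ei := fun i => h1 _ cv (4 * r) _ _ hcv.le (by positivity) (by positivity) hν hνu (hfi i)
      (hbi i) i x
    have eσ := h2 _ (c / r ^ n) r 1 _ (by positivity) hr zero_le_one hσ hσ1
      (measurable_const (a := (1 : ℝ))) (fun _ => by simp) x
    rw [show (((n + 1 : ℕ) : ℝ) - (n - 1)) = (2 : ℕ) by push_cast; ring, Real.rpow_natCast] at e0
    rw [show ((n : ℝ) - (n - 1)) = 1 by ring, Real.rpow_one] at eσ
    simp only [show (((n + 1 : ℕ) : ℝ) - n) = 1 by push_cast; ring, Real.rpow_one] at ei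
    have esum := (Finset.abs_sum_le_sum_abs _ _).trans
      (Finset.sum_le_card_nsmul Finset.univ _ _ fun i _ => ei i)
    rw [Finset.card_univ, Fintype.card_fin, nsmul_eq_mul] at esum
    have eprod := mul_le_mul hq eσ (abs_nonneg _) (by positivity)
    rw [← abs_mul] at eprod
    have hle : (1 : ℝ) ≤ (1 + 2 * K) ^ n * (r / (r + dist x x₀)) ^ n := by
      rw [← mul_pow]
      refine one_le_pow₀ ?_
      rw [← mul_div_assoc, one_le_div (by positivity)]
      linarith
    calc _ ≤ N1 * M := by
          refine (add_le_add ((abs_sub _ _).trans (add_le_add e0 eprod))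
            (mul_le_mul_of_nonneg_left esum zero_le_two)).trans_eq ?_
          rw [hN1]
          push_cast
          field_simp
          ring
      _ ≤ N1 * M * ((1 + 2 * K) ^ n * (r / (r + dist x x₀)) ^ n) :=
          le_mul_of_one_le_right (by positivity) hle
      _ ≤ _ := by
          have : 0 ≤ N2 * 4 ^ n * M * (r / (r + dist x x₀)) ^ n := by positivity
          linarith
  · have hKr : 0 < K * r := by positivity
    have hd0 : 0 < dist x x₀ := by linarith
    have hνK : volume.restrict (ball x₀ (4 * r)) (ball x₀ (K * r))ᶜ = 0 := by
      rw [Measure.restrict_apply measurableSet_ball.compl]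
      refine measure_mono_null (fun y hy => ?_) (measure_empty (μ := volume))
      exact hy.1 (ball_subset_ball (by gcongr) hy.2)
    have e0 := abs_newtonPotential_sub_le_of_far hn hKr (by positivity) (by positivity) hνu hνK hf0
      hb0 hx.le
    have ei := fun i => abs_newtonGradPotential_le_of_far hn hKr (by positivity) (by positivity) hνu
      hνK (hbi i) hx.le i
    have eσ := abs_newtonPotential_sub_le_of_far hn hKr zero_le_one zero_le_one
      (by rw [hσ2, ENNReal.ofReal_one]) hσK (measurable_const (a := (1 : ℝ))) (fun _ => by simp)
      hx.le
    rw [integral_const, Measure.real, hσ2, ENNReal.toReal_one, one_smul, mul_one] at eσ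
    have esum := (Finset.abs_sum_le_sum_abs _ _).trans
      (Finset.sum_le_card_nsmul Finset.univ _ _ fun i _ => ei i)
    rw [Finset.card_univ, Fintype.card_fin, nsmul_eq_mul] at esum
    have eprod := mul_le_mul hq eσ (abs_nonneg _) (by positivity)
    rw [← abs_mul] at eprod
    have hdecay : (dist x x₀ / 2) ^ (-(n : ℝ)) ≤ 4 ^ n * (r / (r + dist x x₀)) ^ n / r ^ n := by
      rw [Real.rpow_neg (by positivity), Real.rpow_natCast, div_pow r, mul_div_assoc, div_div,
        mul_comm (_ ^ n) (r ^ n), ← div_div, div_self (by positivity), ← div_eq_mul_one_div,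
        ← div_pow, ← inv_pow]
      gcongr
      rw [inv_div, div_le_div_iff₀ hd0 (by positivity)]
      nlinarith
    generalize hQ : (∫ y in ball x₀ (4 * r), Ω.indicator u y * lap φ y) = q at *
    have hsplit : ∀ P Q G : ℝ, P - q * Q = (P - G * q) - q * (Q - G) := fun P Q G => by ring
    rw [hsplit _ _ (‖x - x₀‖ ^ (1 - (n : ℝ)))]
    calc _ ≤ N2 * M * r ^ n * (dist x x₀ / 2) ^ (-(n : ℝ)) := by
          refine (add_le_add ((abs_sub _ _).trans (add_le_add e0 eprod))
            (mul_le_mul_of_nonneg_left esum zero_le_two)).trans_eq ?_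
          rw [hN2]
          push_cast
          field_simp
          ring
      _ ≤ N2 * M * r ^ n * (4 ^ n * (r / (r + dist x x₀)) ^ n / r ^ n) := by gcongr
      _ = N2 * 4 ^ n * M * (r / (r + dist x x₀)) ^ n := by
          field_simp
      _ ≤ _ := by
          have : 0 ≤ N1 * (1 + 2 * K) ^ n * M * (r / (r + dist x x₀)) ^ n := by positivity
          linarith

end Corrector

section HarmonicLocalization

variable {n : ℕ}

local notation "𝔼" => EuclideanSpace ℝ (Fin (n + 1))

lemma IsHarmonicOn.weaklyHarmonicOn {u : 𝔼 → ℝ} {Ω : Set 𝔼} (hΩ : IsOpen Ω)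
    (hu : IsHarmonicOn u Ω) : WeaklyHarmonicOn u Ω := by
  intro ψ hψ hψc hψΩ
  rw [integral_mul_lap hΩ hu.1 (hψ.of_le two_le_infty) hψc hψΩ]
  refine integral_eq_zero_of_ae (ae_of_all _ fun x => ?_)
  change lap u x * ψ x = 0
  by_cases hx : x ∈ Ω
  · rw [show lap u x = 0 from hu.2 x hx, zero_mul]
  · rw [image_eq_zero_of_notMem_tsupport fun h => hx (hψΩ h), mul_zero]

lemma WeaklyHarmonicOn.isHarmonicOn (hn : 2 ≤ n) {u : 𝔼 → ℝ} {Ω : Set 𝔼} (hΩ : IsOpen Ω)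
    (h : WeaklyHarmonicOn u Ω) (hu : ContinuousOn u Ω) : IsHarmonicOn u Ω :=
  ⟨(h.contDiffOn hn hΩ hu).of_le two_le_infty, fun _ hx => h.lap_eq_zero hn hΩ hu hx⟩

lemma tendsto_div_add_dist_pow_cocompact (hn : 2 ≤ n) (r : ℝ) (x₀ : 𝔼) :
    Tendsto (fun x => (r / (r + dist x x₀)) ^ n) (cocompact 𝔼) (𝓝 0) := by
  have h1 : Tendsto (fun x => r + dist x x₀) (cocompact 𝔼) atTop :=
    tendsto_atTop_add_const_left _ r (tendsto_dist_right_cocompact_atTop x₀)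
  have h2 := (h1.const_div_atTop r).pow n
  rwa [zero_pow (by omega)] at h2

/-- A bounded harmonic function can be replaced near a boundary point by a harmonic function which
decays away from that point, up to an error with controlled gradient. -/
lemma exists_harmonic_localization (hn : 2 ≤ n) {K c : ℝ} (hK : 4 ≤ K) (hc : 0 < c) :
    ∃ C : ℝ, 0 < C ∧ ∀ (Ω : Set (EuclideanSpace ℝ (Fin (n + 1))))
      (u : EuclideanSpace ℝ (Fin (n + 1)) → ℝ) (x₀ : EuclideanSpace ℝ (Fin (n + 1))) (M r : ℝ)
      (σ : Measure (EuclideanSpace ℝ (Fin (n + 1)))), IsOpen Ω → 0 ≤ M → 0 < r →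
      MemC0Closure Ω u → IsHarmonicOn u Ω → (∀ x ∈ Ω, |u x| ≤ M) →
      HasGrowth σ (c / r ^ n) n → σ univ ≤ ENNReal.ofReal (c / r ^ n * r ^ n) →
      σ univ = 1 → σ Ω = 0 → σ (ball x₀ (2 * r)) = 0 → σ (ball x₀ (K * r))ᶜ = 0 →
      ∃ v : EuclideanSpace ℝ (Fin (n + 1)) → ℝ, MemC0Closure Ω v ∧ IsHarmonicOn v Ω ∧
        (∀ x ∈ Ω, |v x| ≤ C * M * (r / (r + dist x x₀)) ^ n) ∧
        ∀ x ∈ ball x₀ r ∩ Ω, ‖fderiv ℝ u x‖ ≤ C * (‖fderiv ℝ v x‖ + M / r) := by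
  obtain ⟨A, hA, hcut⟩ := exists_cutoff n
  obtain ⟨C, hC, hcorr⟩ := exists_abs_corrector_le hn hK hc hA
  obtain ⟨G, hG, hgrad⟩ := exists_norm_fderiv_le hn
  have hκ : newtonConst n ≠ 0 := (newtonConst_neg hn).ne
  refine ⟨(|newtonConst n| * 5 ^ n + C) + |newtonConst n|⁻¹ * (1 + G * C), by positivity,
    fun Ω u x₀ M r σ hΩ hM hr huC hu huM hσ hσ1 hσ2 hσΩ hσx₀ hσK => ?_⟩
  obtain ⟨φ, hφ, hφ0, hφ1, hφe, hφs, hφA, hφA'⟩ := hcut x₀ r hr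
  have huc : ContinuousOn u Ω := huC.1.mono subset_closure
  have huw := hu.weaklyHarmonicOn hΩ
  set w := corrector x₀ r σ Ω u φ with hw
  have hwc : Continuous w := (integral_corrector_mul_lap hn hr hc.le hM hΩ huc huM hφ hφA hφA' hσ
    hσ1 (ψ := 0) contDiff_const HasCompactSupport.zero).1
  have hwb : ∀ x, |w x| ≤ C * M * (r / (r + dist x x₀)) ^ n :=
    hcorr Ω u φ x₀ M r σ hΩ hM hr huc huM hφ hφA hφA' hσ hσ1 hσ2 hσK
  set v : 𝔼 → ℝ := fun x => newtonConst n * (φ x * u x) + w x with hv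
  have hvc : ContinuousOn v (closure Ω) :=
    (continuousOn_const.mul (hφ.continuous.continuousOn.mul huC.1)).add hwc.continuousOn
  have hvh : IsHarmonicOn v Ω := (weaklyHarmonicOn_corrector hn hr hc.le hM hΩ huc huM huw hφ hφA
    hφA' hφs hσ hσ1 hσΩ).isHarmonicOn hn hΩ (hvc.mono subset_closure)
  have hww := weaklyHarmonicOn_corrector_ball hn hr hc.le hM hΩ huc huM hφ hφA hφA' hφe hσ hσ1 hσx₀
  refine ⟨v, ⟨hvc, ?_⟩, hvh, fun x hx => ?_, fun x hx => ?_⟩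
  · have h1 : Tendsto w (cocompact 𝔼) (𝓝 0) := squeeze_zero_norm hwb (by
      simpa using (tendsto_div_add_dist_pow_cocompact hn r x₀).const_mul (C * M))
    refine (h1.congr' ?_).mono_left inf_le_left
    filter_upwards [(isCompact_closedBall x₀ (4 * r)).compl_mem_cocompact] with y hy
    have : φ y = 0 := image_eq_zero_of_notMem_tsupport fun h =>
      hy (ball_subset_closedBall (hφs h))
    simp [hv, this]
  · have h1 : |newtonConst n * (φ x * u x)| ≤
        |newtonConst n| * 5 ^ n * M * (r / (r + dist x x₀)) ^ n := by
      by_cases hx4 : x ∈ ball x₀ (4 * r)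
      · have h2 : |φ x * u x| ≤ M := by
          rw [abs_mul, abs_of_nonneg (hφ0 x)]
          exact (mul_le_of_le_one_left (abs_nonneg _) (hφ1 x)).trans (huM x hx)
        have h3 : (1 : ℝ) ≤ 5 ^ n * (r / (r + dist x x₀)) ^ n := by
          rw [← mul_pow]
          refine one_le_pow₀ ?_
          rw [← mul_div_assoc, one_le_div (by positivity)]
          linarith [mem_ball.1 hx4]
        rw [abs_mul]
        calc _ ≤ |newtonConst n| * M := by gcongr
          _ ≤ |newtonConst n| * M * (5 ^ n * (r / (r + dist x x₀)) ^ n) :=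
              le_mul_of_one_le_right (by positivity) h3
          _ = _ := by ring
      · rw [image_eq_zero_of_notMem_tsupport fun h => hx4 (hφs h), zero_mul, mul_zero, abs_zero]
        positivity
    have h2 : 0 ≤ |newtonConst n|⁻¹ * (1 + G * C) * M * (r / (r + dist x x₀)) ^ n := by positivity
    refine (abs_add_le _ _).trans ((add_le_add h1 (hwb x)).trans ?_)
    linarith
  · have hx2 : ball x r ⊆ ball x₀ (2 * r) := ball_subset_ball' (by linarith [mem_ball.1 hx.1])
    have hxx : x ∈ ball x₀ (2 * r) := hx2 (mem_ball_self hr)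
    have hwd : DifferentiableAt ℝ w x := ((hww.contDiffOn hn isOpen_ball
      hwc.continuousOn).contDiffAt (isOpen_ball.mem_nhds hxx)).differentiableAt (by simp)
    have hvd : DifferentiableAt ℝ v x :=
      (hvh.1.contDiffAt (hΩ.mem_nhds hx.2)).differentiableAt (by norm_num)
    have hue : u =ᶠ[𝓝 x] fun y => (newtonConst n)⁻¹ * (v y - w y) := by
      filter_upwards [isOpen_ball.mem_nhds hxx] with y hy
      simp only [hv, hφe y hy]
      field_simp
      ring
    have hwg : ‖fderiv ℝ w x‖ ≤ G * (C * M) / r :=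
      hgrad w x r (C * M) hr (fun ψ h1 h2 h3 => hww ψ h1 h2 (h3.trans hx2)) hwc.continuousOn
        fun y _ => (hwb y).trans (mul_le_of_le_one_right (by positivity)
          (pow_le_one₀ (by positivity) (by
            rw [div_le_one (by positivity)]
            linarith [dist_nonneg (x := y) (y := x₀)])))
    have hvw : DifferentiableAt ℝ (fun y => v y - w y) x := hvd.sub hwd
    rw [hue.fderiv_eq, fderiv_const_mul hvw, fderiv_fun_sub hvd hwd, norm_smul, norm_inv,
      Real.norm_eq_abs]
    calc _ ≤ |newtonConst n|⁻¹ * (‖fderiv ℝ v x‖ + G * (C * M) / r) := by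
          gcongr
          exact (norm_sub_le _ _).trans (by gcongr)
      _ = |newtonConst n|⁻¹ * (1 * ‖fderiv ℝ v x‖ + (G * C) * (M / r)) := by ring
      _ ≤ |newtonConst n|⁻¹ * ((1 + G * C) * ‖fderiv ℝ v x‖ + (1 + G * C) * (M / r)) := by
          gcongr
          · linarith [mul_pos hG hC]
          · linarith
      _ = |newtonConst n|⁻¹ * (1 + G * C) * (‖fderiv ℝ v x‖ + M / r) := by ring
      _ ≤ _ := by
          gcongr
          have : 0 ≤ |newtonConst n| * 5 ^ n + C := by positivity
          linarith

end HarmonicLocalization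

section AhlforsRegular

variable {n d : ℕ}

lemma ADRegularWith.measure_lt_top {c₀ : ℝ} {E : Set (EuclideanSpace ℝ (Fin d))}
    (hE : IsClosed E) (h : ADRegularWith c₀ n E) (h0 : Metric.ediam E ≠ 0)
    (htop : Metric.ediam E ≠ ⊤) : μH[(n : ℝ)] E < ⊤ := by
  have hD : 0 < (Metric.ediam E).toReal := ENNReal.toReal_pos h0 htop
  refine (Metric.isCompact_of_isClosed_isBounded hE
    (Metric.isBounded_iff_ediam_ne_top.2 htop)).measure_lt_top_of_nhdsWithin fun x hx =>
    ⟨ball x (Metric.ediam E).toReal ∩ E,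
      inter_comm E _ ▸ inter_mem_nhdsWithin E (ball_mem_nhds x hD),
      (h x hx _ hD ?_).2.trans_lt ENNReal.ofReal_lt_top⟩
  exact (ENNReal.ofReal_toReal htop).le

/-- The upper regularity bound extends to all centres and all radii. -/
lemma ADRegularWith.exists_hasGrowth (hn : 0 < n) {c₀ : ℝ} (hc₀ : 0 < c₀)
    {E : Set (EuclideanSpace ℝ (Fin d))} (hE : IsClosed E) (h : ADRegularWith c₀ n E) :
    ∃ c : ℝ, 1 ≤ c ∧ HasGrowth (μH[(n : ℝ)].restrict E) c n := by
  set D := (Metric.ediam E).toReal with hD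
  set m := (μH[(n : ℝ)] E).toReal with hm
  have hm0 : 0 ≤ m := ENNReal.toReal_nonneg
  have hD0 : 0 ≤ D := ENNReal.toReal_nonneg
  have hq : 0 ≤ m * 2 ^ n / D ^ n := by positivity
  have hq' : 0 < c₀ * 2 ^ n := by positivity
  refine ⟨c₀ * 2 ^ n + m * 2 ^ n / D ^ n + 1, by linarith, fun x ρ hρ => ?_⟩
  have hρn : 0 < ρ ^ n := by positivity
  rw [Measure.restrict_apply measurableSet_ball]
  rcases le_or_gt (ENNReal.ofReal (2 * ρ)) (Metric.ediam E) with hle | hlt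
  · rcases (ball x ρ ∩ E).eq_empty_or_nonempty with he | ⟨y, hy⟩
    · simp [he]
    · refine (measure_mono (inter_subset_inter_left _
        (ball_subset_ball' (y := y) (ε₂ := 2 * ρ) ?_))).trans
        ((h y hy.2 (2 * ρ) (by positivity) hle).2.trans (ENNReal.ofReal_le_ofReal ?_))
      · rw [dist_comm]
        linarith [mem_ball.1 hy.1]
      · rw [mul_pow, ← mul_assoc]
        gcongr
        linarith
  · have htop : Metric.ediam E ≠ ⊤ := (hlt.trans ENNReal.ofReal_lt_top).ne
    rcases eq_or_ne (Metric.ediam E) 0 with h0 | h0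
    · have : NullSingletonClass (μH[(n : ℝ)] : Measure (EuclideanSpace ℝ (Fin d))) :=
        Measure.nullSingletonClass_hausdorff _ (by exact_mod_cast hn)
      rw [((Metric.ediam_eq_zero_iff.1 h0).anti inter_subset_right).measure_zero]
      exact zero_le
    · have hlt' : D < 2 * ρ := (ENNReal.lt_ofReal_iff_toReal_lt htop).1 hlt
      have hDpos : 0 < D := ENNReal.toReal_pos h0 htop
      have hmE : μH[(n : ℝ)] E = ENNReal.ofReal m :=
        (ENNReal.ofReal_toReal (h.measure_lt_top hE h0 htop).ne).symm
      refine (measure_mono inter_subset_right).trans (hmE.trans_le (ENNReal.ofReal_le_ofReal ?_))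
      calc m = m * 1 := (mul_one m).symm
        _ ≤ m * ((2 * ρ) ^ n / D ^ n) := by
            gcongr
            rw [one_le_div (by positivity)]
            gcongr
        _ = m * 2 ^ n / D ^ n * ρ ^ n := by ring
        _ ≤ _ := by
            gcongr
            linarith

/-- A normalized piece of surface measure in an annulus around a boundary point. -/
lemma exists_annular_measure {c₀ c K : ℝ} (hc₀ : 0 < c₀) (hc : 1 ≤ c) (hn : n ≠ 0) (hK1 : 1 ≤ K)
    (hK : c₀ * (c * 2 ^ n + 1) ≤ K) {Ω : Set (EuclideanSpace ℝ (Fin d))} (hΩ : IsOpen Ω)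
    (h : ADRegularWith c₀ n (frontier Ω)) (hg : HasGrowth (μH[(n : ℝ)].restrict (frontier Ω)) c n)
    {x₀ : EuclideanSpace ℝ (Fin d)} (hx₀ : x₀ ∈ frontier Ω) {r : ℝ} (hr : 0 < r)
    (hrK : ENNReal.ofReal (K * r) ≤ Metric.ediam (frontier Ω)) :
    ∃ σ : Measure (EuclideanSpace ℝ (Fin d)), HasGrowth σ (c / r ^ n) n ∧ σ univ = 1 ∧
      σ Ω = 0 ∧ σ (ball x₀ (2 * r)) = 0 ∧ σ (ball x₀ (K * r))ᶜ = 0 := by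
  set μ := (μH[(n : ℝ)] : Measure (EuclideanSpace ℝ (Fin d))).restrict (frontier Ω) with hμ
  set T := ball x₀ (K * r) \ ball x₀ (2 * r) with hT
  have hTm : MeasurableSet T := measurableSet_ball.diff measurableSet_ball
  have hKr : 0 < K * r := by positivity
  have h1 : ENNReal.ofReal (c₀⁻¹ * (K * r) ^ n) ≤ μ (ball x₀ (K * r)) := by
    rw [hμ, Measure.restrict_apply measurableSet_ball]
    exact (h x₀ hx₀ _ hKr hrK).1
  have h2 := hg x₀ (2 * r) (by positivity)
  have hTlow : ENNReal.ofReal (r ^ n) ≤ μ T := by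
    refine le_trans ?_ le_measure_sdiff
    refine le_trans ?_ (tsub_le_tsub h1 h2)
    rw [← ENNReal.ofReal_sub _ (by positivity)]
    refine ENNReal.ofReal_le_ofReal ?_
    have h3 : c * 2 ^ n + 1 ≤ c₀⁻¹ * K ^ n := by
      rw [inv_mul_eq_div, le_div_iff₀ hc₀]
      linarith [le_self_pow₀ hK1 hn]
    have h4 := mul_le_mul_of_nonneg_right h3 (by positivity : 0 ≤ r ^ n)
    rw [mul_pow, mul_pow]
    linarith
  have hTtop : μ T ≠ ⊤ :=
    ((measure_mono sdiff_subset).trans_lt ((hg x₀ _ hKr).trans_lt ENNReal.ofReal_lt_top)).ne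
  have hrn : 0 < r ^ n := by positivity
  have hT0 : μ T ≠ 0 := ((ENNReal.ofReal_pos.2 hrn).trans_le hTlow).ne'
  refine ⟨(μ T)⁻¹ • μ.restrict T, fun x ρ hρ => ?_, ?_, ?_, ?_, ?_⟩
  · rw [Measure.smul_apply, smul_eq_mul]
    calc _ ≤ (ENNReal.ofReal (r ^ n))⁻¹ * ENNReal.ofReal (c * ρ ^ n) :=
          mul_le_mul' (ENNReal.inv_le_inv.2 hTlow)
            ((Measure.restrict_apply_le _ _).trans (hg x ρ hρ))
      _ = _ := by
          rw [← ENNReal.ofReal_inv_of_pos hrn, ← ENNReal.ofReal_mul (by positivity)]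
          congr 1
          ring
  · rw [Measure.smul_apply, Measure.restrict_apply_univ, smul_eq_mul,
      ENNReal.inv_mul_cancel hT0 hTtop]
  · have : μ Ω = 0 := by
      rw [hμ, Measure.restrict_apply hΩ.measurableSet, hΩ.inter_frontier_eq, measure_empty]
    rw [Measure.smul_apply, nonpos_iff_eq_zero.1 ((Measure.restrict_apply_le _ _).trans this.le),
      smul_zero]
  · rw [Measure.smul_apply, Measure.restrict_apply measurableSet_ball,
      show ball x₀ (2 * r) ∩ T = ∅ by
        ext
        simp only [hT, mem_inter_iff, Set.mem_sdiff, mem_empty_iff_false]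
        tauto,
      measure_empty, smul_zero]
  · rw [Measure.smul_apply, Measure.restrict_apply measurableSet_ball.compl,
      show (ball x₀ (K * r))ᶜ ∩ T = ∅ by
        ext
        simp only [hT, mem_inter_iff, Set.mem_sdiff, mem_empty_iff_false, mem_compl_iff]
        tauto,
      measure_empty, smul_zero]

end AhlforsRegular

section SquareFunction

variable {n d : ℕ}

/-- The part of the domain whose distance to the boundary is at most the boundary diameter. -/
def nearRegion (Ω : Set (EuclideanSpace ℝ (Fin d))) : Set (EuclideanSpace ℝ (Fin d)) :=
  {y | y ∈ Ω ∧ ENNReal.ofReal (infDist y (frontier Ω)) ≤ Metric.ediam (frontier Ω)}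

lemma measurableSet_nearRegion {Ω : Set (EuclideanSpace ℝ (Fin d))} (hΩ : IsOpen Ω) :
    MeasurableSet (nearRegion Ω) :=
  hΩ.measurableSet.inter (measurableSet_le
    (ENNReal.measurable_ofReal.comp (continuous_infDist_pt _).measurable) measurable_const)

lemma infDist_frontier_pos {Ω : Set (EuclideanSpace ℝ (Fin d))} (hΩ : IsOpen Ω)
    (hne : (frontier Ω).Nonempty) {y : EuclideanSpace ℝ (Fin d)} (hy : y ∈ Ω) :
    0 < infDist y (frontier Ω) :=
  (isClosed_frontier.notMem_iff_infDist_pos hne).1 fun h => by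
    have : y ∈ Ω ∩ frontier Ω := ⟨hy, h⟩
    rwa [hΩ.inter_frontier_eq] at this

lemma nnnorm_gradient (v : EuclideanSpace ℝ (Fin d) → ℝ) (y : EuclideanSpace ℝ (Fin d)) :
    ‖gradient v y‖₊ = ‖fderiv ℝ v y‖₊ := by
  rw [gradient]
  exact LinearIsometryEquiv.nnnorm_map _ _

lemma measurable_nnnorm_gradient (v : EuclideanSpace ℝ (Fin d) → ℝ) :
    Measurable fun y => (‖gradient v y‖₊ : ℝ≥0∞) := by
  simp only [nnnorm_gradient]
  exact (measurable_fderiv ℝ v).nnnorm.coe_nnreal_ennreal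

lemma sqFun_sq (Ω : Set (EuclideanSpace ℝ (Fin d))) (v : EuclideanSpace ℝ (Fin d) → ℝ)
    (x : EuclideanSpace ℝ (Fin d)) : sqFun n Ω v x ^ 2 = ∫⁻ y in cone Ω x,
      (‖gradient v y‖₊ : ℝ≥0∞) ^ 2 *
        ENNReal.ofReal (infDist y (frontier Ω) ^ ((1 : ℝ) - n)) := by
  rw [sqFun, ← ENNReal.rpow_natCast, ← ENNReal.rpow_mul]
  norm_num

/-- Carleson-box integrals of `|∇v|² δ` are controlled by the square function. -/
lemma ADRegularWith.lintegral_gradient_sq_le_sqFun {c₀ c : ℝ} (hc₀ : 0 < c₀)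
    {Ω : Set (EuclideanSpace ℝ (Fin d))} (hΩ : IsOpen Ω) (h : ADRegularWith c₀ n (frontier Ω))
    (hg : HasGrowth (μH[(n : ℝ)].restrict (frontier Ω)) c n) (v : EuclideanSpace ℝ (Fin d) → ℝ)
    {x₀ : EuclideanSpace ℝ (Fin d)} (hx₀ : x₀ ∈ frontier Ω) {r : ℝ} (hr : 0 < r) :
    ∫⁻ y in ball x₀ r ∩ nearRegion Ω,
        (‖gradient v y‖₊ : ℝ≥0∞) ^ 2 * ENNReal.ofReal (infDist y (frontier Ω)) ≤
      ENNReal.ofReal c₀ *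
        ∫⁻ x in ball x₀ (3 * r), sqFun n Ω v x ^ 2 ∂μH[(n : ℝ)].restrict (frontier Ω) := by
  have hne : (frontier Ω).Nonempty := ⟨x₀, hx₀⟩
  set μ := ((μH[(n : ℝ)] : Measure (EuclideanSpace ℝ (Fin d))).restrict
    (frontier Ω)).restrict (ball x₀ (3 * r)) with hμ
  have : IsFiniteMeasure μ := ⟨by
    rw [hμ, Measure.restrict_apply_univ]
    exact (hg x₀ _ (by positivity)).trans_lt ENNReal.ofReal_lt_top⟩
  set g : EuclideanSpace ℝ (Fin d) → ℝ≥0∞ := fun y => (‖gradient v y‖₊ : ℝ≥0∞) ^ 2 *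
    ENNReal.ofReal (infDist y (frontier Ω) ^ ((1 : ℝ) - n)) with hgdef
  have hgm : Measurable g := ((measurable_nnnorm_gradient v).pow_const 2).mul
    (((continuous_infDist_pt _).measurable.pow_const _).ennreal_ofReal)
  set T : Set (EuclideanSpace ℝ (Fin d) × EuclideanSpace ℝ (Fin d)) :=
    {q | q.1 ∈ Ω ∧ dist q.2 q.1 < 2 * infDist q.1 (frontier Ω)} with hT
  have hTo : IsOpen T := (hΩ.preimage continuous_fst).inter (isOpen_lt
    (continuous_snd.dist continuous_fst)
    (continuous_const.mul ((continuous_infDist_pt _).comp continuous_fst)))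
  have hcone : ∀ x y, y ∈ cone Ω x ↔ (y, x) ∈ T := fun x y => Iff.rfl
  have hconeo : ∀ x, MeasurableSet (cone Ω x) := fun x =>
    (hTo.preimage (by fun_prop : Continuous fun y : EuclideanSpace ℝ (Fin d) =>
      (y, x))).measurableSet
  have hpt : ∀ y ∈ ball x₀ r ∩ nearRegion Ω,
      (‖gradient v y‖₊ : ℝ≥0∞) ^ 2 * ENNReal.ofReal (infDist y (frontier Ω)) ≤
        ENNReal.ofReal c₀ * ∫⁻ x, (cone Ω x).indicator g y ∂μ := by
    rintro y ⟨hyB, hyΩ, hyd⟩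
    set δ := infDist y (frontier Ω) with hδ
    have hδ0 : 0 < δ := infDist_frontier_pos hΩ hne hyΩ
    have hδr : δ < r := (infDist_le_dist_of_mem hx₀).trans_lt hyB
    obtain ⟨z, hz, hyz⟩ := isClosed_frontier.exists_infDist_eq_dist hne y
    have hsub : ball z δ ⊆ ball x₀ (3 * r) := ball_subset_ball' (by
      have := dist_triangle z y x₀
      rw [dist_comm z y, ← hyz] at this
      linarith [mem_ball.1 hyB])
    have hmem : ∀ x ∈ ball z δ, y ∈ cone Ω x := fun x hx => ⟨hyΩ, by
      have := dist_triangle x z y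
      rw [dist_comm z y, ← hyz] at this
      linarith [mem_ball.1 hx]⟩
    have hlow : ENNReal.ofReal (c₀⁻¹ * δ ^ n) ≤ μ (ball z δ) := by
      rw [hμ, Measure.restrict_apply measurableSet_ball, inter_eq_left.2 hsub,
        Measure.restrict_apply measurableSet_ball]
      exact (h z hz δ hδ0 hyd).1
    calc _ = ENNReal.ofReal c₀ * (g y * ENNReal.ofReal (c₀⁻¹ * δ ^ n)) := by
          rw [hgdef, mul_assoc, ← ENNReal.ofReal_mul (by positivity), mul_left_comm,
            ← ENNReal.ofReal_mul hc₀.le, ← hδ, mul_left_comm c₀, mul_inv_cancel_left₀ hc₀.ne',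
            ← Real.rpow_natCast δ n, ← Real.rpow_add hδ0, sub_add_cancel, Real.rpow_one]
      _ ≤ ENNReal.ofReal c₀ * (g y * μ (ball z δ)) := by gcongr
      _ = ENNReal.ofReal c₀ * ∫⁻ x in ball z δ, g y ∂μ := by rw [setLIntegral_const]
      _ ≤ ENNReal.ofReal c₀ * ∫⁻ x in ball z δ, (cone Ω x).indicator g y ∂μ := by
          refine mul_le_mul_right (setLIntegral_mono' measurableSet_ball fun x hx => ?_) _
          rw [indicator_of_mem (hmem x hx)]
      _ ≤ _ := mul_le_mul_right (setLIntegral_le_lintegral _ _) _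
  calc _ ≤ ∫⁻ y in ball x₀ r ∩ nearRegion Ω,
        ENNReal.ofReal c₀ * ∫⁻ x, (cone Ω x).indicator g y ∂μ :=
        setLIntegral_mono' (measurableSet_ball.inter (measurableSet_nearRegion hΩ)) hpt
    _ ≤ ∫⁻ y, ENNReal.ofReal c₀ * (∫⁻ x, (cone Ω x).indicator g y ∂μ) :=
        setLIntegral_le_lintegral _ _
    _ = ENNReal.ofReal c₀ * ∫⁻ y, (∫⁻ x, (cone Ω x).indicator g y ∂μ) :=
        lintegral_const_mul' _ _ ENNReal.ofReal_ne_top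
    _ = ENNReal.ofReal c₀ * ∫⁻ x, (∫⁻ y, (cone Ω x).indicator g y) ∂μ := by
        congr 1
        refine lintegral_lintegral_swap ?_
        have : (fun q : EuclideanSpace ℝ (Fin d) × EuclideanSpace ℝ (Fin d) =>
            (cone Ω q.2).indicator g q.1) = T.indicator fun q => g q.1 := by
          ext q
          by_cases hq : q ∈ T
          · rw [indicator_of_mem hq, indicator_of_mem ((hcone _ _).2 hq)]
          · rw [indicator_of_notMem hq, indicator_of_notMem (mt (hcone _ _).1 hq)]
        change AEMeasurable (fun q : EuclideanSpace ℝ (Fin d) × EuclideanSpace ℝ (Fin d) =>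
            (cone Ω q.2).indicator g q.1) _
        rw [this]
        exact ((hgm.comp measurable_fst).indicator hTo.measurableSet).aemeasurable
    _ = _ := by
        congr 1
        refine lintegral_congr fun x => ?_
        rw [lintegral_indicator (hconeo x), sqFun_sq]

lemma ENNReal.sq_le_add_rpow {p M : ℝ} (hp : 2 ≤ p) (hM : 0 < M) (s : ℝ≥0∞) :
    s ^ 2 ≤ ENNReal.ofReal (M ^ 2) + ENNReal.ofReal (M ^ (2 - p)) * s ^ p := by
  rcases le_or_gt s (ENNReal.ofReal M) with h | h
  · refine le_add_right ?_
    rw [ENNReal.ofReal_pow hM.le]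
    gcongr
  · refine le_add_left ?_
    rcases eq_or_ne s ⊤ with rfl | hs
    · rw [ENNReal.top_rpow_of_pos (by linarith),
        ENNReal.mul_top (ENNReal.ofReal_pos.2 (by positivity)).ne']
      exact le_top
    · lift s to ℝ≥0 using hs
      have hsM : M < s := by
        rwa [← ENNReal.ofReal_coe_nnreal, ENNReal.ofReal_lt_ofReal_iff_of_nonneg hM.le] at h
      have hs0 : (0 : ℝ) < s := hM.trans hsM
      rw [← ENNReal.ofReal_coe_nnreal, ENNReal.ofReal_rpow_of_pos hs0,
        ← ENNReal.ofReal_mul (by positivity), ← ENNReal.ofReal_pow hs0.le]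
      refine ENNReal.ofReal_le_ofReal ?_
      calc (s : ℝ) ^ 2 = (s : ℝ) ^ (2 - p) * (s : ℝ) ^ p := by
            rw [← Real.rpow_add hs0, sub_add_cancel, Real.rpow_two]
        _ ≤ _ := by
            gcongr ?_ * _
            exact Real.rpow_le_rpow_of_nonpos hM hsM.le (by linarith)

/-- An `L^p` bound on the maximal function together with the `S < N` estimate bounds
the Carleson-box integral. -/
lemma ADRegularWith.lintegral_gradient_sq_le {c₀ c p Cp B M : ℝ} (hc₀ : 0 < c₀) (hc : 0 ≤ c)
    (hp : 2 ≤ p) (hCp : 0 < Cp) (hB : 0 ≤ B) (hM : 0 < M)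
    {Ω : Set (EuclideanSpace ℝ (Fin d))} (hΩ : IsOpen Ω) (h : ADRegularWith c₀ n (frontier Ω))
    (hg : HasGrowth (μH[(n : ℝ)].restrict (frontier Ω)) c n) {v : EuclideanSpace ℝ (Fin d) → ℝ}
    (hSN : (∫⁻ x in frontier Ω, sqFun n Ω v x ^ p ∂μH[(n : ℝ)]) ^ (1 / p) ≤
        ENNReal.ofReal Cp *
          (∫⁻ x in frontier Ω, ntMaximal Ω v x ^ p ∂μH[(n : ℝ)]) ^ (1 / p))
    {x₀ : EuclideanSpace ℝ (Fin d)} (hx₀ : x₀ ∈ frontier Ω) {r : ℝ} (hr : 0 < r)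
    (hN : ∫⁻ x in frontier Ω, ntMaximal Ω v x ^ p ∂μH[(n : ℝ)] ≤
      ENNReal.ofReal (B * M ^ p * r ^ n)) :
    ∫⁻ y in ball x₀ r ∩ nearRegion Ω,
        (‖gradient v y‖₊ : ℝ≥0∞) ^ 2 * ENNReal.ofReal (infDist y (frontier Ω)) ≤
      ENNReal.ofReal (c₀ * (c * 3 ^ n + Cp ^ p * B) * M ^ 2 * r ^ n) := by
  have hp0 : 0 < p := by linarith
  have hS : ∫⁻ x in frontier Ω, sqFun n Ω v x ^ p ∂μH[(n : ℝ)] ≤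
      ENNReal.ofReal (Cp ^ p * (B * M ^ p * r ^ n)) := by
    have h1 := ENNReal.rpow_le_rpow hSN hp0.le
    rw [ENNReal.mul_rpow_of_nonneg _ _ hp0.le, ← ENNReal.rpow_mul, ← ENNReal.rpow_mul,
      one_div_mul_cancel hp0.ne', ENNReal.rpow_one, ENNReal.rpow_one,
      ENNReal.ofReal_rpow_of_pos hCp] at h1
    rw [ENNReal.ofReal_mul (by positivity)]
    exact h1.trans (mul_le_mul_right hN _)
  refine (h.lintegral_gradient_sq_le_sqFun hc₀ hΩ hg v hx₀ hr).trans ?_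
  calc _ ≤ ENNReal.ofReal c₀ * ∫⁻ x in ball x₀ (3 * r), (ENNReal.ofReal (M ^ 2) +
          ENNReal.ofReal (M ^ (2 - p)) * sqFun n Ω v x ^ p) ∂μH[(n : ℝ)].restrict (frontier Ω) :=
        mul_le_mul_right (lintegral_mono fun x => ENNReal.sq_le_add_rpow hp hM _) _
    _ = ENNReal.ofReal c₀ * (ENNReal.ofReal (M ^ 2) *
          μH[(n : ℝ)].restrict (frontier Ω) (ball x₀ (3 * r)) + ENNReal.ofReal (M ^ (2 - p)) *
          ∫⁻ x in ball x₀ (3 * r), sqFun n Ω v x ^ p ∂μH[(n : ℝ)].restrict (frontier Ω)) := by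
        rw [lintegral_add_left measurable_const, setLIntegral_const,
          lintegral_const_mul' _ _ ENNReal.ofReal_ne_top]
    _ ≤ ENNReal.ofReal c₀ * (ENNReal.ofReal (M ^ 2) * ENNReal.ofReal (c * (3 * r) ^ n) +
          ENNReal.ofReal (M ^ (2 - p)) * ENNReal.ofReal (Cp ^ p * (B * M ^ p * r ^ n))) := by
        gcongr
        · exact hg x₀ _ (by positivity)
        · exact (setLIntegral_le_lintegral _ _).trans hS
    _ = _ := by
        rw [← ENNReal.ofReal_mul (by positivity), ← ENNReal.ofReal_mul (by positivity),
          ← ENNReal.ofReal_add (by positivity) (by positivity), ← ENNReal.ofReal_mul hc₀.le]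
        congr 1
        have : M ^ (2 - p) * M ^ p = M ^ 2 := by
          rw [← Real.rpow_add hM, sub_add_cancel, Real.rpow_two]
        rw [mul_pow]
        linear_combination c₀ * Cp ^ p * B * r ^ n * this

end SquareFunction

section CarlesonEstimate

variable {n d : ℕ}

lemma dist_le_three_mul_of_mem_cone {Ω : Set (EuclideanSpace ℝ (Fin d))}
    {x y x₀ : EuclideanSpace ℝ (Fin d)} (hx₀ : x₀ ∈ frontier Ω) (hy : y ∈ cone Ω x) :
    dist x x₀ ≤ 3 * dist y x₀ := by
  linarith [dist_triangle x y x₀, hy.2, infDist_le_dist_of_mem (x := y) hx₀]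

lemma ntMaximal_le_of_forall_le {Ω : Set (EuclideanSpace ℝ (Fin d))}
    {v : EuclideanSpace ℝ (Fin d) → ℝ} {x : EuclideanSpace ℝ (Fin d)} {a : ℝ}
    (h : ∀ y ∈ cone Ω x, |v y| ≤ a) : ntMaximal Ω v x ≤ ENNReal.ofReal a := by
  refine iSup₂_le fun y hy => ?_
  rw [← ENNReal.ofReal_coe_nnreal]
  exact ENNReal.ofReal_le_ofReal (h y hy)

lemma exists_lintegral_ntMaximal_rpow_le (hn : 0 < n) {c A p : ℝ} (hc : 0 ≤ c) (hA : 0 ≤ A)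
    (hp : 2 ≤ p) : ∃ B : ℝ, 0 ≤ B ∧ ∀ (Ω : Set (EuclideanSpace ℝ (Fin d)))
      (v : EuclideanSpace ℝ (Fin d) → ℝ) (x₀ : EuclideanSpace ℝ (Fin d)) (M r : ℝ),
      HasGrowth (μH[(n : ℝ)].restrict (frontier Ω)) c n → x₀ ∈ frontier Ω → 0 < r → 0 ≤ M →
      (∀ y ∈ Ω, |v y| ≤ A * M * (r / (r + dist y x₀)) ^ n) →
      ∫⁻ x in frontier Ω, ntMaximal Ω v x ^ p ∂μH[(n : ℝ)] ≤
        ENNReal.ofReal (B * M ^ p * r ^ n) := by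
  obtain ⟨C, hC, htail⟩ := exists_lintegral_tail_le (X := EuclideanSpace ℝ (Fin d)) n hn
  refine ⟨(A * 3 ^ n) ^ p * (c * C), by positivity, fun Ω v x₀ M r hg hx₀ hr hM hv => ?_⟩
  have hp0 : 0 ≤ p := by linarith
  have hpt : ∀ x, ntMaximal Ω v x ^ p ≤ ENNReal.ofReal ((A * 3 ^ n * M) ^ p) *
      ENNReal.ofReal ((r / (r + dist x x₀)) ^ (2 * n)) := fun x => by
    have ht0 : 0 < r / (r + dist x x₀) := by positivity
    have ht1 : r / (r + dist x x₀) ≤ 1 :=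
      div_le_one_of_le₀ (by linarith [dist_nonneg (x := x) (y := x₀)]) (by positivity)
    have h1 : ntMaximal Ω v x ≤
        ENNReal.ofReal (A * 3 ^ n * M * (r / (r + dist x x₀)) ^ n) := by
      refine ntMaximal_le_of_forall_le fun y hy => (hv y hy.1).trans ?_
      have h3 : r / (r + dist y x₀) ≤ 3 * (r / (r + dist x x₀)) := by
        rw [mul_div_assoc', div_le_div_iff₀ (by positivity) (by positivity)]
        nlinarith [dist_le_three_mul_of_mem_cone hx₀ hy]
      calc _ ≤ A * M * (3 * (r / (r + dist x x₀))) ^ n := by gcongr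
        _ = _ := by ring
    refine (ENNReal.rpow_le_rpow h1 hp0).trans ?_
    rw [ENNReal.ofReal_rpow_of_nonneg (by positivity) hp0, ← ENNReal.ofReal_mul (by positivity)]
    refine ENNReal.ofReal_le_ofReal ?_
    rw [Real.mul_rpow (by positivity) (by positivity)]
    gcongr
    rw [← Real.rpow_natCast, ← Real.rpow_natCast, ← Real.rpow_mul ht0.le]
    refine Real.rpow_le_rpow_of_exponent_ge ht0 ht1 ?_
    push_cast
    nlinarith [(n.cast_nonneg : (0 : ℝ) ≤ n)]
  calc _ ≤ ∫⁻ x in frontier Ω, ENNReal.ofReal ((A * 3 ^ n * M) ^ p) *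
        ENNReal.ofReal ((r / (r + dist x x₀)) ^ (2 * n)) ∂μH[(n : ℝ)] := lintegral_mono hpt
    _ ≤ ENNReal.ofReal ((A * 3 ^ n * M) ^ p) * ENNReal.ofReal (c * (C * r ^ n)) := by
      rw [lintegral_const_mul' _ _ ENNReal.ofReal_ne_top]
      exact mul_le_mul_right (htail _ c hc hg x₀ r hr) _
    _ = _ := by
      rw [← ENNReal.ofReal_mul (by positivity), Real.mul_rpow (by positivity) hM]
      congr 1
      ring

lemma nnnorm_gradient_sq_mul_ofReal (v : EuclideanSpace ℝ (Fin d) → ℝ)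
    (y : EuclideanSpace ℝ (Fin d)) (t : ℝ) :
    (‖gradient v y‖₊ : ℝ≥0∞) ^ 2 * ENNReal.ofReal t =
      ENNReal.ofReal (‖fderiv ℝ v y‖ ^ 2 * t) := by
  rw [nnnorm_gradient, ← ENNReal.ofReal_coe_nnreal, ← ENNReal.ofReal_pow (by positivity),
    ← ENNReal.ofReal_mul (by positivity), coe_nnnorm]

/-- The Carleson estimate on balls that are small compared with the boundary. -/
lemma ADRegularWith.exists_lintegral_gradient_sq_le_of_le_ediam (hn : 2 ≤ n) {c₀ c p Cp : ℝ}
    (hc₀ : 0 < c₀) (hc : 1 ≤ c) (hp : 2 ≤ p) (hCp : 0 < Cp) {K : ℝ} (hK4 : 4 ≤ K)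
    (hK : c₀ * (c * 2 ^ n + 1) ≤ K) {Ω : Set (EuclideanSpace ℝ (Fin (n + 1)))} (hΩ : IsOpen Ω)
    (h : ADRegularWith c₀ n (frontier Ω)) (hg : HasGrowth (μH[(n : ℝ)].restrict (frontier Ω)) c n)
    (hSN : ∀ u : EuclideanSpace ℝ (Fin (n + 1)) → ℝ,
      MemC0Closure Ω u → IsHarmonicOn u Ω →
      (∫⁻ x in frontier Ω, sqFun n Ω u x ^ p ∂μH[(n : ℝ)]) ^ (1 / p) ≤
        ENNReal.ofReal Cp *
          (∫⁻ x in frontier Ω, ntMaximal Ω u x ^ p ∂μH[(n : ℝ)]) ^ (1 / p)) :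
    ∃ C : ℝ, 0 < C ∧ ∀ (u : EuclideanSpace ℝ (Fin (n + 1)) → ℝ) (M : ℝ), 0 < M →
      MemC0Closure Ω u → IsHarmonicOn u Ω → (∀ x ∈ Ω, |u x| ≤ M) →
      ∀ x₀ ∈ frontier Ω, ∀ r : ℝ, 0 < r → ENNReal.ofReal (K * r) ≤ Metric.ediam (frontier Ω) →
        ∫⁻ y in ball x₀ r ∩ Ω,
            (‖gradient u y‖₊ : ℝ≥0∞) ^ 2 * ENNReal.ofReal (infDist y (frontier Ω)) ≤
          ENNReal.ofReal (C * M ^ 2 * r ^ n) := by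
  have hc0 : 0 < c := by linarith
  obtain ⟨A, hA, hloc⟩ := exists_harmonic_localization hn hK4 hc0
  obtain ⟨B, hB, hnt⟩ := exists_lintegral_ntMaximal_rpow_le (d := n + 1) (by omega : 0 < n)
    hc0.le hA.le hp
  obtain ⟨V, hV, hvol⟩ := exists_hasGrowth_volume n
  refine ⟨2 * A ^ 2 * (c₀ * (c * 3 ^ n + Cp ^ p * B) + V), by positivity,
    fun u M hM huC hu huM x₀ hx₀ r hr hrK => ?_⟩
  obtain ⟨σ, hσ, hσ1, hσΩ, hσ2, hσK⟩ := exists_annular_measure hc₀ hc (by omega) (by linarith) hK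
    hΩ h hg hx₀ hr hrK
  obtain ⟨v, hvC, hv, hvb, hgrad⟩ := hloc Ω u x₀ M r σ hΩ hM.le hr huC hu huM hσ
    (by rw [hσ1, div_mul_cancel₀ _ (by positivity)]; simpa using hc) hσ1 hσΩ hσ2 hσK
  have hmain := h.lintegral_gradient_sq_le hc₀ hc0.le hp hCp hB hM hΩ hg (hSN v hvC hv) hx₀ hr
    (hnt Ω v x₀ M r hg hx₀ hr hM.le hvb)
  have hsub : ball x₀ r ∩ Ω = ball x₀ r ∩ nearRegion Ω := by
    refine Subset.antisymm (fun y hy => ⟨hy.1, hy.2, le_trans ?_ hrK⟩)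
      (fun y hy => ⟨hy.1, hy.2.1⟩)
    exact ENNReal.ofReal_le_ofReal (by
      nlinarith [infDist_le_dist_of_mem (x := y) hx₀, mem_ball.1 hy.1])
  have hpt : ∀ y ∈ ball x₀ r ∩ Ω,
      (‖gradient u y‖₊ : ℝ≥0∞) ^ 2 * ENNReal.ofReal (infDist y (frontier Ω)) ≤
        ENNReal.ofReal (2 * A ^ 2) * ((‖gradient v y‖₊ : ℝ≥0∞) ^ 2 *
          ENNReal.ofReal (infDist y (frontier Ω)) + ENNReal.ofReal (M ^ 2 / r)) := by
    intro y hy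
    have hδ0 : 0 ≤ infDist y (frontier Ω) := infDist_nonneg
    have hδr : infDist y (frontier Ω) ≤ r :=
      (infDist_le_dist_of_mem hx₀).trans (mem_ball.1 hy.1).le
    rw [nnnorm_gradient_sq_mul_ofReal, nnnorm_gradient_sq_mul_ofReal,
      ← ENNReal.ofReal_add (by positivity) (by positivity), ← ENNReal.ofReal_mul (by positivity)]
    refine ENNReal.ofReal_le_ofReal ?_
    set δ := infDist y (frontier Ω)
    set a := ‖fderiv ℝ v y‖
    have h1 : M ^ 2 / r ^ 2 * δ ≤ M ^ 2 / r := by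
      calc _ ≤ M ^ 2 / r ^ 2 * r := by gcongr
        _ = _ := by field_simp
    calc _ ≤ (A * (a + M / r)) ^ 2 * δ := by
          gcongr
          exact hgrad y hy
      _ ≤ 2 * A ^ 2 * (a ^ 2 + M ^ 2 / r ^ 2) * δ := by
          gcongr
          rw [← div_pow]
          nlinarith [mul_nonneg (sq_nonneg A) (sq_nonneg (a - M / r))]
      _ = 2 * A ^ 2 * (a ^ 2 * δ + M ^ 2 / r ^ 2 * δ) := by ring
      _ ≤ _ := by gcongr
  calc _ ≤ ∫⁻ y in ball x₀ r ∩ Ω, ENNReal.ofReal (2 * A ^ 2) * ((‖gradient v y‖₊ : ℝ≥0∞) ^ 2 *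
          ENNReal.ofReal (infDist y (frontier Ω)) + ENNReal.ofReal (M ^ 2 / r)) :=
        setLIntegral_mono' (measurableSet_ball.inter hΩ.measurableSet) hpt
    _ = ENNReal.ofReal (2 * A ^ 2) * ((∫⁻ y in ball x₀ r ∩ nearRegion Ω,
          (‖gradient v y‖₊ : ℝ≥0∞) ^ 2 * ENNReal.ofReal (infDist y (frontier Ω))) +
          ENNReal.ofReal (M ^ 2 / r) * volume (ball x₀ r ∩ Ω)) := by
        rw [lintegral_const_mul' _ _ ENNReal.ofReal_ne_top, lintegral_add_right _ measurable_const,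
          setLIntegral_const, ← hsub]
    _ ≤ ENNReal.ofReal (2 * A ^ 2) * (ENNReal.ofReal (c₀ * (c * 3 ^ n + Cp ^ p * B) * M ^ 2 * r ^ n)
          + ENNReal.ofReal (M ^ 2 / r) * ENNReal.ofReal (V * r ^ (n + 1))) := by
        gcongr
        exact (measure_mono inter_subset_left).trans (hvol x₀ r hr)
    _ = _ := by
        rw [← ENNReal.ofReal_mul (by positivity),
          ← ENNReal.ofReal_add (by positivity) (by positivity),
          ← ENNReal.ofReal_mul (by positivity)]
        congr 1
        field_simp
        ring

lemma ball_infDist_frontier_subset {Ω : Set (EuclideanSpace ℝ (Fin d))} (hΩ : IsOpen Ω)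
    {y : EuclideanSpace ℝ (Fin d)} (hy : y ∈ Ω) : ball y (infDist y (frontier Ω)) ⊆ Ω := by
  rcases (infDist_nonneg (x := y) (s := frontier Ω)).eq_or_lt with h0 | h0
  · simp [← h0]
  refine (convex_ball y _).isPreconnected.subset_left_of_subset_union hΩ
    isClosed_closure.isOpen_compl (disjoint_compl_right.mono_left subset_closure)
    (fun z hz => ?_) ⟨y, mem_ball_self h0, hy⟩
  by_contra hcon
  simp only [mem_union, mem_compl_iff, not_or, not_not] at hcon
  have hzf : z ∈ frontier Ω := by
    rw [hΩ.frontier_eq]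
    exact ⟨hcon.2, hcon.1⟩
  have := infDist_le_dist_of_mem (x := y) hzf
  rw [dist_comm] at this
  exact absurd (mem_ball.1 hz) (not_lt.2 this)

/-- The Carleson estimate on balls that are not small compared with the boundary. -/
lemma ADRegularWith.exists_lintegral_gradient_sq_le_of_ediam_lt (hn : 2 ≤ n) {c₀ c p Cp : ℝ}
    (hc₀ : 0 < c₀) (hc : 0 < c) (hp : 2 ≤ p) (hCp : 0 < Cp) {K : ℝ} (hK : 0 < K)
    {Ω : Set (EuclideanSpace ℝ (Fin (n + 1)))} (hΩ : IsOpen Ω)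
    (h : ADRegularWith c₀ n (frontier Ω)) (hg : HasGrowth (μH[(n : ℝ)].restrict (frontier Ω)) c n)
    (hSN : ∀ u : EuclideanSpace ℝ (Fin (n + 1)) → ℝ,
      MemC0Closure Ω u → IsHarmonicOn u Ω →
      (∫⁻ x in frontier Ω, sqFun n Ω u x ^ p ∂μH[(n : ℝ)]) ^ (1 / p) ≤
        ENNReal.ofReal Cp *
          (∫⁻ x in frontier Ω, ntMaximal Ω u x ^ p ∂μH[(n : ℝ)]) ^ (1 / p)) :
    ∃ C : ℝ, 0 < C ∧ ∀ (u : EuclideanSpace ℝ (Fin (n + 1)) → ℝ) (M : ℝ), 0 < M →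
      MemC0Closure Ω u → IsHarmonicOn u Ω → (∀ x ∈ Ω, |u x| ≤ M) →
      ∀ x₀ ∈ frontier Ω, ∀ r : ℝ, 0 < r → Metric.ediam (frontier Ω) < ENNReal.ofReal (K * r) →
        ∫⁻ y in ball x₀ r ∩ Ω,
            (‖gradient u y‖₊ : ℝ≥0∞) ^ 2 * ENNReal.ofReal (infDist y (frontier Ω)) ≤
          ENNReal.ofReal (C * M ^ 2 * r ^ n) := by
  obtain ⟨G, hG, hgrad⟩ := exists_norm_fderiv_le hn
  obtain ⟨V, hV, hvol⟩ := exists_hasGrowth_volume n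
  obtain ⟨A, hA, hInt⟩ := exists_lintegral_ball_rpow_le (X := EuclideanSpace ℝ (Fin (n + 1)))
    (n + 1) 1 one_pos (by push_cast; linarith [(Nat.cast_pos.2 (by omega) : (0 : ℝ) < n)])
  refine ⟨c₀ * (c * 3 ^ n + Cp ^ p * (c * K ^ n)) + 2 * G ^ 2 * (V * A), by positivity,
    fun u M hM huC hu huM x₀ hx₀ r hr hrK => ?_⟩
  have hp0 : 0 ≤ p := by linarith
  have hne : (frontier Ω).Nonempty := ⟨x₀, hx₀⟩
  have hN : ∫⁻ x in frontier Ω, ntMaximal Ω u x ^ p ∂μH[(n : ℝ)] ≤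
      ENNReal.ofReal (c * K ^ n * M ^ p * r ^ n) := by
    have hsub : frontier Ω ⊆ ball x₀ (K * r) := fun x hx => by
      have := (Metric.edist_le_ediam_of_mem hx hx₀).trans_lt hrK
      rwa [edist_dist, ENNReal.ofReal_lt_ofReal_iff (by positivity)] at this
    have hfin : μH[(n : ℝ)] (frontier Ω) ≤ ENNReal.ofReal (c * (K * r) ^ n) := by
      have := hg x₀ (K * r) (by positivity)
      rwa [Measure.restrict_apply measurableSet_ball, inter_eq_right.2 hsub] at this
    calc _ ≤ ∫⁻ _ in frontier Ω, ENNReal.ofReal (M ^ p) ∂μH[(n : ℝ)] :=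
          lintegral_mono fun x => by
            rw [← ENNReal.ofReal_rpow_of_nonneg hM.le hp0]
            exact ENNReal.rpow_le_rpow
              (ntMaximal_le_of_forall_le fun y hy => huM y hy.1) hp0
      _ ≤ ENNReal.ofReal (M ^ p) * ENNReal.ofReal (c * (K * r) ^ n) := by
          rw [setLIntegral_const]
          exact mul_le_mul_right hfin _
      _ = _ := by
          rw [← ENNReal.ofReal_mul (by positivity)]
          congr 1
          ring
  have hnear := h.lintegral_gradient_sq_le hc₀ hc.le hp hCp (by positivity) hM hΩ hg
    (hSN u huC hu) hx₀ hr hN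
  have hpt : ∀ y ∈ ball x₀ r ∩ (Ω \ nearRegion Ω),
      (‖gradient u y‖₊ : ℝ≥0∞) ^ 2 * ENNReal.ofReal (infDist y (frontier Ω)) ≤
        ENNReal.ofReal (2 * G ^ 2 * M ^ 2) * ENNReal.ofReal (dist x₀ y ^ (-1 : ℝ)) := by
    rintro y ⟨-, hyΩ, hyn⟩
    have hsub := ball_infDist_frontier_subset hΩ hyΩ
    have hδ0 : 0 < infDist y (frontier Ω) := infDist_frontier_pos hΩ hne hyΩ
    have hδ : infDist y (frontier Ω) ≤ dist y x₀ := infDist_le_dist_of_mem hx₀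
    have hD : Metric.ediam (frontier Ω) < ENNReal.ofReal (infDist y (frontier Ω)) :=
      not_le.1 fun hle => hyn ⟨hyΩ, hle⟩
    obtain ⟨z, hz, hyz⟩ := isClosed_frontier.exists_infDist_eq_dist hne y
    have hzx : dist z x₀ < infDist y (frontier Ω) := by
      have := (Metric.edist_le_ediam_of_mem hz hx₀).trans_lt hD
      rwa [edist_dist, ENNReal.ofReal_lt_ofReal_iff hδ0] at this
    have hder := hgrad u y _ M hδ0
      (fun ψ h1 h2 h3 => hu.weaklyHarmonicOn hΩ ψ h1 h2 (h3.trans hsub))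
      (huC.1.mono (hsub.trans subset_closure)) fun w hw => huM w (hsub hw)
    rw [nnnorm_gradient_sq_mul_ofReal, ← ENNReal.ofReal_mul (by positivity)]
    refine ENNReal.ofReal_le_ofReal ?_
    have hdist := dist_triangle y z x₀
    rw [← hyz] at hdist
    rw [Real.rpow_neg_one, dist_comm x₀ y]
    set δ := infDist y (frontier Ω)
    have hd0 : 0 < dist y x₀ := hδ0.trans_le hδ
    calc _ ≤ (G * M / δ) ^ 2 * δ := by gcongr
      _ = G ^ 2 * M ^ 2 * δ⁻¹ := by field_simp
      _ ≤ G ^ 2 * M ^ 2 * (2 * (dist y x₀)⁻¹) := by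
          gcongr
          rw [← div_eq_mul_inv, inv_eq_one_div, div_le_div_iff₀ hδ0 hd0]
          linarith
      _ = _ := by ring
  have hfar : ∫⁻ y in ball x₀ r ∩ (Ω \ nearRegion Ω),
      (‖gradient u y‖₊ : ℝ≥0∞) ^ 2 * ENNReal.ofReal (infDist y (frontier Ω)) ≤
        ENNReal.ofReal (2 * G ^ 2 * M ^ 2 * (V * (A * r ^ n))) := by
    have h1 := hInt volume V hV.le hvol x₀ r hr
    rw [Nat.cast_add, Nat.cast_one, add_sub_cancel_right, Real.rpow_natCast] at h1
    calc _ ≤ ∫⁻ y in ball x₀ r ∩ (Ω \ nearRegion Ω),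
          ENNReal.ofReal (2 * G ^ 2 * M ^ 2) * ENNReal.ofReal (dist x₀ y ^ (-1 : ℝ)) :=
          setLIntegral_mono' (measurableSet_ball.inter
            (hΩ.measurableSet.diff (measurableSet_nearRegion hΩ))) hpt
      _ ≤ ENNReal.ofReal (2 * G ^ 2 * M ^ 2) * ∫⁻ y in ball x₀ r,
          ENNReal.ofReal (dist x₀ y ^ (-1 : ℝ)) := by
          rw [lintegral_const_mul' _ _ ENNReal.ofReal_ne_top]
          exact mul_le_mul_right (lintegral_mono_set inter_subset_left) _
      _ ≤ _ := by
          rw [ENNReal.ofReal_mul (p := 2 * G ^ 2 * M ^ 2) (by positivity)]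
          exact mul_le_mul_right h1 _
  calc _ ≤ ∫⁻ y in (ball x₀ r ∩ nearRegion Ω) ∪ (ball x₀ r ∩ (Ω \ nearRegion Ω)),
        (‖gradient u y‖₊ : ℝ≥0∞) ^ 2 * ENNReal.ofReal (infDist y (frontier Ω)) := by
        refine lintegral_mono_set ?_
        rw [← inter_union_distrib_left, union_sdiff_self]
        exact inter_subset_inter_right _ subset_union_right
    _ ≤ _ := lintegral_union_le _ _ _
    _ ≤ _ := add_le_add hnear hfar
    _ = _ := by
        rw [← ENNReal.ofReal_add (by positivity) (by positivity)]
        congr 1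
        ring

end CarlesonEstimate

/-- for `n ≥ 2`, the `S < N` estimate in `L^p(μ)`, `p ∈ [2,∞)`, implies
the square-function Carleson measure estimate for all harmonic functions in
`C₀(closure Ω)`. -/
theorem carlesonMeasureEstimate_of_SN
    (n : ℕ) (hn : 2 ≤ n) (Ω : Set (EuclideanSpace ℝ (Fin (n + 1))))
    (hΩ : IsOpen Ω) (hcs : Corkscrew Ω) (hADR : ADRegular n (frontier Ω))
    (p : ℝ) (hp : 2 ≤ p) (Cp : ℝ) (hCp : 0 < Cp)
    (hSN : ∀ u : EuclideanSpace ℝ (Fin (n + 1)) → ℝ,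
      MemC0Closure Ω u → IsHarmonicOn u Ω →
      (∫⁻ x in frontier Ω, sqFun n Ω u x ^ p ∂μH[(n : ℝ)]) ^ (1 / p) ≤
        ENNReal.ofReal Cp *
          (∫⁻ x in frontier Ω, ntMaximal Ω u x ^ p ∂μH[(n : ℝ)]) ^ (1 / p)) :
    ∃ C : ℝ, 0 < C ∧
      ∀ (u : EuclideanSpace ℝ (Fin (n + 1)) → ℝ) (M : ℝ),
        MemC0Closure Ω u → IsHarmonicOn u Ω → (∀ x ∈ Ω, |u x| ≤ M) →
        ∀ x₀ ∈ frontier Ω, ∀ r : ℝ, 0 < r →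
          ∫ x in ball x₀ r ∩ Ω, ‖gradient u x‖ ^ 2 * infDist x (frontier Ω) ≤
            C * M ^ 2 * r ^ n := by
  obtain ⟨c₀, hc₀, h⟩ := hADR
  obtain ⟨c, hc, hg⟩ := h.exists_hasGrowth (by omega) hc₀ isClosed_frontier
  set K := max 4 (c₀ * (c * 2 ^ n + 1))
  have hK4 : 4 ≤ K := le_max_left _ _
  obtain ⟨C₁, hC₁, hsmall⟩ := h.exists_lintegral_gradient_sq_le_of_le_ediam hn hc₀ hc hp hCp hK4
    (le_max_right _ _) hΩ hg hSN
  obtain ⟨C₂, hC₂, hlarge⟩ := h.exists_lintegral_gradient_sq_le_of_ediam_lt hn hc₀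
    (by linarith : 0 < c) hp hCp (by linarith : 0 < K) hΩ hg hSN
  refine ⟨max C₁ C₂, lt_max_of_lt_left hC₁, fun u M huC hu huM x₀ hx₀ r hr => ?_⟩
  obtain ⟨y, hy⟩ : Ω.Nonempty := closure_nonempty_iff.1 ⟨x₀, frontier_subset_closure hx₀⟩
  rcases ((abs_nonneg _).trans (huM y hy)).eq_or_lt with rfl | hM
  · refine (setIntegral_eq_zero_of_forall_eq_zero fun x hx => ?_).trans_le (by simp)
    have hu0 : u =ᶠ[𝓝 x] fun _ => 0 := by
      filter_upwards [hΩ.mem_nhds hx.2] with z hz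
      exact abs_nonpos_iff.1 (huM z hz)
    simp [gradient, hu0.fderiv_eq]
  have hmain : ∫⁻ y in ball x₀ r ∩ Ω,
      (‖gradient u y‖₊ : ℝ≥0∞) ^ 2 * ENNReal.ofReal (infDist y (frontier Ω)) ≤
        ENNReal.ofReal (max C₁ C₂ * M ^ 2 * r ^ n) := by
    rcases le_or_gt (ENNReal.ofReal (K * r)) (Metric.ediam (frontier Ω)) with hr' | hr'
    · refine (hsmall u M hM huC hu huM x₀ hx₀ r hr hr').trans (ENNReal.ofReal_le_ofReal ?_)
      gcongr
      exact le_max_left _ _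
    · refine (hlarge u M hM huC hu huM x₀ hx₀ r hr hr').trans (ENNReal.ofReal_le_ofReal ?_)
      gcongr
      exact le_max_right _ _
  refine (Real.le_norm_self _).trans ((norm_integral_le_lintegral_norm _).trans
    (ENNReal.toReal_le_of_le_ofReal (by positivity) (le_trans (le_of_eq ?_) hmain)))
  refine lintegral_congr fun x => ?_
  rw [Real.norm_of_nonneg (mul_nonneg (sq_nonneg _) infDist_nonneg),
    ENNReal.ofReal_mul (sq_nonneg _), ENNReal.ofReal_pow (norm_nonneg _), ofReal_norm]
  rfl
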